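/- arXiv:2511.15508 — 5 statements merged into one kernel-verified Lean document; each statement's English description precedes it below -/
import Mathlib

section
/- Let k > t ≥ 1 be integers and let n ≥ \binom{t+2}{2}·k² (where \binom{t+2}{2} = (t+2)(t+1)/2). If F ⊆ \binom{[n]}{k} is a t-intersecting family, then the (k+2)-th largest degree satisfies d_{k+2}(F) ≤ \binom{n-t-1}{k-t-1}. -/
open Finset

/-- The degree of `x` in the family `F`: the number of members of `F` containing `x`. -/
def degree (F : Finset (Finset ℕ)) (x : ℕ) : ℕ :=
  (F.filter fun A => x ∈ A).card

/-- The `i`-th largest degree (1-indexed) of the family `F` on ground set `[n] = {1, …, n}`: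
the `i`-th entry of the list of degrees of all `n` elements arranged in nonincreasing order. -/
def nthDegree (n : ℕ) (F : Finset (Finset ℕ)) (i : ℕ) : ℕ :=
  (((Finset.Icc 1 n).val.map (degree F)).sort (· ≥ ·)).getD (i - 1) 0

def PB (n k m : ℕ) : ℕ := if m ≤ k then (n - m).choose (k - m) else 0

def FS (F : Finset (Finset ℕ)) (S : Finset ℕ) : Finset (Finset ℕ) := F.filter fun A => S ⊆ A

lemma PB_succ (n k m : ℕ) (h : m < n) : PB n k (m+1) * (n - m) = (k - m) * PB n k m := by
  unfold PB
  rcases lt_trichotomy m k with h1 | h1 | h1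
  · rw [if_pos (by omega), if_pos (by omega)]
    obtain ⟨a, rfl⟩ : ∃ a, n = m + 1 + a := ⟨n - m - 1, by omega⟩
    obtain ⟨b, rfl⟩ : ∃ b, k = m + 1 + b := ⟨k - m - 1, by omega⟩
    have e1 : m + 1 + a - (m+1) = a := by omega
    have e2 : m + 1 + b - (m+1) = b := by omega
    have e3 : m + 1 + a - m = a + 1 := by omega
    have e4 : m + 1 + b - m = b + 1 := by omega
    rw [e1, e2, e3, e4]
    have := Nat.add_one_mul_choose_eq a b
    linarith
  · subst h1; simp
  · rw [if_neg (by omega), if_neg (by omega)]; simp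

lemma FS_card_base (n k : ℕ) (F : Finset (Finset ℕ))
    (hF : F ⊆ Finset.powersetCard k (Finset.Icc 1 n)) (S : Finset ℕ) (hS : S ⊆ Finset.Icc 1 n) :
    (FS F S).card ≤ PB n k S.card := by
  unfold PB
  split_ifs with h
  · have e : (Finset.powersetCard (k - S.card) (Finset.Icc 1 n \ S)).card
        = (n - S.card).choose (k - S.card) := by
      rw [Finset.card_powersetCard, Finset.card_sdiff_of_subset hS]; simp
    rw [← e]
    apply Finset.card_le_card_of_injOn (fun A => A \ S)
    · intro A hA
      simp only [FS, Finset.coe_filter, Set.mem_ofPred_eq] at hA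
      have := Finset.mem_powersetCard.1 (hF hA.1)
      simp only [Finset.mem_coe, Finset.mem_powersetCard]
      refine ⟨Finset.sdiff_subset_sdiff this.1 (Finset.Subset.refl _), ?_⟩
      rw [Finset.card_sdiff_of_subset hA.2, this.2]
    · intro A hA B hB hAB
      simp only [FS, Finset.coe_filter, Set.mem_ofPred_eq] at hA hB
      simp only at hAB
      rw [← Finset.sdiff_union_of_subset hA.2, hAB, Finset.sdiff_union_of_subset hB.2]
  · simp only [Nat.le_zero, Finset.card_eq_zero]
    ext A
    simp only [FS, Finset.mem_filter, Finset.notMem_empty, iff_false]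
    rintro ⟨hA, hSA⟩
    have h1 := Finset.mem_powersetCard.1 (hF hA)
    have := Finset.card_le_card hSA
    omega

/-- `S` is a `t`-transversal of `F`. -/
def Trv (t : ℕ) (F : Finset (Finset ℕ)) (S : Finset ℕ) : Prop := ∀ A ∈ F, t ≤ (S ∩ A).card

lemma FS_step (n k t : ℕ) (F : Finset (Finset ℕ))
    (hF : F ⊆ Finset.powersetCard k (Finset.Icc 1 n))
    (hint : ∀ A ∈ F, ∀ B ∈ F, t ≤ (A ∩ B).card)
    (S : Finset ℕ) (hS : S ⊆ Finset.Icc 1 n) (hT : ¬ Trv t F S) (M : ℕ)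
    (hM : ∀ S' : Finset ℕ, S' ⊆ Finset.Icc 1 n → S'.card = S.card + 1 → (FS F S').card ≤ M) :
    (FS F S).card ≤ k * M := by
  unfold Trv at hT
  push Not at hT
  obtain ⟨A, hA, hlt⟩ := hT
  have hA' := Finset.mem_powersetCard.1 (hF hA)
  have hsub : FS F S ⊆ (A \ S).biUnion (fun y => FS F (insert y S)) := by
    intro B hB
    simp only [FS, Finset.mem_filter] at hB
    have h1 := hint A hA B hB.1
    have : ∃ y ∈ A ∩ B, y ∉ S := by
      by_contra hcon
      push Not at hcon
      have : A ∩ B ⊆ S ∩ A := by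
        intro y hy
        exact Finset.mem_inter.2 ⟨hcon y hy, (Finset.mem_inter.1 hy).1⟩
      have := Finset.card_le_card this
      omega
    obtain ⟨y, hy, hyS⟩ := this
    rw [Finset.mem_inter] at hy
    simp only [FS, Finset.mem_biUnion, Finset.mem_filter, Finset.mem_sdiff]
    exact ⟨y, ⟨hy.1, hyS⟩, hB.1, Finset.insert_subset hy.2 hB.2⟩
  refine (Finset.card_le_card hsub).trans ?_
  refine (Finset.card_biUnion_le_card_mul _ _ M ?_).trans ?_
  · intro y hy
    rw [Finset.mem_sdiff] at hy
    apply hM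
    · exact Finset.insert_subset (hA'.1 hy.1) hS
    · rw [Finset.card_insert_of_notMem hy.2]
  · apply Nat.mul_le_mul_right
    exact (Finset.card_le_card Finset.sdiff_subset).trans hA'.2.le

lemma FS_branch (n k t s : ℕ) (F : Finset (Finset ℕ))
    (hF : F ⊆ Finset.powersetCard k (Finset.Icc 1 n))
    (hint : ∀ A ∈ F, ∀ B ∈ F, t ≤ (A ∩ B).card)
    (hs : ∀ S : Finset ℕ, S ⊆ Finset.Icc 1 n → S.card < s → ¬ Trv t F S) (j : ℕ) :
    ∀ S : Finset ℕ, S ⊆ Finset.Icc 1 n → S.card + j = s →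
      (FS F S).card ≤ k ^ j * PB n k s := by
  induction j with
  | zero =>
    intro S hS h
    have := FS_card_base n k F hF S hS
    simp only [add_zero] at h
    rw [h] at this
    simpa using this
  | succ j ih =>
    intro S hS h
    have := FS_step n k t F hF hint S hS (hs S hS (by omega)) (k ^ j * PB n k s) (by
      intro S' hS' hc
      exact ih S' hS' (by omega))
    rw [pow_succ]
    linarith

lemma deg_le (k t : ℕ) (F : Finset (Finset ℕ)) (B : Finset ℕ) (hB : Trv t F B) (x : ℕ) (M : ℕ)
    (hM : ∀ S ⊆ B, S.card = t → (FS F (insert x S)).card ≤ M) :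
    degree F x ≤ B.card.choose t * M := by
  have hsub : (F.filter fun A => x ∈ A) ⊆
      (Finset.powersetCard t B).biUnion (fun S => FS F (insert x S)) := by
    intro A hA
    rw [Finset.mem_filter] at hA
    obtain ⟨S, hS, hSc⟩ := Finset.exists_subset_card_eq (hB A hA.1)
    simp only [FS, Finset.mem_biUnion, Finset.mem_filter, Finset.mem_powersetCard]
    exact ⟨S, ⟨hS.trans Finset.inter_subset_left, hSc⟩, hA.1,
      Finset.insert_subset hA.2 (hS.trans Finset.inter_subset_right)⟩
  refine (Finset.card_le_card hsub).trans ?_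
  refine (Finset.card_biUnion_le_card_mul _ _ M ?_).trans ?_
  · intro S hS
    rw [Finset.mem_powersetCard] at hS
    exact hM S hS.1 hS.2
  · rw [Finset.card_powersetCard]

lemma num_base (n k t : ℕ) (htk : t < k) (hn : (t+2).choose t * k^2 ≤ n) :
    (t+2).choose t * k * PB n k (t+2) ≤ PB n k (t+1) := by
  have hc : 1 ≤ (t+2).choose t := Nat.choose_pos (by omega)
  set c := (t+2).choose t
  have h1 : t + 1 + c * k * (k - (t+1)) ≤ n := by
    obtain ⟨b, rfl⟩ : ∃ b, k = t + 1 + b := ⟨k - t - 1, by omega⟩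
    rw [Nat.add_sub_cancel_left]
    nlinarith [Nat.mul_le_mul hc (Nat.mul_le_mul (show 1 ≤ t+1+b by omega) (le_refl (t+1)))]
  rcases Nat.eq_zero_or_pos (n - (t+1)) with h0 | h0
  · have : k - (t+1) = 0 := by
      by_contra hne
      have : 0 < c * k * (k - (t+1)) := by
        have : 0 < k := by omega
        have : 0 < k - (t+1) := by omega
        positivity
      omega
    unfold PB
    rw [if_neg (by omega)]; simp
  have := PB_succ n k (t+1) (by omega)
  apply Nat.le_of_mul_le_mul_right _ h0
  calc c * k * PB n k (t+2) * (n - (t+1)) = c * k * (PB n k (t+1+1) * (n - (t+1))) := by ring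
    _ = (c * k * (k - (t+1))) * PB n k (t+1) := by rw [this]; ring
    _ ≤ (n - (t+1)) * PB n k (t+1) := Nat.mul_le_mul_right _ (by omega)
    _ = _ := by ring

lemma num_all (n k t : ℕ) (htk : t < k) (hn : (t+2).choose t * k^2 ≤ n) (j : ℕ)
    (hj : t + 2 + j ≤ k) :
    (t+2+j).choose t * k^(j+1) * PB n k (t+2+j) ≤ PB n k (t+1) := by
  induction j with
  | zero => simpa using num_base n k t htk hn
  | succ j ih =>
    refine le_trans ?_ (ih (by omega))
    set s := t + 2 + j with hsdef
    have hc : t + 1 ≤ (t+2).choose t := by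
      have h2 := Nat.choose_le_choose t (show t + 1 ≤ t + 2 by omega)
      have h3 : (t+1).choose t = t+1 := by simp
      omega
    have hn' : (t+1) * k^2 ≤ n := (Nat.mul_le_mul_right _ hc).trans hn
    have h1 : s + (t+1) * k * (k - s) ≤ n := by
      refine le_trans ?_ hn'
      obtain ⟨b, hb⟩ : ∃ b, k = s + b := ⟨k - s, by omega⟩
      rw [hb, Nat.add_sub_cancel_left]
      nlinarith [Nat.mul_le_mul (show 1 ≤ t + 1 by omega)
        (Nat.mul_le_mul (show 1 ≤ s + b by omega) (le_refl s))]
    have hpos : 0 < (t+1) * k * (k - s) := by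
      have : 0 < k := by omega
      have : 0 < k - s := by omega
      positivity
    have hP := PB_succ n k s (by omega)
    have hC := Nat.choose_mul_succ_eq s t
    have hu : s + 1 ≤ (s + 1 - t) * (t + 1) := by
      obtain ⟨u, hu⟩ : ∃ u, s + 1 = t + u + 1 := ⟨s - t, by omega⟩
      rw [hu, show t + u + 1 - t = u + 1 by omega]
      nlinarith
    have hp2 : 0 < (s + 1 - t) * (n - s) := Nat.mul_pos (by omega) (by omega)
    apply Nat.le_of_mul_le_mul_right _ hp2
    have hkey : (s + 1) * k * (k - s) ≤ (s + 1 - t) * (n - s) := by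
      calc (s + 1) * k * (k - s) ≤ ((s + 1 - t) * (t + 1)) * k * (k - s) :=
            Nat.mul_le_mul_right _ (Nat.mul_le_mul_right _ hu)
        _ = (s + 1 - t) * ((t+1) * k * (k - s)) := by ring
        _ ≤ _ := Nat.mul_le_mul_left _ (by omega)
    calc (s+1).choose t * k^(j+1+1) * PB n k (s+1) * ((s + 1 - t) * (n - s))
        = ((s+1).choose t * (s + 1 - t)) * k^(j+1) * k * (PB n k (s+1) * (n - s)) := by ring
      _ = (s.choose t * k^(j+1) * PB n k s) * ((s + 1) * k * (k - s)) := by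
          rw [hP, ← hC]; ring
      _ ≤ _ := Nat.mul_le_mul_left _ hkey

lemma nth_le (n k : ℕ) (F : Finset (Finset ℕ)) (M : ℕ) (E : Finset ℕ) (hE : E.card ≤ k + 1)
    (h : ∀ x ∈ Finset.Icc 1 n, x ∉ E → degree F x ≤ M) : nthDegree n F (k+2) ≤ M := by
  unfold nthDegree
  by_contra hcon
  push Not at hcon
  set l := ((Finset.Icc 1 n).val.map (degree F)).sort (· ≥ ·) with hl
  have hsort : l.Pairwise (· ≥ ·) := Multiset.pairwise_sort _ _
  have hlen : k + 1 < l.length := by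
    by_contra hc
    rw [List.getD_eq_default _ _ (by omega)] at hcon
    omega
  have hcnt : l.countP (fun d => M < d) ≤ k + 1 := by
    have h1 : l.countP (fun d => M < d)
        = ((Finset.Icc 1 n).filter (fun x => M < degree F x)).card := by
      have : l.countP (fun d => M < d) = Multiset.countP (fun d => M < d) (l : Multiset ℕ) := by
        simp
      rw [this, hl, Multiset.sort_eq, Multiset.countP_map]
      rfl
    rw [h1]
    refine (Finset.card_le_card ?_).trans hE
    intro x hx
    rw [Finset.mem_filter] at hx
    by_contra hxE
    have := h x hx.1 hxE
    omega
  have htake : (l.take (k+2)).countP (fun d => M < d) = k + 2 := by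
    have : (l.take (k+2)).countP (fun d => M < d) = (l.take (k+2)).length := by
      rw [List.countP_eq_length]
      intro a ha
      rw [List.mem_take_iff_getElem] at ha
      obtain ⟨i, hi, rfl⟩ := ha
      rw [List.getD_eq_getElem _ _ (by omega)] at hcon
      simp only [decide_eq_true_eq]
      refine lt_of_lt_of_le hcon ?_
      rcases Nat.lt_or_ge i (k+1) with h2 | h2
      · exact List.pairwise_iff_getElem.1 hsort i (k+1) (by omega) (by omega) h2
      · have : i = k + 1 := by omega
        subst this
        exact le_refl _
    rw [this, List.length_take]; omega
  have := (List.take_sublist (k+2) l).countP_le (p := fun d => M < d)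
  omega

lemma trv_inter (n k t : ℕ) (htk : t < k) (hn : 3 * k ≤ n) (F : Finset (Finset ℕ))
    (hmax : ∀ K ∈ Finset.powersetCard k (Finset.Icc 1 n), Trv t F K → K ∈ F)
    (T T' : Finset ℕ) (hT : T ⊆ Finset.Icc 1 n)
    (hTc : T.card = t + 1) (hTc' : T'.card = t + 1)
    (hTt : Trv t F T) (hTt' : Trv t F T') : t ≤ (T ∩ T').card := by
  have h1 : T ⊆ Finset.Icc 1 n \ (T' \ T) := by
    intro x hx
    simp [hx]
    simpa using hT hx
  have h2 : k ≤ (Finset.Icc 1 n \ (T' \ T)).card := by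
    have := Finset.le_card_sdiff (T' \ T) (Finset.Icc 1 n)
    have h3 := Finset.card_le_card (Finset.sdiff_subset (s := T') (t := T))
    simp only [Nat.card_Icc] at this
    omega
  obtain ⟨K, hTK, hK, hKc⟩ := Finset.exists_subsuperset_card_eq h1 (by omega) h2
  have hKF : K ∈ F := by
    apply hmax
    · exact Finset.mem_powersetCard.2 ⟨hK.trans Finset.sdiff_subset, hKc⟩
    · intro A hA
      exact (hTt A hA).trans (Finset.card_le_card (Finset.inter_subset_inter_right hTK))
  refine (hTt' K hKF).trans (Finset.card_le_card ?_)
  intro y hy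
  rw [Finset.mem_inter] at hy ⊢
  have := hK hy.2
  simp only [Finset.mem_sdiff] at this
  tauto

lemma main_max (n k t : ℕ) (ht : 1 ≤ t) (htk : t < k)
    (hn : (t+2).choose t * k^2 ≤ n) (hn3 : 3 * k ≤ n)
    (F : Finset (Finset ℕ)) (hF : F ⊆ Finset.powersetCard k (Finset.Icc 1 n))
    (hint : ∀ A ∈ F, ∀ B ∈ F, t ≤ (A ∩ B).card)
    (hmax : ∀ K ∈ Finset.powersetCard k (Finset.Icc 1 n), Trv t F K → K ∈ F) :
    ∃ E : Finset ℕ, E.card ≤ k + 1 ∧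
      ∀ x ∈ Finset.Icc 1 n, x ∉ E → degree F x ≤ PB n k (t+1) := by
  classical
  rcases F.eq_empty_or_nonempty with rfl | ⟨A0, hA0⟩
  · exact ⟨∅, by simp, by simp [degree]⟩
  have hA0' := Finset.mem_powersetCard.1 (hF hA0)
  obtain ⟨B, hB, hBmin⟩ := Finset.exists_min_image
    ((Finset.Icc 1 n).powerset.filter (fun S => Trv t F S)) Finset.card
    ⟨A0, Finset.mem_filter.2 ⟨Finset.mem_powerset.2 hA0'.1, fun A hA => hint A0 hA0 A hA⟩⟩
  rw [Finset.mem_filter, Finset.mem_powerset] at hB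
  obtain ⟨hBn, hBt⟩ := hB
  have hmin : ∀ S : Finset ℕ, S ⊆ Finset.Icc 1 n → S.card < B.card → ¬ Trv t F S := by
    intro S hS hlt hSt
    have := hBmin S (Finset.mem_filter.2 ⟨Finset.mem_powerset.2 hS, hSt⟩)
    omega
  have hBk : B.card ≤ k := by
    have := hBmin A0 (Finset.mem_filter.2
      ⟨Finset.mem_powerset.2 hA0'.1, fun A hA => hint A0 hA0 A hA⟩)
    omega
  have htB : t ≤ B.card := (hBt A0 hA0).trans (Finset.card_le_card Finset.inter_subset_left)
  have hins : ∀ x, x ∉ B → ∀ S ⊆ B, S.card = t → (insert x S).card = t + 1 := by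
    intro x hx S hS hc
    rw [Finset.card_insert_of_notMem (fun h => hx (hS h)), hc]
  have hinsn : ∀ x ∈ Finset.Icc 1 n, ∀ S ⊆ B, insert x S ⊆ Finset.Icc 1 n :=
    fun x hx S hS => Finset.insert_subset hx (hS.trans hBn)
  rcases Nat.lt_or_ge B.card (t+2) with hlt | hge
  · rcases Nat.lt_or_ge B.card (t+1) with hlt1 | hge1
    · -- size t
      have hBc : B.card = t := by omega
      refine ⟨B, by omega, fun x hx hxB => ?_⟩
      have := deg_le k t F B hBt x (PB n k (t+1)) (by
        intro S hS hSc
        have := FS_card_base n k F hF (insert x S) (hinsn x hx S hS)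
        rwa [hins x hxB S hS hSc] at this)
      rw [hBc] at this
      simpa using this
    · -- size t + 1
      have hBc : B.card = t + 1 := by omega
      have hgood : ∀ x ∈ Finset.Icc 1 n, x ∉ B →
          (∀ S ⊆ B, S.card = t → ¬ Trv t F (insert x S)) → degree F x ≤ PB n k (t+1) := by
        intro x hx hxB hS
        have := deg_le k t F B hBt x (k * PB n k (t+2)) (by
          intro S hSB hSc
          apply FS_step n k t F hF hint _ (hinsn x hx S hSB) (hS S hSB hSc)
          intro S' hS' hc
          rw [hins x hxB S hSB hSc] at hc
          have := FS_card_base n k F hF S' hS'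
          rwa [hc] at this)
        refine this.trans (le_trans ?_ (num_base n k t htk hn))
        rw [hBc, mul_assoc]
        exact Nat.mul_le_mul_right _ (Nat.choose_le_choose t (by omega))
      by_cases hbad : ∃ x ∈ Finset.Icc 1 n, x ∉ B ∧ ∃ S ⊆ B, S.card = t ∧ Trv t F (insert x S)
      · obtain ⟨x, hx, hxB, S, hSB, hSc, hST⟩ := hbad
        by_cases hbad2 : ∃ y ∈ Finset.Icc 1 n, y ∉ B ∧ y ≠ x ∧
            ∃ S ⊆ B, S.card = t ∧ Trv t F (insert y S)
        · -- common kernel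
          have huniq : ∀ x ∈ Finset.Icc 1 n, x ∉ B → ∀ y ∈ Finset.Icc 1 n, y ∉ B → y ≠ x →
              ∀ S ⊆ B, S.card = t → Trv t F (insert x S) → ∀ S' ⊆ B, S'.card = t →
              Trv t F (insert y S') → S = S' := by
            intro x hx hxB y hy hyB hyx S hSB hSc hST S' hSB' hSc' hST'
            have h1 := trv_inter n k t htk hn3 F hmax _ _ (hinsn x hx S hSB)
              (hins x hxB S hSB hSc) (hins y hyB S' hSB' hSc') hST hST'
            have h2 : insert x S ∩ insert y S' ⊆ S ∩ S' := by
              intro z hz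
              simp only [Finset.mem_inter, Finset.mem_insert] at hz ⊢
              obtain ⟨h3 | h3, h4 | h4⟩ := hz
              · exact absurd (h4.symm.trans h3) hyx
              · subst h3; exact absurd (hSB' h4) hxB
              · subst h4; exact absurd (hSB h3) hyB
              · exact ⟨h3, h4⟩
            have h3 := h1.trans (Finset.card_le_card h2)
            have h4 : S ∩ S' = S :=
              Finset.eq_of_subset_of_card_le Finset.inter_subset_left (by omega)
            have h5 : S ∩ S' = S' :=
              Finset.eq_of_subset_of_card_le Finset.inter_subset_right (by omega)
            rw [← h4, h5]
          obtain ⟨y, hy, hyB, hyx, S2, hSB2, hSc2, hST2⟩ := hbad2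
          have e2 := huniq x hx hxB y hy hyB hyx S hSB hSc hST S2 hSB2 hSc2 hST2
          subst e2
          have hSn := hmin S (hSB.trans hBn) (by omega)
          unfold Trv at hSn
          push Not at hSn
          obtain ⟨A, hA, hAlt⟩ := hSn
          have hA' := Finset.mem_powersetCard.1 (hF hA)
          have hmemA : ∀ z, Trv t F (insert z S) → z ∈ A ∧ t ≤ (S ∩ A).card + 1 := by
            intro z hz
            have h1 := hz A hA
            by_cases hzA : z ∈ A
            · refine ⟨hzA, ?_⟩
              rw [Finset.insert_inter_of_mem hzA] at h1
              exact h1.trans (Finset.card_insert_le _ _)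
            · rw [Finset.insert_inter_of_notMem hzA] at h1
              omega
          have hSA := (hmemA x hST).2
          refine ⟨S ∪ A, ?_, ?_⟩
          · have := Finset.card_union_add_card_inter S A
            omega
          · intro z hz hzE
            rw [Finset.mem_union, not_or] at hzE
            have hzB : z ∉ B := by
              intro hzB
              have : insert z S = B := by
                apply Finset.eq_of_subset_of_card_le (Finset.insert_subset hzB hSB)
                rw [Finset.card_insert_of_notMem hzE.1]; omega
              exact hzE.2 (hmemA z (this ▸ hBt)).1
            apply hgood z hz hzB
            intro S3 hSB3 hSc3 hST3
            have e3 : S = S3 := by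
              by_cases hzx : z = x
              · subst hzx
                exact huniq y hy hyB z hz hzB (Ne.symm hyx) S hSB hSc hST2 S3 hSB3 hSc3 hST3
              · exact huniq x hx hxB z hz hzB hzx S hSB hSc hST S3 hSB3 hSc3 hST3
            subst e3
            exact hzE.2 (hmemA z hST3).1
        · refine ⟨insert x B, ?_, ?_⟩
          · rw [Finset.card_insert_of_notMem hxB]; omega
          · intro z hz hzE
            rw [Finset.mem_insert, not_or] at hzE
            apply hgood z hz hzE.2
            intro S3 hSB3 hSc3 hST3
            exact hbad2 ⟨z, hz, hzE.2, hzE.1, S3, hSB3, hSc3, hST3⟩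
      · refine ⟨B, by omega, fun x hx hxB => hgood x hx hxB ?_⟩
        intro S hSB hSc hST
        exact hbad ⟨x, hx, hxB, S, hSB, hSc, hST⟩
  · refine ⟨B, by omega, fun x hx hxB => ?_⟩
    obtain ⟨j, hj⟩ : ∃ j, B.card = t + 2 + j := ⟨B.card - (t+2), by omega⟩
    have := deg_le k t F B hBt x (k^(j+1) * PB n k B.card) (by
      intro S hS hSc
      apply FS_branch n k t B.card F hF hint hmin (j+1) _ (hinsn x hx S hS)
      rw [hins x hxB S hS hSc]; omega)
    refine this.trans ?_
    rw [hj, ← mul_assoc]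
    exact num_all n k t htk hn j (by omega)

theorem stmt_4 (n k t : ℕ) (ht : 1 ≤ t) (htk : t < k)
    (hn : (t + 2) * (t + 1) / 2 * k ^ 2 ≤ n)
    (F : Finset (Finset ℕ)) (hF : F ⊆ Finset.powersetCard k (Finset.Icc 1 n))
    (hint : ∀ A ∈ F, ∀ B ∈ F, t ≤ (A ∩ B).card) :
    nthDegree n F (k + 2) ≤ (n - t - 1).choose (k - t - 1) := by
  classical
  have hc : (t + 2) * (t + 1) / 2 = (t+2).choose t := by
    have h1 := Nat.choose_two_right (t+2)
    have h2 := Nat.choose_symm_add (a := t) (b := 2)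
    rw [h2, h1]; rfl
  rw [hc] at hn
  have hn3 : 3 * k ≤ n := by
    have h3 : 3 ≤ (t+2).choose t := by
      rw [← hc, Nat.le_div_iff_mul_le (by norm_num)]
      nlinarith
    have := Nat.mul_le_mul h3 (show k ≤ k^2 by nlinarith)
    omega
  obtain ⟨G, hG, hGmax⟩ := Finset.exists_max_image
    ((Finset.powersetCard k (Finset.Icc 1 n)).powerset.filter
      (fun G => F ⊆ G ∧ ∀ A ∈ G, ∀ B ∈ G, t ≤ (A ∩ B).card)) Finset.card
    ⟨F, Finset.mem_filter.2 ⟨Finset.mem_powerset.2 hF, Finset.Subset.refl _, hint⟩⟩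
  rw [Finset.mem_filter, Finset.mem_powerset] at hG
  obtain ⟨hGn, hFG, hGint⟩ := hG
  obtain ⟨E, hE, hEd⟩ := main_max n k t ht htk hn hn3 G hGn hGint (by
    intro K hK hKT
    by_contra hKG
    have hKc := (Finset.mem_powersetCard.1 hK).2
    have := hGmax (insert K G) (Finset.mem_filter.2 ⟨Finset.mem_powerset.2
      (Finset.insert_subset hK hGn), hFG.trans (Finset.subset_insert _ _), by
        intro A hA B hB
        rw [Finset.mem_insert] at hA hB
        rcases hA with rfl | hA
        · rcases hB with rfl | hB
          · rw [Finset.inter_self]; omega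
          · exact hKT B hB
        · rcases hB with rfl | hB
          · rw [Finset.inter_comm]; exact hKT A hA
          · exact hGint A hA B hB⟩)
    rw [Finset.card_insert_of_notMem hKG] at this
    omega)
  have hPB : PB n k (t+1) = (n - t - 1).choose (k - t - 1) := by
    unfold PB
    rw [if_pos (by omega), Nat.sub_sub, Nat.sub_sub]
  rw [← hPB]
  apply nth_le n k F _ E hE
  intro x hx hxE
  refine le_trans ?_ (hEd x hx hxE)
  exact Finset.card_le_card (Finset.filter_subset_filter _ hFG)
end

section
/- Let k ≥ 3 and n ≥ 6k be integers and let F ⊆ \binom{[n]}{k} be an intersecting family. Then the fourth largest degree satisfies d_4(F) ≤ \binom{n-2}{k-2} + \binom{n-4}{k-3}. -/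
open Finset

section CrossIntersecting
open scoped FinsetFamily

lemma initSeg_shrink {m r : ℕ} : ∀ (d : ℕ) (P : Finset (Finset (Fin m))),
    Colex.IsInitSeg P r → d ≤ #P → ∃ C ⊆ P, Colex.IsInitSeg C r ∧ #C + d = #P := by
  intro d
  induction d with
  | zero => intro P hP _; exact ⟨P, Subset.refl _, hP, by simp⟩
  | succ d ih =>
    intro P hP hd
    have hne : P.Nonempty := by rw [← card_pos]; omega
    obtain ⟨s, hs, hmax⟩ := exists_max_image P (fun s => toColex s) hne
    have hP' : Colex.IsInitSeg (P.erase s) r := by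
      refine ⟨fun t ht => hP.1 (mem_of_mem_erase ht), ?_⟩
      intro s1 t h1 h2
      refine mem_erase.2 ⟨?_, hP.2 (mem_of_mem_erase h1) h2⟩
      rintro rfl
      exact absurd (hmax _ (mem_of_mem_erase h1)) (not_le.2 h2.1)
    have hc : #(P.erase s) + 1 = #P := card_erase_add_one hs
    obtain ⟨C, hC, h1, h2⟩ := ih _ hP' (by omega)
    exact ⟨C, hC.trans (erase_subset _ _), h1, by omega⟩

lemma shadow_local {m r a M : ℕ} (R : Finset (Fin m)) (hR : #R = M) (C : Finset (Finset (Fin m)))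
    (hC : C ⊆ powersetCard r R) (ha : a ≤ r) (hr : r ≤ M) :
    #C * M.choose a ≤ #(∂^[r - a] C) * M.choose r := by
  have key : #C * r.choose a ≤ #(∂^[r - a] C) * (M - a).choose (r - a) := by
    classical
    refine card_mul_le_card_mul' (fun t s : Finset (Fin m) => t ⊆ s) (fun s hs => ?_)
      (fun t ht => ?_)
    · have h1 := (mem_powersetCard.1 (hC hs))
      rw [← h1.2, ← card_powersetCard]
      refine card_le_card fun t ht => ?_
      rw [mem_powersetCard] at ht
      rw [mem_bipartiteBelow]
      refine ⟨mem_shadow_iterate_iff_exists_sdiff.2 ⟨s, hs, ht.1, ?_⟩, ht.1⟩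
      rw [card_sdiff_of_subset ht.1, ht.2, h1.2]
    · obtain ⟨s0, hs0, hts0, hc0⟩ := mem_shadow_iterate_iff_exists_sdiff.1 ht
      have h0 := (mem_powersetCard.1 (hC hs0))
      have htR : t ⊆ R := hts0.trans h0.1
      have hta : #t = a := by
        rw [card_sdiff_of_subset hts0, h0.2] at hc0
        have := card_le_card hts0
        omega
      have h2 : (M - a).choose (r - a) = #(powersetCard (r - a) (R \ t)) := by
        rw [card_powersetCard, card_sdiff_of_subset htR, hR, hta]
      rw [h2]
      refine card_le_card_of_injOn (fun s => s \ t) ?_ ?_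
      · intro s hs
        rw [mem_coe, mem_bipartiteAbove] at hs
        have h3 := mem_powersetCard.1 (hC hs.1)
        rw [mem_coe, mem_powersetCard, card_sdiff_of_subset hs.2, h3.2, hta]
        exact ⟨sdiff_subset_sdiff h3.1 (Subset.refl _), rfl⟩
      · intro s hs s' hs' h
        rw [mem_coe, mem_bipartiteAbove] at hs hs'
        have h : s \ t = s' \ t := h
        rw [← sdiff_union_of_subset hs.2, h, sdiff_union_of_subset hs'.2]
  have hid : M.choose r * r.choose a = M.choose a * (M - a).choose (r - a) := Nat.choose_mul ha
  have hpos : 0 < (M - a).choose (r - a) := Nat.choose_pos (by omega)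
  refine Nat.le_of_mul_le_mul_right ?_ hpos
  calc #C * M.choose a * (M - a).choose (r - a) = (#C * r.choose a) * M.choose r := by
        rw [mul_assoc, ← hid]; ring
    _ ≤ (#(∂^[r - a] C) * (M - a).choose (r - a)) * M.choose r := Nat.mul_le_mul_right _ key
    _ = _ := by ring

lemma isInitSeg_range {m r : ℕ} (M : ℕ) (R : Finset (Fin m)) (hR : ∀ x, x ∈ R ↔ x.val < M) :
    Colex.IsInitSeg (powersetCard r R) r := by
  refine ⟨Set.sized_powersetCard _ _, ?_⟩
  intro A B hA hB
  obtain ⟨HB₁, HB₂⟩ := hB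
  rw [mem_powersetCard] at hA ⊢
  refine ⟨fun t ht ↦ ?_, HB₂⟩
  rw [hR]
  have : toColex (image Fin.val B) < toColex (image Fin.val A) := by
    rwa [Colex.toColex_image_lt_toColex_image Fin.val_strictMono]
  apply Colex.forall_lt_mono this.le _ t (mem_image.2 ⟨t, ht, rfl⟩)
  simp_rw [mem_image]
  rintro _ ⟨a, ha, hab⟩
  rw [← hab]
  exact (hR _).1 (hA.1 ha)

lemma cross_fin {m a b : ℕ} (𝒜 ℬ : Finset (Finset (Fin m)))
    (h𝒜 : ∀ A ∈ 𝒜, #A = a) (hℬ : ∀ B ∈ ℬ, #B = b) (hb : 1 ≤ b) (hab : a + b ≤ m)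
    (hcross : ∀ A ∈ 𝒜, ∀ B ∈ ℬ, ¬ Disjoint A B) (hsmall : #ℬ ≤ (m - 1).choose (b - 1)) :
    #𝒜 * (m - 1).choose (b - 1) + (m - 1).choose a * #ℬ
      ≤ m.choose a * (m - 1).choose (b - 1) := by
  have hsym : (m - 1).choose (b - 1) = (m - 1).choose (m - b) :=
    (Nat.choose_symm_of_eq_add (by omega))
  rw [hsym] at hsmall ⊢
  set r := m - b with hr
  have hsz : (ℬᶜˢ : Set (Finset (Fin m))).Sized r := by
    have : (ℬ : Set (Finset (Fin m))).Sized b := fun B hB => hℬ B hB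
    simpa using this.compls
  set R : Finset (Fin m) := univ.filter (fun x => x.val < m - 1) with hRdef
  have hRm : ∀ x, x ∈ R ↔ x.val < m - 1 := by intro x; simp [hRdef]
  have hRc : #R = m - 1 := by
    rw [hRdef, Fin.card_filter_val_lt]; omega
  have hPc : #(powersetCard r R) = (m - 1).choose r := by rw [card_powersetCard, hRc]
  obtain ⟨C, hCP, hCi, hCc⟩ := initSeg_shrink (#(powersetCard r R) - #ℬ) _
    (isInitSeg_range (r := r) (m - 1) R hRm) (by omega)
  have hCB : #C = #ℬ := by omega
  have h1 := shadow_local (a := a) R hRc C hCP (by omega) (by omega)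
  have h2 : #(∂^[r - a] C) ≤ #(∂^[r - a] ℬᶜˢ) :=
    iterated_kk hsz (by rw [card_compls]; omega) hCi
  have hdisj : Disjoint 𝒜 (∂^[r - a] ℬᶜˢ) := disjoint_right.2 fun A hAbar hA ↦ by
    simp only [mem_shadow_iterate_iff_exists_sdiff, mem_compls] at hAbar
    obtain ⟨C, hC, hAC, _⟩ := hAbar
    exact hcross A hA _ hC (disjoint_of_subset_left hAC disjoint_compl_right)
  have h3 : #𝒜 + #(∂^[r - a] ℬᶜˢ) ≤ m.choose a := by
    rw [← card_union_of_disjoint hdisj]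
    have : m.choose a = #(powersetCard a (univ : Finset (Fin m))) := by simp
    rw [this]
    refine card_le_card fun A hA => ?_
    rw [mem_powersetCard]
    refine ⟨subset_univ _, ?_⟩
    rcases mem_union.1 hA with h | h
    · exact h𝒜 A h
    · have := hsz.shadow_iterate (k := r - a) h
      omega
  rw [hCB] at h1
  calc #𝒜 * (m - 1).choose r + (m - 1).choose a * #ℬ
      ≤ #𝒜 * (m - 1).choose r + #(∂^[r - a] ℬᶜˢ) * (m - 1).choose r := by
        have := Nat.mul_le_mul_right ((m-1).choose r) h2
        rw [mul_comm ((m - 1).choose a)]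
        omega
    _ = (#𝒜 + #(∂^[r - a] ℬᶜˢ)) * (m - 1).choose r := by ring
    _ ≤ _ := Nat.mul_le_mul_right _ h3

/-- transfer to an arbitrary ground set -/
lemma cross_gen {m a b : ℕ} (U : Finset ℕ) (hU : #U = m) (𝒜 ℬ : Finset (Finset ℕ))
    (h𝒜 : 𝒜 ⊆ powersetCard a U) (hℬ : ℬ ⊆ powersetCard b U) (hb : 1 ≤ b) (hab : a + b ≤ m)
    (hcross : ∀ A ∈ 𝒜, ∀ B ∈ ℬ, ¬ Disjoint A B) (hsmall : #ℬ ≤ (m - 1).choose (b - 1)) :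
    #𝒜 * (m - 1).choose (b - 1) + (m - 1).choose a * #ℬ
      ≤ m.choose a * (m - 1).choose (b - 1) := by
  let e : Fin m ↪ ℕ := (U.orderEmbOfFin hU).toEmbedding
  have hmap : univ.map e = U := by

    simp [e]
  let g : Finset ℕ → Finset (Fin m) := fun A => univ.filter (fun x => e x ∈ A)
  have hg : ∀ A, A ⊆ U → (g A).map e = A := by
    intro A hA
    ext y
    simp only [g, mem_map, mem_filter, mem_univ, true_and]
    constructor
    · rintro ⟨x, hx, rfl⟩; exact hx
    · intro hy
      have : y ∈ univ.map e := by rw [hmap]; exact hA hy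
      obtain ⟨x, _, rfl⟩ := mem_map.1 this
      exact ⟨x, hy, rfl⟩
  have hcard : ∀ c, ∀ 𝒳 ⊆ powersetCard c U, #(𝒳.image g) = #𝒳 ∧ ∀ X ∈ 𝒳.image g, #X = c := by
    intro c 𝒳 h𝒳
    refine ⟨card_image_of_injOn ?_, ?_⟩
    · intro x hx y hy hxy
      have hx' := (mem_powersetCard.1 (h𝒳 hx)).1
      have hy' := (mem_powersetCard.1 (h𝒳 hy)).1
      rw [← hg x hx', ← hg y hy', hxy]
    · intro X hX
      obtain ⟨x, hx, rfl⟩ := mem_image.1 hX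
      have hx' := (mem_powersetCard.1 (h𝒳 hx))
      rw [← card_map e, hg x hx'.1, hx'.2]
  have hA := hcard a 𝒜 h𝒜
  have hB := hcard b ℬ hℬ
  have := cross_fin (𝒜.image g) (ℬ.image g) hA.2 hB.2 hb hab ?_ (by rw [hB.1]; exact hsmall)
  · rwa [hA.1, hB.1] at this
  · intro X hX Y hY hd
    obtain ⟨x, hx, rfl⟩ := mem_image.1 hX
    obtain ⟨y, hy, rfl⟩ := mem_image.1 hY
    refine hcross x hx y hy ?_
    rw [← hg x (mem_powersetCard.1 (h𝒜 hx)).1, ← hg y (mem_powersetCard.1 (hℬ hy)).1]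
    exact (disjoint_map e).2 hd

/-- at most one of two cross-intersecting families is larger than a star -/
lemma cross_gen_large {m a b : ℕ} (U : Finset ℕ) (hU : #U = m) (𝒜 ℬ : Finset (Finset ℕ))
    (h𝒜 : 𝒜 ⊆ powersetCard a U) (hℬ : ℬ ⊆ powersetCard b U) (hb : 1 ≤ b) (ha : 1 ≤ a)
    (hab : a + b ≤ m)
    (hcross : ∀ A ∈ 𝒜, ∀ B ∈ ℬ, ¬ Disjoint A B) (hlarge : (m - 1).choose (b - 1) ≤ #ℬ) :
    #𝒜 ≤ (m - 1).choose (a - 1) := by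
  obtain ⟨ℬ', hsub, hc⟩ := exists_subset_card_eq hlarge
  have h := cross_gen U hU 𝒜 ℬ' h𝒜 (hsub.trans hℬ) hb hab
    (fun A hA B hB => hcross A hA B (hsub hB)) hc.le
  rw [hc, ← add_mul] at h
  have hpos : 0 < (m - 1).choose (b - 1) := Nat.choose_pos (by omega)
  have h' := Nat.le_of_mul_le_mul_right h hpos
  obtain ⟨m', rfl⟩ : ∃ m', m = m' + 1 := ⟨m - 1, by omega⟩
  obtain ⟨a', rfl⟩ : ∃ a', a = a' + 1 := ⟨a - 1, by omega⟩
  rw [Nat.choose_succ_succ] at h'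
  simp at h' ⊢
  omega

end CrossIntersecting

lemma star_arith {N2 N3 M3 Q f2 f3 f4 f12 f13 f14 f23 f24 f34 t123 t124 t134 t234 q : ℝ}
    (hN3 : 0 < N3) (hN : 4 * N3 ≤ N2)
    (a1 : f12 + f3 ≤ N2 + N3) (a2 : f13 + f4 ≤ N2 + N3) (a3 : f14 + f2 ≤ N2 + N3)
    (b1 : f12 * N3 + N2 * f34 ≤ (N2 + N3) * N3) (b2 : f13 * N3 + N2 * f24 ≤ (N2 + N3) * N3)
    (b3 : f14 * N3 + N2 * f23 ≤ (N2 + N3) * N3)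
    (c1 : t123 * N2 + N3 * f4 ≤ M3 * N2) (c2 : t124 * N2 + N3 * f3 ≤ M3 * N2)
    (c3 : t134 * N2 + N3 * f2 ≤ M3 * N2) (c4 : t234 ≤ M3) (hq : q ≤ Q)
    (d2 : N2 + N3 + 3 * M3 + Q < f2 + f12 + f23 + f24 + t123 + t124 + t234 + q)
    (d3 : N2 + N3 + 3 * M3 + Q < f3 + f13 + f23 + f34 + t123 + t134 + t234 + q)
    (d4 : N2 + N3 + 3 * M3 + Q < f4 + f14 + f24 + f34 + t124 + t134 + t234 + q) : False := by
  have hN2 : 0 < N2 := by linarith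
  obtain ⟨y, hy⟩ : ∃ y, f2 + f3 + f4 = N2 * y := ⟨(f2 + f3 + f4) / N2, by field_simp⟩
  obtain ⟨x, hx⟩ : ∃ x, f23 + f24 + f34 = N3 * x := ⟨(f23 + f24 + f34) / N3, by field_simp⟩
  have hW : t123 + t124 + t134 ≤ 3 * M3 - N3 * y := by
    refine le_of_mul_le_mul_right (a := N2) ?_ hN2
    have : N3 * y * N2 = N3 * (f2 + f3 + f4) := by rw [hy]; ring
    rw [sub_mul, this]
    linarith
  have hG : f12 + f13 + f14 ≤ 3 * (N2 + N3) - N2 * x := by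
    refine le_of_mul_le_mul_right (a := N3) ?_ hN3
    have : N2 * x * N3 = N2 * (f23 + f24 + f34) := by rw [hx]; ring
    rw [sub_mul, this]
    linarith
  rcases le_total x y with h | h
  · have := mul_le_mul_of_nonneg_left h hN3.le
    linarith
  · have h1 : 0 ≤ (N2 - 4 * N3) * (x - y) := mul_nonneg (by linarith) (by linarith)
    have := mul_le_mul_of_nonneg_left h hN3.le
    linarith

lemma tri_arith {N2 N3 M3 Q f1 f2 f3 f4 f12 f13 f23 f14 f24 f34 t123 t124 t134 t234 q : ℝ}
    (hN3 : 0 < N3) (hN : 4 * N3 ≤ N2)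
    (n1 : 0 ≤ f1) (n2 : 0 ≤ f2) (n3 : 0 ≤ f3) (n4 : 0 ≤ f4)
    (a1 : f12 + f3 ≤ N2 + N3) (a2 : f13 + f2 ≤ N2 + N3) (a3 : f23 + f1 ≤ N2 + N3)
    (a4 : f12 + f4 ≤ N2 + N3) (a5 : f13 + f4 ≤ N2 + N3) (a6 : f23 + f4 ≤ N2 + N3)
    (b1 : f12 * N3 + N2 * f34 ≤ (N2 + N3) * N3) (b2 : f13 * N3 + N2 * f24 ≤ (N2 + N3) * N3)
    (b3 : f23 * N3 + N2 * f14 ≤ (N2 + N3) * N3)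
    (c1 : t123 * N2 + N3 * f4 ≤ M3 * N2) (c2 : t124 * N2 + N3 * f3 ≤ M3 * N2)
    (c3 : t134 * N2 + N3 * f2 ≤ M3 * N2) (c4 : t234 * N2 + N3 * f1 ≤ M3 * N2) (hq : q ≤ Q)
    (d1 : N2 + N3 + 3 * M3 + Q < f1 + f12 + f13 + f14 + t123 + t124 + t134 + q)
    (d2 : N2 + N3 + 3 * M3 + Q < f2 + f12 + f23 + f24 + t123 + t124 + t234 + q)
    (d3 : N2 + N3 + 3 * M3 + Q < f3 + f13 + f23 + f34 + t123 + t134 + t234 + q)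
    (d4 : N2 + N3 + 3 * M3 + Q < f4 + f14 + f24 + f34 + t124 + t134 + t234 + q) : False := by
  have hN2 : 0 < N2 := by linarith
  obtain ⟨r, hr⟩ : ∃ r, f1 + f2 + f3 = 3 * (N2 * r) := ⟨(f1 + f2 + f3) / (3 * N2), by field_simp⟩
  obtain ⟨s, hs⟩ : ∃ s, f4 = N2 * s := ⟨f4 / N2, by field_simp⟩
  obtain ⟨u, hu⟩ : ∃ u, f14 + f24 + f34 = 3 * (N3 * u) :=
    ⟨(f14 + f24 + f34) / (3 * N3), by field_simp⟩
  have hr0 : 0 ≤ r := by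
    by_contra h
    have := mul_neg_of_pos_of_neg hN2 (not_le.1 h)
    linarith
  have hs0 : 0 ≤ s := by
    by_contra h
    have := mul_neg_of_pos_of_neg hN2 (not_le.1 h)
    linarith
  have hV : t124 + t134 + t234 ≤ 3 * M3 - 3 * (N3 * r) := by
    refine le_of_mul_le_mul_right (a := N2) ?_ hN2
    have : 3 * (N3 * r) * N2 = N3 * (f1 + f2 + f3) := by rw [hr]; ring
    rw [sub_mul, this]
    linarith
  have ht : t123 ≤ M3 - N3 * s := by
    refine le_of_mul_le_mul_right (a := N2) ?_ hN2
    have : N3 * s * N2 = N3 * f4 := by rw [hs]; ring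
    rw [sub_mul, this]
    linarith
  have hP : f12 + f13 + f23 ≤ 3 * (N2 + N3) - 3 * (N2 * u) := by
    refine le_of_mul_le_mul_right (a := N3) ?_ hN3
    have : 3 * (N2 * u) * N3 = N2 * (f14 + f24 + f34) := by rw [hu]; ring
    rw [sub_mul, this]
    linarith
  have p1 := mul_nonneg hN3.le hr0
  have p2 := mul_nonneg hN3.le hs0
  rcases le_total u r with h | h
  · have := mul_le_mul_of_nonneg_left h hN3.le
    linarith
  · have h1 : 0 ≤ (N2 - 4 * N3) * (u - r) := mul_nonneg (by linarith) (by linarith)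
    have := mul_le_mul_of_nonneg_left h hN3.le
    linarith

/-- number of members of `F` with trace `S` on `T` -/
def traceCount (F : Finset (Finset ℕ)) (T S : Finset ℕ) : ℕ := #(F.filter fun A => A ∩ T = S)

section Trace
variable {n k : ℕ} {F : Finset (Finset ℕ)} {T : Finset ℕ}

lemma trace_fam (hF : F ⊆ powersetCard k (Icc 1 n)) (S : Finset ℕ) :
    #((F.filter fun A => A ∩ T = S).image (fun A => A \ T)) = traceCount F T S ∧
    ((F.filter fun A => A ∩ T = S).image (fun A => A \ T)) ⊆
      powersetCard (k - #S) (Icc 1 n \ T) := by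
  constructor
  · refine card_image_of_injOn ?_
    intro A hA B hB h
    rw [mem_coe, mem_filter] at hA hB
    have h : A \ T = B \ T := h
    rw [← sdiff_union_inter A T, ← sdiff_union_inter B T, h, hA.2, hB.2]
  · intro X hX
    obtain ⟨A, hA, rfl⟩ := mem_image.1 hX
    rw [mem_filter] at hA
    have h1 := mem_powersetCard.1 (hF hA.1)
    rw [mem_powersetCard]
    refine ⟨sdiff_subset_sdiff h1.1 (Subset.refl _), ?_⟩
    have := card_sdiff_add_card_inter A T
    rw [hA.2] at this
    omega

lemma trace_cross (hint : ∀ A ∈ F, ∀ B ∈ F, (A ∩ B).Nonempty) {S S' : Finset ℕ}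
    (hSS : Disjoint S S') :
    ∀ A ∈ (F.filter fun A => A ∩ T = S).image (fun A => A \ T),
    ∀ B ∈ (F.filter fun A => A ∩ T = S').image (fun A => A \ T), ¬ Disjoint A B := by
  intro X hX Y hY hd
  obtain ⟨A, hA, rfl⟩ := mem_image.1 hX
  obtain ⟨B, hB, rfl⟩ := mem_image.1 hY
  rw [mem_filter] at hA hB
  obtain ⟨x, hx⟩ := hint A hA.1 B hB.1
  rw [mem_inter] at hx
  by_cases hxT : x ∈ T
  · refine (disjoint_left.1 hSS) (a := x) ?_ ?_
    · rw [← hA.2]; exact mem_inter.2 ⟨hx.1, hxT⟩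
    · rw [← hB.2]; exact mem_inter.2 ⟨hx.2, hxT⟩
  · exact (disjoint_left.1 hd) (mem_sdiff.2 ⟨hx.1, hxT⟩) (mem_sdiff.2 ⟨hx.2, hxT⟩)

lemma trace_ground (hT : T ⊆ Icc 1 n) (hT4 : #T = 4) : #(Icc 1 n \ T) = n - 4 := by
  rw [card_sdiff_of_subset hT, hT4]; simp

lemma trace_le (hF : F ⊆ powersetCard k (Icc 1 n)) (hT : T ⊆ Icc 1 n) (hT4 : #T = 4)
    (S : Finset ℕ) : traceCount F T S ≤ (n - 4).choose (k - #S) := by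
  have h := trace_fam (T := T) hF S
  rw [← h.1, ← trace_ground hT hT4, ← card_powersetCard]
  exact card_le_card h.2

lemma trace_small (hk : 3 ≤ k) (hn : 6 * k ≤ n) (hF : F ⊆ powersetCard k (Icc 1 n))
    (hint : ∀ A ∈ F, ∀ B ∈ F, (A ∩ B).Nonempty) (hT : T ⊆ Icc 1 n) (hT4 : #T = 4)
    {S S' : Finset ℕ} (hSS : Disjoint S S') {i j : ℕ} (hi : #S = i) (hj : #S' = j)
    (hj1 : 1 ≤ j) (hj2 : j ≤ 2) (hs : traceCount F T S' ≤ (n - 5).choose (k - j - 1)) :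
    traceCount F T S * (n - 5).choose (k - j - 1) + (n - 5).choose (k - i) * traceCount F T S'
      ≤ (n - 4).choose (k - i) * (n - 5).choose (k - j - 1) := by
  have h := trace_fam (T := T) hF S
  have h' := trace_fam (T := T) hF S'
  have := cross_gen _ (trace_ground hT hT4) _ _ h.2 h'.2 (by omega) (by omega)
    (trace_cross hint hSS) (by rw [h'.1, hj]; exact hs)
  rw [h.1, h'.1, hi, hj] at this
  exact this

lemma trace_large (hk : 3 ≤ k) (hn : 6 * k ≤ n) (hF : F ⊆ powersetCard k (Icc 1 n))
    (hint : ∀ A ∈ F, ∀ B ∈ F, (A ∩ B).Nonempty) (hT : T ⊆ Icc 1 n) (hT4 : #T = 4)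
    {S S' : Finset ℕ} (hSS : Disjoint S S') {i j : ℕ} (hi : #S = i) (hj : #S' = j)
    (hi2 : i ≤ 2) (hj2 : j ≤ 2) (hs : ¬ traceCount F T S' ≤ (n - 5).choose (k - j - 1)) :
    traceCount F T S ≤ (n - 5).choose (k - i - 1) := by
  have h := trace_fam (T := T) hF S
  have h' := trace_fam (T := T) hF S'
  have := cross_gen_large _ (trace_ground hT hT4) _ _ h.2 h'.2 (by omega) (by omega) (by omega)
    (trace_cross hint hSS) (by rw [h'.1, hj]; exact (not_le.1 hs).le)
  rw [h.1, hi] at this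
  exact this

lemma trace_degree {a b c d : ℕ} (hT : T = {a, b, c, d}) (hab : a ≠ b) (hac : a ≠ c)
    (had : a ≠ d) (hbc : b ≠ c) (hbd : b ≠ d) (hcd : c ≠ d) :
    degree F a = traceCount F T {a} + traceCount F T {a, b} + traceCount F T {a, c}
      + traceCount F T {a, d} + traceCount F T {a, b, c} + traceCount F T {a, b, d}
      + traceCount F T {a, c, d} + traceCount F T {a, b, c, d} := by
  have h1 : degree F a = ∑ S ∈ ({b, c, d} : Finset ℕ).powerset, traceCount F T (insert a S) := by
    unfold degree traceCount
    rw [card_eq_sum_card_fiberwise (f := fun A => (A ∩ T).erase a)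
      (t := ({b, c, d} : Finset ℕ).powerset)]
    · refine sum_congr rfl fun S hS => ?_
      rw [filter_filter]
      congr 1
      refine filter_congr fun A _ => ?_
      have haS : a ∉ S := by
        intro h
        have := mem_powerset.1 hS h
        simp [hab, hac, had] at this
      constructor
      · rintro ⟨hA, rfl⟩
        rw [insert_erase]
        simp [hT, hA]
      · intro h
        refine ⟨?_, by rw [h, erase_insert haS]⟩
        have : a ∈ A ∩ T := by rw [h]; simp
        exact (mem_inter.1 this).1
    · intro A _
      simp only [coe_powerset, Set.mem_preimage, Set.mem_powerset_iff, coe_subset]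
      intro x hx
      simp [hT] at hx ⊢
      tauto
  rw [h1, sum_powerset_insert (by simp [hbc, hbd]), sum_powerset_insert (by simp [hcd]),
    sum_powerset_insert (by simp [hcd]), ← insert_empty_eq d, sum_powerset_insert (by simp),
    sum_powerset_insert (by simp), sum_powerset_insert (by simp), sum_powerset_insert (by simp)]
  simp only [powerset_empty, sum_singleton, insert_empty_eq]
  ring

end Trace

set_option linter.unusedSimpArgs false

section Assembly
variable {n k : ℕ} {F : Finset (Finset ℕ)} {T : Finset ℕ} {a b c d : ℕ}

lemma trace_degree_all (hT : T = {a, b, c, d}) (hab : a ≠ b) (hac : a ≠ c)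
    (had : a ≠ d) (hbc : b ≠ c) (hbd : b ≠ d) (hcd : c ≠ d) :
    (degree F a = traceCount F T {a} + traceCount F T {a, b} + traceCount F T {a, c}
      + traceCount F T {a, d} + traceCount F T {a, b, c} + traceCount F T {a, b, d}
      + traceCount F T {a, c, d} + traceCount F T {a, b, c, d}) ∧
    (degree F b = traceCount F T {b} + traceCount F T {a, b} + traceCount F T {b, c}
      + traceCount F T {b, d} + traceCount F T {a, b, c} + traceCount F T {a, b, d}
      + traceCount F T {b, c, d} + traceCount F T {a, b, c, d}) ∧
    (degree F c = traceCount F T {c} + traceCount F T {a, c} + traceCount F T {b, c}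
      + traceCount F T {c, d} + traceCount F T {a, b, c} + traceCount F T {a, c, d}
      + traceCount F T {b, c, d} + traceCount F T {a, b, c, d}) ∧
    (degree F d = traceCount F T {d} + traceCount F T {a, d} + traceCount F T {b, d}
      + traceCount F T {c, d} + traceCount F T {a, b, d} + traceCount F T {a, c, d}
      + traceCount F T {b, c, d} + traceCount F T {a, b, c, d}) := by
  refine ⟨trace_degree hT hab hac had hbc hbd hcd, ?_, ?_, ?_⟩
  · rw [trace_degree (T := T) (a := b) (b := a) (c := c) (d := d) (by rw [hT]; grind) hab.symm hbc hbd hac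
      had hcd]
    rw [show ({b, a} : Finset ℕ) = {a, b} by grind, show ({b, a, c} : Finset ℕ) = {a, b, c} by grind,
      show ({b, a, d} : Finset ℕ) = {a, b, d} by grind,
      show ({b, a, c, d} : Finset ℕ) = {a, b, c, d} by grind]
  · rw [trace_degree (T := T) (a := c) (b := a) (c := b) (d := d) (by rw [hT]; grind) hac.symm hbc.symm hcd hab
      had hbd]
    rw [show ({c, a} : Finset ℕ) = {a, c} by grind, show ({c, b} : Finset ℕ) = {b, c} by grind,
      show ({c, a, b} : Finset ℕ) = {a, b, c} by grind,
      show ({c, a, d} : Finset ℕ) = {a, c, d} by grind,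
      show ({c, b, d} : Finset ℕ) = {b, c, d} by grind,
      show ({c, a, b, d} : Finset ℕ) = {a, b, c, d} by grind]
  · rw [trace_degree (T := T) (a := d) (b := a) (c := b) (d := c) (by rw [hT]; grind) had.symm hbd.symm
      hcd.symm hab hac hbc]
    rw [show ({d, a} : Finset ℕ) = {a, d} by grind, show ({d, b} : Finset ℕ) = {b, d} by grind,
      show ({d, c} : Finset ℕ) = {c, d} by grind,
      show ({d, a, b} : Finset ℕ) = {a, b, d} by grind,
      show ({d, a, c} : Finset ℕ) = {a, c, d} by grind,
      show ({d, b, c} : Finset ℕ) = {b, c, d} by grind,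
      show ({d, a, b, c} : Finset ℕ) = {a, b, c, d} by grind]

/-- the standing hypotheses, with the four elements of `T` of large degree -/
structure Setup (n k : ℕ) (F : Finset (Finset ℕ)) (T : Finset ℕ) : Prop where
  hk : 3 ≤ k
  hn : 6 * k ≤ n
  hF : F ⊆ powersetCard k (Icc 1 n)
  hint : ∀ A ∈ F, ∀ B ∈ F, (A ∩ B).Nonempty
  hT : T ⊆ Icc 1 n
  hT4 : #T = 4
  hdeg : ∀ x ∈ T, (n - 2).choose (k - 2) + (n - 4).choose (k - 3) < degree F x

lemma Setup.fact21 (h : Setup n k F T) {x y z : ℕ} (hxy : x ≠ y) (hxz : x ≠ z) (hyz : y ≠ z)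
    (hs : traceCount F T {z} ≤ (n - 5).choose (k - 2)) :
    (traceCount F T {x, y} : ℝ) + traceCount F T {z}
      ≤ (n - 5).choose (k - 2) + (n - 5).choose (k - 3) := by
  have hk := h.hk
  have hn := h.hn
  have e : k - 1 - 1 = k - 2 := by omega
  have h1 := trace_small h.hk h.hn h.hF h.hint h.hT h.hT4 (S := {x, y}) (S' := {z}) (by simp only [disjoint_insert_left, disjoint_insert_right, disjoint_singleton, disjoint_singleton_right, disjoint_singleton_left, mem_insert, mem_singleton]; omega)
    (card_pair hxy) (card_singleton z) (by omega) (by omega) (by rw [e]; exact hs)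
  rw [e] at h1
  have hpos : 0 < (n - 5).choose (k - 2) := Nat.choose_pos (by omega)
  have h2 : (n - 4).choose (k - 2) = (n - 5).choose (k - 3) + (n - 5).choose (k - 2) := by
    rw [show n - 4 = (n - 5) + 1 by omega, show k - 2 = (k - 3) + 1 by omega, Nat.choose_succ_succ]
  have h3 : traceCount F T {x, y} + traceCount F T {z} ≤ (n - 4).choose (k - 2) := by
    refine Nat.le_of_mul_le_mul_right ?_ hpos
    linarith
  rw [h2] at h3
  have : ((traceCount F T {x, y} + traceCount F T {z} : ℕ) : ℝ)
    ≤ ((n - 5).choose (k - 3) + (n - 5).choose (k - 2) : ℕ) := by exact_mod_cast h3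
  push_cast at this
  linarith

lemma Setup.fact22 (h : Setup n k F T) {x y z w : ℕ} (hxy : x ≠ y) (hxz : x ≠ z) (hyz : y ≠ z)
    (hxw : x ≠ w) (hyw : y ≠ w) (hzw : z ≠ w)
    (hs : traceCount F T {z, w} ≤ (n - 5).choose (k - 3)) :
    (traceCount F T {x, y} : ℝ) * (n - 5).choose (k - 3)
      + (n - 5).choose (k - 2) * traceCount F T {z, w}
      ≤ ((n - 5).choose (k - 2) + (n - 5).choose (k - 3)) * (n - 5).choose (k - 3) := by
  have hk := h.hk
  have hn := h.hn
  have e : k - 2 - 1 = k - 3 := by omega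
  have h1 := trace_small h.hk h.hn h.hF h.hint h.hT h.hT4 (S := {x, y}) (S' := {z, w}) (by simp only [disjoint_insert_left, disjoint_insert_right, disjoint_singleton, disjoint_singleton_right, disjoint_singleton_left, mem_insert, mem_singleton]; omega)
    (card_pair hxy) (card_pair hzw) (by omega) (by omega) (by rw [e]; exact hs)
  rw [e] at h1
  have h2 : (n - 4).choose (k - 2) = (n - 5).choose (k - 2) + (n - 5).choose (k - 3) := by
    rw [show n - 4 = (n - 5) + 1 by omega, show k - 2 = (k - 3) + 1 by omega, Nat.choose_succ_succ,
      add_comm]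
  rw [h2] at h1
  exact_mod_cast h1

lemma Setup.fact31 (h : Setup n k F T) {x y z w : ℕ} (hxy : x ≠ y) (hxz : x ≠ z) (hyz : y ≠ z)
    (hxw : x ≠ w) (hyw : y ≠ w) (hzw : z ≠ w)
    (hs : traceCount F T {w} ≤ (n - 5).choose (k - 2)) :
    (traceCount F T {x, y, z} : ℝ) * (n - 5).choose (k - 2)
      + (n - 5).choose (k - 3) * traceCount F T {w}
      ≤ (n - 4).choose (k - 3) * (n - 5).choose (k - 2) := by
  have hk := h.hk
  have hn := h.hn
  have e : k - 1 - 1 = k - 2 := by omega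
  have h1 := trace_small h.hk h.hn h.hF h.hint h.hT h.hT4 (S := {x, y, z}) (S' := {w}) (by simp only [disjoint_insert_left, disjoint_insert_right, disjoint_singleton, disjoint_singleton_right, disjoint_singleton_left, mem_insert, mem_singleton]; omega)
    (card_eq_three.2 ⟨x, y, z, hxy, hxz, hyz, rfl⟩) (card_singleton w) (by omega) (by omega)
    (by rw [e]; exact hs)
  rw [e] at h1
  exact_mod_cast h1

lemma Setup.fact3 (h : Setup n k F T) {x y z : ℕ} (hxy : x ≠ y) (hxz : x ≠ z) (hyz : y ≠ z) :
    (traceCount F T {x, y, z} : ℝ) ≤ (n - 4).choose (k - 3) := by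
  have h1 := trace_le h.hF h.hT h.hT4 {x, y, z}
  rw [card_eq_three.2 ⟨x, y, z, hxy, hxz, hyz, rfl⟩] at h1
  exact_mod_cast h1

lemma Setup.fact4 (h : Setup n k F T) : ∃ Q : ℕ, traceCount F T T ≤ Q ∧
    (n - 2).choose (k - 2) + (n - 4).choose (k - 3) =
      (n - 5).choose (k - 2) + (n - 5).choose (k - 3) + 3 * (n - 4).choose (k - 3) + Q := by
  have hk := h.hk
  have hn := h.hn
  obtain ⟨m, rfl⟩ : ∃ m, n = m + 5 := ⟨n - 5, by omega⟩
  rcases Nat.lt_or_ge k 4 with hk4 | hk4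
  · have : k = 3 := by omega
    subst this
    refine ⟨0, ?_, ?_⟩
    · rw [traceCount, Nat.le_zero, card_eq_zero, filter_eq_empty_iff]
      intro A hA hAT
      have h1 := (mem_powersetCard.1 (h.hF hA)).2
      have h2 := card_le_card (inter_subset_left (s₁ := A) (s₂ := T))
      rw [hAT, h.hT4] at h2
      omega
    · simp
  · obtain ⟨j, rfl⟩ : ∃ j, k = j + 4 := ⟨k - 4, by omega⟩
    refine ⟨(m + 1).choose j, ?_, ?_⟩
    · have := trace_le h.hF h.hT h.hT4 T
      rw [h.hT4] at this
      simpa using this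
    · have e1 : m + 5 - 2 = m + 3 := by omega
      have e2 : m + 5 - 4 = m + 1 := by omega
      have e3 : m + 5 - 5 = m := by omega
      have e4 : j + 4 - 2 = j + 2 := by omega
      have e5 : j + 4 - 3 = j + 1 := by omega
      rw [e1, e2, e3, e4, e5]
      have c1 := Nat.choose_succ_succ (m + 2) (j + 1)
      have c2 := Nat.choose_succ_succ (m + 1) (j + 1)
      have c3 := Nat.choose_succ_succ (m + 1) j
      have c4 := Nat.choose_succ_succ m (j + 1)
      simp only [Nat.succ_eq_add_one, add_assoc, Nat.reduceAdd] at c1 c2 c3 c4 ⊢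
      omega

lemma Setup.ratio (h : Setup n k F T) :
    (0 : ℝ) < (n - 5).choose (k - 3) ∧ (4 : ℝ) * (n - 5).choose (k - 3) ≤ (n - 5).choose (k - 2) := by
  have hk := h.hk
  have hn := h.hn
  have hpos : 0 < (n - 5).choose (k - 3) := Nat.choose_pos (by omega)
  refine ⟨by exact_mod_cast hpos, ?_⟩
  have h1 := Nat.choose_succ_right_eq (n - 5) (k - 3)
  rw [show k - 3 + 1 = k - 2 by omega] at h1
  have h2 : 4 * (n - 5).choose (k - 3) ≤ (n - 5).choose (k - 2) := by
    refine Nat.le_of_mul_le_mul_right (c := k - 2) ?_ (by omega)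
    rw [h1]
    have : 4 * (k - 2) ≤ n - 5 - (k - 3) := by omega
    calc 4 * (n - 5).choose (k - 3) * (k - 2) = (n - 5).choose (k - 3) * (4 * (k - 2)) := by ring
      _ ≤ _ := Nat.mul_le_mul_left _ this
  exact_mod_cast h2

lemma Setup.star (h : Setup n k F T) (hT : T = {a, b, c, d}) (hab : a ≠ b) (hac : a ≠ c)
    (had : a ≠ d) (hbc : b ≠ c) (hbd : b ≠ d) (hcd : c ≠ d)
    (sb : traceCount F T {b} ≤ (n - 5).choose (k - 2))
    (sc : traceCount F T {c} ≤ (n - 5).choose (k - 2))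
    (sd : traceCount F T {d} ≤ (n - 5).choose (k - 2))
    (sbc : traceCount F T {b, c} ≤ (n - 5).choose (k - 3))
    (sbd : traceCount F T {b, d} ≤ (n - 5).choose (k - 3))
    (scd : traceCount F T {c, d} ≤ (n - 5).choose (k - 3)) : False := by
  obtain ⟨Q, hQ, hB⟩ := h.fact4
  obtain ⟨hN3, hN⟩ := h.ratio
  obtain ⟨-, e2, e3, e4⟩ := trace_degree_all (F := F) hT hab hac had hbc hbd hcd
  rw [← hT] at e2 e3 e4
  have d2 := h.hdeg b (by rw [hT]; simp)
  have d3 := h.hdeg c (by rw [hT]; simp)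
  have d4 := h.hdeg d (by rw [hT]; simp)
  rw [hB, e2] at d2
  rw [hB, e3] at d3
  rw [hB, e4] at d4
  exact star_arith hN3 hN
    (h.fact21 hab hac hbc sc) (h.fact21 hac had hcd sd) (h.fact21 had hab hbd.symm sb)
    (h.fact22 hab hac hbc had hbd hcd scd)
    (h.fact22 hac hab hbc.symm had hcd hbd sbd)
    (h.fact22 had hab hbd.symm hac hcd.symm hbc sbc)
    (h.fact31 hab hac hbc had hbd hcd sd)
    (h.fact31 hab had hbd hac hbc hcd.symm sc)
    (h.fact31 hac had hcd hab hbc.symm hbd.symm sb)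
    (h.fact3 hbc hbd hcd) (Nat.cast_le.2 hQ)
    (by exact_mod_cast d2) (by exact_mod_cast d3) (by exact_mod_cast d4)

/-- here `d` is the centre of the three small pairs -/
lemma Setup.tri (h : Setup n k F T) (hT : T = {a, b, c, d}) (hab : a ≠ b) (hac : a ≠ c)
    (had : a ≠ d) (hbc : b ≠ c) (hbd : b ≠ d) (hcd : c ≠ d)
    (sa : traceCount F T {a} ≤ (n - 5).choose (k - 2))
    (sb : traceCount F T {b} ≤ (n - 5).choose (k - 2))
    (sc : traceCount F T {c} ≤ (n - 5).choose (k - 2))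
    (sd : traceCount F T {d} ≤ (n - 5).choose (k - 2))
    (sad : traceCount F T {a, d} ≤ (n - 5).choose (k - 3))
    (sbd : traceCount F T {b, d} ≤ (n - 5).choose (k - 3))
    (scd : traceCount F T {c, d} ≤ (n - 5).choose (k - 3)) : False := by
  obtain ⟨Q, hQ, hB⟩ := h.fact4
  obtain ⟨hN3, hN⟩ := h.ratio
  obtain ⟨e1, e2, e3, e4⟩ := trace_degree_all (F := F) hT hab hac had hbc hbd hcd
  rw [← hT] at e1 e2 e3 e4
  have d1 := h.hdeg a (by rw [hT]; simp)
  have d2 := h.hdeg b (by rw [hT]; simp)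
  have d3 := h.hdeg c (by rw [hT]; simp)
  have d4 := h.hdeg d (by rw [hT]; simp)
  rw [hB, e1] at d1
  rw [hB, e2] at d2
  rw [hB, e3] at d3
  rw [hB, e4] at d4
  exact tri_arith hN3 hN (f1 := traceCount F T {a}) (f2 := traceCount F T {b})
    (f3 := traceCount F T {c}) (f4 := traceCount F T {d})
    (Nat.cast_nonneg _) (Nat.cast_nonneg _) (Nat.cast_nonneg _) (Nat.cast_nonneg _)
    (h.fact21 hab hac hbc sc) (h.fact21 hac hab hbc.symm sb) (h.fact21 hbc hab.symm hac.symm sa)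
    (h.fact21 hab had hbd sd) (h.fact21 hac had hcd sd) (h.fact21 hbc hbd hcd sd)
    (h.fact22 hab hac hbc had hbd hcd scd)
    (h.fact22 hac hab hbc.symm had hcd hbd sbd)
    (h.fact22 hbc hab.symm hac.symm hbd hcd had sad)
    (h.fact31 hab hac hbc had hbd hcd sd)
    (h.fact31 hab had hbd hac hbc hcd.symm sc)
    (h.fact31 hac had hcd hab hbc.symm hbd.symm sb)
    (h.fact31 hbc hbd hcd hab.symm hac.symm had.symm sa)
    (Nat.cast_le.2 hQ)
    (by exact_mod_cast d1) (by exact_mod_cast d2) (by exact_mod_cast d3) (by exact_mod_cast d4)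

/-- if a single trace is large, then it is a star case -/
lemma Setup.single_large (h : Setup n k F T) (hT : T = {a, b, c, d}) (hab : a ≠ b) (hac : a ≠ c)
    (had : a ≠ d) (hbc : b ≠ c) (hbd : b ≠ d) (hcd : c ≠ d) :
    traceCount F T {a} ≤ (n - 5).choose (k - 2) := by
  by_contra hs
  have hk := h.hk
  have e : k - 1 - 1 = k - 2 := by omega
  have e' : k - 2 - 1 = k - 3 := by omega
  have l1 : ∀ x, x ≠ a → traceCount F T {x} ≤ (n - 5).choose (k - 2) := by
    intro x hx
    have := trace_large h.hk h.hn h.hF h.hint h.hT h.hT4 (S := {x}) (S' := {a}) (by simp only [disjoint_insert_left, disjoint_insert_right, disjoint_singleton, disjoint_singleton_right, disjoint_singleton_left, mem_insert, mem_singleton]; omega)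
      (card_singleton x) (card_singleton a) (by omega) (by omega) (by rw [e]; exact hs)
    rwa [e] at this
  have l2 : ∀ x y, x ≠ a → y ≠ a → x ≠ y → traceCount F T {x, y} ≤ (n - 5).choose (k - 3) := by
    intro x y hx hy hxy
    have := trace_large h.hk h.hn h.hF h.hint h.hT h.hT4 (S := {x, y}) (S' := {a}) (by simp only [disjoint_insert_left, disjoint_insert_right, disjoint_singleton, disjoint_singleton_right, disjoint_singleton_left, mem_insert, mem_singleton]; omega)
      (card_pair hxy) (card_singleton a) (by omega) (by omega) (by rw [e]; exact hs)
    rwa [e'] at this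
  exact h.star hT hab hac had hbc hbd hcd (l1 b hab.symm) (l1 c hac.symm) (l1 d had.symm)
    (l2 b c hab.symm hac.symm hbc) (l2 b d hab.symm had.symm hbd) (l2 c d hac.symm had.symm hcd)

lemma Setup.pair_alt (h : Setup n k F T) (hab : a ≠ b) (hac : a ≠ c)
    (had : a ≠ d) (hbc : b ≠ c) (hbd : b ≠ d) (hcd : c ≠ d) :
    traceCount F T {a, b} ≤ (n - 5).choose (k - 3) ∨
    traceCount F T {c, d} ≤ (n - 5).choose (k - 3) := by
  by_contra! hs
  have hk := h.hk
  have e' : k - 2 - 1 = k - 3 := by omega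
  have := trace_large h.hk h.hn h.hF h.hint h.hT h.hT4 (S := {a, b}) (S' := {c, d}) (by simp only [disjoint_insert_left, disjoint_insert_right, disjoint_singleton, disjoint_singleton_right, disjoint_singleton_left, mem_insert, mem_singleton]; omega)
      (card_pair hab) (card_pair hcd) (by omega) (by omega) (by rw [e']; exact not_le.2 hs.2)
  rw [e'] at this
  omega

lemma Setup.false (h : Setup n k F T) : False := by
  obtain ⟨a, T', haT, hT, hT'⟩ := card_eq_succ.1 (show #T = 3 + 1 from h.hT4)
  obtain ⟨b, c, d, hbc, hbd, hcd, rfl⟩ := card_eq_three.1 hT'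
  have hT := hT.symm
  simp only [mem_insert, mem_singleton, not_or] at haT
  obtain ⟨hab, hac, had⟩ := haT
  have hTb : T = {b, a, c, d} := by rw [hT]; grind
  have hTc : T = {c, a, b, d} := by rw [hT]; grind
  have hTd : T = {d, a, b, c} := by rw [hT]; grind
  have sa := h.single_large hT hab hac had hbc hbd hcd
  have sb := h.single_large hTb (Ne.symm hab) hbc hbd hac had hcd
  have sc := h.single_large hTc (Ne.symm hac) hbc.symm hcd hab had hbd
  have sd := h.single_large hTd (Ne.symm had) hbd.symm hcd.symm hab hac hbc
  have sw : ∀ x y, traceCount F T {x, y} ≤ (n - 5).choose (k - 3) →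
      traceCount F T {y, x} ≤ (n - 5).choose (k - 3) := by
    intro x y hxy; rwa [pair_comm]
  rcases h.pair_alt hab hac had hbc hbd hcd with p | p <;>
  rcases h.pair_alt hac hab had hbc.symm hcd hbd with q | q <;>
  rcases h.pair_alt had hab hac hbd.symm hcd.symm hbc with r | r
  · exact h.tri (a := b) (b := c) (c := d) (d := a) (by rw [hT]; grind) hbc hbd (Ne.symm hab) hcd
      (Ne.symm hac) (Ne.symm had) sb sc sd sa (sw _ _ p) (sw _ _ q) (sw _ _ r)
  · exact h.star hTd (Ne.symm had) hbd.symm hcd.symm hab hac hbc sa sb sc p q r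
  · exact h.star hTc (Ne.symm hac) hbc.symm hcd hab had hbd sa sb sd p r q
  · exact h.tri (a := a) (b := c) (c := d) (d := b) (by rw [hT]; grind) hac had hab hcd
      hbc.symm hbd.symm sa sc sd sb p (sw _ _ r) (sw _ _ q)
  · exact h.star hTb (Ne.symm hab) hbc hbd hac had hcd sa sc sd q r p
  · exact h.tri (a := a) (b := b) (c := d) (d := c) (by rw [hT]; grind) hab had hac hbd
      hbc hcd.symm sa sb sd sc q r (sw _ _ p)
  · exact h.tri hT hab hac had hbc hbd hcd sa sb sc sd r q p
  · exact h.star hT hab hac had hbc hbd hcd sb sc sd r q p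

end Assembly

lemma exists_four {n B : ℕ} {F : Finset (Finset ℕ)} (h : B < nthDegree n F 4) :
    ∃ T ⊆ Icc 1 n, #T = 4 ∧ ∀ x ∈ T, B < degree F x := by
  unfold nthDegree at h
  set L := ((Finset.Icc 1 n).val.map (degree F)).sort (· ≥ ·) with hL
  have hsorted : L.Pairwise (· ≥ ·) := Multiset.pairwise_sort _ _
  have hlen : 3 < L.length := by
    by_contra hc
    rw [List.getD_eq_default _ _ (by omega)] at h
    omega
  rw [List.getD_eq_getElem _ _ hlen] at h
  have hcount : 4 ≤ L.countP (fun x => decide (B < x)) := by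
    have h1 : (L.take 4).countP (fun x => decide (B < x)) = 4 := by
      rw [List.countP_eq_length.2, List.length_take]
      · omega
      · intro x hx
        obtain ⟨i, hi, rfl⟩ := List.mem_iff_getElem.1 hx
        rw [List.length_take] at hi
        rw [List.getElem_take]
        have : L[3] ≤ L[i] := by
          rcases Nat.lt_or_ge i 3 with h3 | h3
          · exact (List.pairwise_iff_getElem.1 hsorted) i 3 (by omega) hlen h3
          · have : i = 3 := by omega
            subst this; exact le_refl _
        simpa using lt_of_lt_of_le h this
    rw [← h1]
    exact (List.take_sublist 4 L).countP_le
  have hcard : 4 ≤ #((Icc 1 n).filter fun x => B < degree F x) := by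
    have h2 : (L : Multiset ℕ) = (Finset.Icc 1 n).val.map (degree F) := Multiset.sort_eq _ _
    have h3 : Multiset.countP (fun x => B < x) (L : Multiset ℕ) = L.countP (fun x => decide (B < x)) :=
      Multiset.coe_countP _ _
    rw [← h3, h2, Multiset.countP_map] at hcount
    exact hcount
  obtain ⟨T, hT, hT4⟩ := exists_subset_card_eq hcard
  exact ⟨T, hT.trans (filter_subset _ _), hT4, fun x hx => (mem_filter.1 (hT hx)).2⟩

theorem stmt_5 (n k : ℕ) (hk : 3 ≤ k) (hn : 6 * k ≤ n)
    (F : Finset (Finset ℕ)) (hF : F ⊆ Finset.powersetCard k (Finset.Icc 1 n))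
    (hint : ∀ A ∈ F, ∀ B ∈ F, (A ∩ B).Nonempty) :
    nthDegree n F 4 ≤ (n - 2).choose (k - 2) + (n - 4).choose (k - 3) := by
  by_contra hcon
  obtain ⟨T, hT, hT4, hdeg⟩ := exists_four (not_le.1 hcon)
  exact (Setup.mk hk hn hF hint hT hT4 hdeg).false
end

section
/- Let k and ℓ be integers with 4 ≤ ℓ ≤ k, let n > 2ℓ²k, and let F ⊆ \binom{[n]}{k} be an intersecting family. Then the (ℓ+1)-th largest degree satisfies d_{ℓ+1}(F) ≤ \binom{n-2}{k-2} + \binom{n-ℓ-1}{k-ℓ}. -/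
open Finset

namespace S6

/-- shift of a single set -/
def sh (i j : ℕ) (A : Finset ℕ) : Finset ℕ :=
  if j ∈ A ∧ i ∉ A then insert i (A.erase j) else A

/-- shift of a set relative to a family -/
def phi (F : Finset (Finset ℕ)) (i j : ℕ) (A : Finset ℕ) : Finset ℕ :=
  if sh i j A ∈ F then A else sh i j A

/-- weights -/
def wt (X : Finset ℕ) (a : ℕ) : ℕ := if a ∈ X then 0 else a

def Inter (F : Finset (Finset ℕ)) : Prop := ∀ A ∈ F, ∀ B ∈ F, (A ∩ B).Nonempty

def Shifted (n : ℕ) (X : Finset ℕ) (F : Finset (Finset ℕ)) : Prop :=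
  ∀ A ∈ F, ∀ i ∈ Finset.Icc 1 n, ∀ j ∈ A, wt X i < wt X j → i ∉ A → insert i (A.erase j) ∈ F

lemma phi_injOn (F : Finset (Finset ℕ)) (i j : ℕ) (hij : i ≠ j) :
    Set.InjOn (phi F i j) F := by
  intro A hA B hB h
  simp only [Finset.mem_coe] at hA hB
  unfold phi at h
  split_ifs at h with h1 h2 h2
  · exact h
  · exact absurd (h ▸ hA) h2
  · exact absurd (h ▸ hB) h1
  · have c1 : j ∈ A ∧ i ∉ A := by
      by_contra hc; exact h1 (by rw [sh, if_neg hc]; exact hA)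
    have c2 : j ∈ B ∧ i ∉ B := by
      by_contra hc; exact h2 (by rw [sh, if_neg hc]; exact hB)
    rw [sh, sh, if_pos c1, if_pos c2] at h
    ext a
    have := Finset.ext_iff.1 h a
    simp only [Finset.mem_insert, Finset.mem_erase] at this
    by_cases ha : a = j
    · subst ha; simp [c1, c2]
    · by_cases hb : a = i
      · subst hb; simp [c1, c2]
      · simpa [ha, hb] using this

lemma phi_inter (F : Finset (Finset ℕ)) (i j : ℕ) (hij : i ≠ j) (h : Inter F) :
    Inter (F.image (phi F i j)) := by
  -- mixed case
  have mixed : ∀ A ∈ F, ∀ B ∈ F, sh i j A ∈ F → sh i j B ∉ F → (A ∩ sh i j B).Nonempty := by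
    intro A hA B hB h1 h2
    have c2 : j ∈ B ∧ i ∉ B := by
      by_contra hc; exact h2 (by rw [sh, if_neg hc]; exact hB)
    rw [sh, if_pos c2]
    by_cases hiA : i ∈ A
    · exact ⟨i, by simp [hiA]⟩
    by_cases hjA : j ∈ A
    · rw [sh, if_pos ⟨hjA, hiA⟩] at h1
      obtain ⟨a, ha⟩ := h _ h1 B hB
      simp only [Finset.mem_inter, Finset.mem_insert, Finset.mem_erase] at ha
      refine ⟨a, ?_⟩
      simp only [Finset.mem_inter, Finset.mem_insert, Finset.mem_erase]
      rcases ha with ⟨rfl | ⟨h3, h4⟩, h5⟩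
      · exact absurd h5 c2.2
      · exact ⟨h4, Or.inr ⟨h3, h5⟩⟩
    · obtain ⟨a, ha⟩ := h A hA B hB
      simp only [Finset.mem_inter] at ha
      refine ⟨a, ?_⟩
      simp only [Finset.mem_inter, Finset.mem_insert, Finset.mem_erase]
      exact ⟨ha.1, Or.inr ⟨fun e => hjA (e ▸ ha.1), ha.2⟩⟩
  intro A' hA' B' hB'
  obtain ⟨A, hA, rfl⟩ := Finset.mem_image.1 hA'
  obtain ⟨B, hB, rfl⟩ := Finset.mem_image.1 hB'
  unfold phi
  split_ifs with h1 h2 h2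
  · exact h A hA B hB
  · exact mixed A hA B hB h1 h2
  · rw [Finset.inter_comm]; exact mixed B hB A hA h2 h1
  · have c1 : j ∈ A ∧ i ∉ A := by
      by_contra hc; exact h1 (by rw [sh, if_neg hc]; exact hA)
    have c2 : j ∈ B ∧ i ∉ B := by
      by_contra hc; exact h2 (by rw [sh, if_neg hc]; exact hB)
    rw [sh, sh, if_pos c1, if_pos c2]
    exact ⟨i, by simp⟩

lemma phi_degree (F : Finset (Finset ℕ)) (i j : ℕ) (hij : i ≠ j) (x : ℕ) (hx : x ≠ j) :
    degree F x ≤ degree (F.image (phi F i j)) x := by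
  unfold degree
  apply Finset.card_le_card_of_injOn (phi F i j)
  · intro A hA
    simp only [Finset.coe_filter, Set.mem_ofPred_eq] at hA ⊢
    refine ⟨Finset.mem_image_of_mem _ hA.1, ?_⟩
    unfold phi sh
    split_ifs <;> simp [hA.2, hx]
  · intro A hA B hB
    simp only [Finset.coe_filter, Set.mem_ofPred_eq] at hA hB
    exact phi_injOn F i j hij hA.1 hB.1

lemma sh_card (i j : ℕ) (A : Finset ℕ) : (sh i j A).card = A.card := by
  unfold sh
  split_ifs with h
  · rw [Finset.card_insert_of_notMem (by simp [h.2]), Finset.card_erase_of_mem h.1]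
    have := Finset.card_pos.2 ⟨j, h.1⟩
    omega
  · rfl

lemma sh_sum (i j : ℕ) (A : Finset ℕ) (f : ℕ → ℕ) (hf : f i < f j) :
    (∑ a ∈ sh i j A, f a) ≤ ∑ a ∈ A, f a ∧
    (sh i j A ≠ A → (∑ a ∈ sh i j A, f a) < ∑ a ∈ A, f a) := by
  unfold sh
  split_ifs with h
  · have h1 : ∑ a ∈ A, f a = f j + ∑ a ∈ A.erase j, f a := (Finset.add_sum_erase _ _ h.1).symm
    rw [Finset.sum_insert (by simp [h.2])]
    constructor
    · omega
    · intro _; omega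
  · simp

lemma exists_shifted (n k : ℕ) (X : Finset ℕ) (N : ℕ) : ∀ (F : Finset (Finset ℕ)),
    (∑ A ∈ F, ∑ a ∈ A, wt X a) = N →
    F ⊆ Finset.powersetCard k (Finset.Icc 1 n) → Inter F →
    ∃ G, G ⊆ Finset.powersetCard k (Finset.Icc 1 n) ∧ Inter G ∧
      (∀ x ∈ X, degree F x ≤ degree G x) ∧ Shifted n X G := by
  induction N using Nat.strong_induction_on with
  | _ N ih =>
  intro F hN hF hI
  by_cases hS : Shifted n X F
  · exact ⟨F, hF, hI, fun _ _ => le_rfl, hS⟩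
  unfold Shifted at hS
  push Not at hS
  obtain ⟨A, hA, i, hi, j, hj, hw, hiA, hnot⟩ := hS
  have hij : i ≠ j := by rintro rfl; exact hiA hj
  have hjX : j ∉ X := by
    intro hjX; simp [wt, hjX] at hw
  have hshA : sh i j A = insert i (A.erase j) := by rw [sh, if_pos ⟨hj, hiA⟩]
  have hlt : (∑ B ∈ F.image (phi F i j), ∑ a ∈ B, wt X a) < N := by
    rw [Finset.sum_image (phi_injOn F i j hij), ← hN]
    apply Finset.sum_lt_sum
    · intro B _
      unfold phi
      split_ifs
      · rfl
      · exact (sh_sum i j B _ hw).1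
    · refine ⟨A, hA, ?_⟩
      unfold phi
      rw [if_neg (by rw [hshA]; exact hnot)]
      apply (sh_sum i j A _ hw).2
      intro he
      rw [hshA] at he
      exact hnot (by rw [he]; exact hA)
  have hsub : F.image (phi F i j) ⊆ Finset.powersetCard k (Finset.Icc 1 n) := by
    intro B' hB'
    obtain ⟨B, hB, rfl⟩ := Finset.mem_image.1 hB'
    have hB2 := Finset.mem_powersetCard.1 (hF hB)
    unfold phi
    split_ifs
    · exact hF hB
    · rw [Finset.mem_powersetCard, sh_card]
      refine ⟨?_, hB2.2⟩
      unfold sh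
      split_ifs
      · exact Finset.insert_subset hi ((Finset.erase_subset _ _).trans hB2.1)
      · exact hB2.1
  obtain ⟨G, h1, h2, h3, h4⟩ := ih _ hlt _ rfl hsub (phi_inter F i j hij hI)
  refine ⟨G, h1, h2, fun x hx => ?_, h4⟩
  exact (phi_degree F i j hij x (by rintro rfl; exact hjX hx)).trans (h3 x hx)

/-- initial segments -/
def P (n : ℕ) (X : Finset ℕ) (m : ℕ) : Finset ℕ := (Finset.Icc 1 n).filter fun a => wt X a ≤ m

lemma initial_lemma (n k : ℕ) (X : Finset ℕ) (G : Finset (Finset ℕ))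
    (hG : G ⊆ Finset.powersetCard k (Finset.Icc 1 n)) (hI : Inter G) (hS : Shifted n X G)
    (B : Finset ℕ) (hB : B ∈ G) (c : ℕ) : ∀ A ∈ G, (A ∩ B).card = c → Disjoint (A ∩ B) X →
      (∀ m, (A ∩ P n X m).card + (B ∩ P n X m).card ≤ (P n X m).card) → False := by
  induction c with
  | zero =>
    intro A hA hc _ _
    have := hI A hA B hB
    rw [Finset.card_eq_zero] at hc
    simp [hc] at this
  | succ c ih =>
    intro A hA hc hd hm
    have hne : (A ∩ B).Nonempty := hI A hA B hB
    obtain ⟨y, hy, hmin⟩ := Finset.exists_min_image (A ∩ B) id hne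
    have hAV := (Finset.mem_powersetCard.1 (hG hA)).1
    have hBV := (Finset.mem_powersetCard.1 (hG hB)).1
    have hyA := (Finset.mem_inter.1 hy).1
    have hyB := (Finset.mem_inter.1 hy).2
    have hyX : y ∉ X := fun h => Finset.disjoint_left.1 hd hy h
    have hwy : wt X y = y := by simp [wt, hyX]
    have hyP : y ∈ P n X y := by
      simp only [P, Finset.mem_filter]; exact ⟨hAV hyA, hwy.le⟩
    -- free element
    have hz : ∃ z ∈ P n X y, z ∉ A ∧ z ∉ B := by
      by_contra hcon
      push Not at hcon
      have h1 : (A ∩ P n X y) ∪ (B ∩ P n X y) = P n X y := by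
        ext a
        simp only [Finset.mem_union, Finset.mem_inter]
        constructor
        · rintro (h | h) <;> exact h.2
        · intro h
          by_cases ha : a ∈ A
          · exact Or.inl ⟨ha, h⟩
          · exact Or.inr ⟨hcon a h ha, h⟩
      have h2 := Finset.card_union_add_card_inter (A ∩ P n X y) (B ∩ P n X y)
      have h3 : 0 < ((A ∩ P n X y) ∩ (B ∩ P n X y)).card :=
        Finset.card_pos.2 ⟨y, by simp [hyA, hyB, hyP]⟩
      have := hm y
      rw [h1] at h2
      omega
    obtain ⟨z, hzP, hzA, hzB⟩ := hz
    have hzy : z ≠ y := by rintro rfl; exact hzA hyA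
    have hzV : z ∈ Finset.Icc 1 n := (Finset.mem_filter.1 hzP).1
    have hzw : wt X z ≤ y := (Finset.mem_filter.1 hzP).2
    have hzlt : wt X z < wt X y := by
      rw [hwy]
      rcases hzw.lt_or_eq with h | h
      · exact h
      · exfalso
        unfold wt at h
        have : 1 ≤ y := (Finset.mem_Icc.1 (hAV hyA)).1
        split_ifs at h
        · omega
        · exact hzy h
    have hnew := hS A hA z hzV y hyA hzlt hzA
    have hinter : (insert z (A.erase y)) ∩ B = (A ∩ B).erase y := by
      ext a
      simp only [Finset.mem_inter, Finset.mem_insert, Finset.mem_erase]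
      constructor
      · rintro ⟨rfl | h, h'⟩
        · exact absurd h' hzB
        · exact ⟨h.1, h.2, h'⟩
      · rintro ⟨h1, h2, h3⟩; exact ⟨Or.inr ⟨h1, h2⟩, h3⟩
    refine ih _ hnew ?_ ?_ ?_
    · rw [hinter, Finset.card_erase_of_mem hy, hc]; rfl
    · rw [hinter]; exact Finset.disjoint_of_subset_left (Finset.erase_subset _ _) hd
    · intro m
      by_cases hym : y ≤ m
      · have hyPm : y ∈ P n X m := by
          simp only [P, Finset.mem_filter]; exact ⟨hAV hyA, by omega⟩
        have h1 : (insert z (A.erase y)) ∩ P n X m ⊆ insert z ((A ∩ P n X m).erase y) := by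
          intro a
          simp only [Finset.mem_inter, Finset.mem_insert, Finset.mem_erase]
          tauto
        have h2 := Finset.card_le_card h1
        have h3 := Finset.card_insert_le z ((A ∩ P n X m).erase y)
        have h4 : y ∈ A ∩ P n X m := Finset.mem_inter.2 ⟨hyA, hyPm⟩
        rw [Finset.card_erase_of_mem h4] at h3
        have h5 := Finset.card_pos.2 ⟨y, h4⟩
        have := hm m
        omega
      · have hdis : Disjoint ((insert z (A.erase y)) ∩ P n X m) (B ∩ P n X m) := by
          rw [Finset.disjoint_left]
          intro a ha hb
          have ha' : a ∈ (insert z (A.erase y)) ∩ B :=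
            Finset.mem_inter.2 ⟨(Finset.mem_inter.1 ha).1, (Finset.mem_inter.1 hb).1⟩
          rw [hinter] at ha'
          have hab := Finset.mem_of_mem_erase ha'
          have h1 := hmin a hab
          have haX : a ∉ X := fun h => Finset.disjoint_left.1 hd hab h
          have h2 : wt X a ≤ m := (Finset.mem_filter.1 (Finset.mem_inter.1 hb).2).2
          simp only [wt, haX, if_false, id] at h1 h2
          omega
        rw [← Finset.card_union_of_disjoint hdis]
        apply Finset.card_le_card
        intro a ha
        rcases Finset.mem_union.1 ha with h | h <;> exact (Finset.mem_inter.1 h).2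

def Fat (n : ℕ) (X A : Finset ℕ) : Prop := ∃ m, (P n X m).card < 2 * (A ∩ P n X m).card

lemma nonfat_inter (n k : ℕ) (X : Finset ℕ) (G : Finset (Finset ℕ))
    (hG : G ⊆ Finset.powersetCard k (Finset.Icc 1 n)) (hI : Inter G) (hS : Shifted n X G)
    (A B : Finset ℕ) (hA : A ∈ G) (hB : B ∈ G) (fA : ¬ Fat n X A) (fB : ¬ Fat n X B) :
    ∃ x ∈ X, x ∈ A ∧ x ∈ B := by
  by_contra hcon
  push Not at hcon
  unfold Fat at fA fB
  push Not at fA fB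
  refine initial_lemma n k X G hG hI hS B hB _ A hA rfl ?_ ?_
  · rw [Finset.disjoint_left]
    intro a ha haX
    exact hcon a haX (Finset.mem_inter.1 ha).1 (Finset.mem_inter.1 ha).2
  · intro m
    have := fA m
    have := fB m
    omega

lemma P_zero (n : ℕ) (X : Finset ℕ) (hX : X ⊆ Finset.Icc 1 n) : P n X 0 = X := by
  ext a
  rw [P, Finset.mem_filter]
  unfold wt
  constructor
  · rintro ⟨h1, h2⟩
    by_contra h
    simp only [h, if_false] at h2
    have := (Finset.mem_Icc.1 h1).1
    omega
  · intro h; exact ⟨hX h, by simp [h]⟩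

lemma P_mono (n : ℕ) (X : Finset ℕ) {m m' : ℕ} (h : m ≤ m') : P n X m ⊆ P n X m' := by
  intro a
  simp only [P, Finset.mem_filter]
  rintro ⟨h1, h2⟩; exact ⟨h1, h2.trans h⟩

lemma card_superset (n k : ℕ) (H : Finset (Finset ℕ)) (R : Finset ℕ)
    (hH : H ⊆ Finset.powersetCard k (Finset.Icc 1 n)) (hR : R ⊆ Finset.Icc 1 n)
    (hRH : ∀ A ∈ H, R ⊆ A) : H.card ≤ (n - R.card).choose (k - R.card) := by
  have h1 : (n - R.card).choose (k - R.card) =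
      (Finset.powersetCard (k - R.card) (Finset.Icc 1 n \ R)).card := by
    rw [Finset.card_powersetCard, Finset.card_sdiff_of_subset hR]; simp
  rw [h1]
  apply Finset.card_le_card_of_injOn (fun A => A \ R)
  · intro A hA
    have hA' := Finset.mem_powersetCard.1 (hH hA)
    rw [Finset.mem_coe]
    refine Finset.mem_powersetCard.2 ⟨Finset.sdiff_subset_sdiff hA'.1 le_rfl, ?_⟩
    rw [Finset.card_sdiff_of_subset (hRH A hA), hA'.2]
  · intro A hA B hB h
    simp only at h
    rw [← Finset.sdiff_union_of_subset (hRH A hA), h, Finset.sdiff_union_of_subset (hRH B hB)]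

lemma choose_ratio (n k a c : ℕ) (ha : 2 ≤ a) (hn : c * k ≤ n) (hc : 1 ≤ c) (hak : a ≤ k) :
    (n - a).choose (k - a) * c ^ (a - 2) ≤ (n - 2).choose (k - 2) := by
  induction a, ha using Nat.le_induction with
  | base => simp
  | succ a ha ih =>
    have ih := ih (by omega)
    obtain ⟨k', rfl⟩ : ∃ k', k = a + 1 + k' := ⟨k - a - 1, by omega⟩
    have hkn : a + 1 + k' ≤ n := le_trans (Nat.le_mul_of_pos_left _ hc) hn
    obtain ⟨n', rfl⟩ : ∃ n', n = a + 1 + n' := ⟨n - a - 1, by omega⟩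
    have e1 : a + 1 + n' - (a + 1) = n' := by omega
    have e2 : a + 1 + k' - (a + 1) = k' := by omega
    have e3 : a + 1 + n' - a = n' + 1 := by omega
    have e4 : a + 1 + k' - a = k' + 1 := by omega
    have e5 : a + 1 - 2 = (a - 2) + 1 := by omega
    rw [e1, e2, e5]
    rw [e3, e4] at ih
    refine le_trans ?_ ih
    have h := Nat.add_one_mul_choose_eq n' k'
    have h2 : c * (k' + 1) ≤ n' + 1 := by
      have : c * (a + 1 + k') = c * (k' + 1) + c * a := by ring
      have h3 : a ≤ c * a := Nat.le_mul_of_pos_left _ hc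
      omega
    have h4 : n'.choose k' * c ≤ (n' + 1).choose (k' + 1) := by
      have : n'.choose k' * c * (k' + 1) ≤ (n' + 1).choose (k' + 1) * (k' + 1) := by
        rw [← h]
        calc n'.choose k' * c * (k' + 1) = (c * (k' + 1)) * n'.choose k' := by ring
          _ ≤ (n' + 1) * n'.choose k' := Nat.mul_le_mul_right _ h2
      exact Nat.le_of_mul_le_mul_right this (by omega)
    calc n'.choose k' * c ^ (a - 2 + 1) = (n'.choose k' * c) * c ^ (a - 2) := by ring
      _ ≤ _ := Nat.mul_le_mul_right _ h4

/-- sets containing `y` with at least `a` elements in `Q` -/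
lemma card_big_trace (n k a c : ℕ) (H : Finset (Finset ℕ)) (Q : Finset ℕ) (y : ℕ)
    (hH : H ⊆ Finset.powersetCard k (Finset.Icc 1 n)) (hQ : Q ⊆ Finset.Icc 1 n) (hy : y ∈ Q)
    (ha : 2 ≤ a) (hn : c * k ≤ n) (hc : 1 ≤ c)
    (hHy : ∀ A ∈ H, y ∈ A ∧ a ≤ (A ∩ Q).card) :
    H.card * c ^ (a - 2) ≤ (Q.card - 1).choose (a - 1) * (n - 2).choose (k - 2) := by
  rcases H.eq_empty_or_nonempty with rfl | ⟨A0, hA0⟩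
  · simp
  have hak : a ≤ k := by
    have h1 := (hHy A0 hA0).2
    have h2 := Finset.card_le_card (Finset.inter_subset_left : A0 ∩ Q ⊆ A0)
    rw [(Finset.mem_powersetCard.1 (hH hA0)).2] at h2
    omega
  have hsub : H ⊆ (Finset.powersetCard (a - 1) (Q.erase y)).biUnion
      (fun R => H.filter fun A => insert y R ⊆ A) := by
    intro A hA
    obtain ⟨h1, h2⟩ := hHy A hA
    have h3 : a - 1 ≤ ((A ∩ Q).erase y).card := by
      rw [Finset.card_erase_of_mem (Finset.mem_inter.2 ⟨h1, hy⟩)]; omega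
    obtain ⟨R, hR1, hR2⟩ := Finset.exists_subset_card_eq h3
    rw [Finset.mem_biUnion]
    refine ⟨R, Finset.mem_powersetCard.2 ⟨?_, hR2⟩, Finset.mem_filter.2 ⟨hA, ?_⟩⟩
    · intro b hb
      have := hR1 hb
      simp only [Finset.mem_erase, Finset.mem_inter] at this ⊢
      tauto
    · apply Finset.insert_subset h1
      intro b hb
      have := hR1 hb
      simp only [Finset.mem_erase, Finset.mem_inter] at this
      tauto
  have h1 : H.card ≤ (Q.card - 1).choose (a - 1) * (n - a).choose (k - a) := by
    calc H.card ≤ _ := Finset.card_le_card hsub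
      _ ≤ (Finset.powersetCard (a - 1) (Q.erase y)).card * (n - a).choose (k - a) := by
        apply Finset.card_biUnion_le_card_mul
        intro R hR
        obtain ⟨hR1, hR2⟩ := Finset.mem_powersetCard.1 hR
        have hyR : y ∉ R := fun h => by simpa using hR1 h
        have hc : (insert y R).card = a := by
          rw [Finset.card_insert_of_notMem hyR]; omega
        rw [← hc]
        apply card_superset
        · exact (Finset.filter_subset _ _).trans hH
        · exact Finset.insert_subset (hQ hy) ((hR1.trans (Finset.erase_subset _ _)).trans hQ)
        · intro A hA; exact (Finset.mem_filter.1 hA).2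
      _ = _ := by rw [Finset.card_powersetCard, Finset.card_erase_of_mem hy]
  calc H.card * c ^ (a - 2) ≤ (Q.card - 1).choose (a - 1) * (n - a).choose (k - a) * c ^ (a - 2) :=
        Nat.mul_le_mul_right _ h1
    _ = (Q.card - 1).choose (a - 1) * ((n - a).choose (k - a) * c ^ (a - 2)) := by ring
    _ ≤ _ := Nat.mul_le_mul_left _ (choose_ratio n k a c ha hn hc hak)

lemma pow_bound (q : ℕ) (hq : 5 ≤ q) : 2 ^ q * 2 ^ q ≤ 4 * 32 ^ ((q - 1) / 2) := by
  have key : ∀ i, 2 ≤ i → 2 ^ (2 * i + 2) * 2 ^ (2 * i + 2) ≤ 4 * 32 ^ i := by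
    intro i hi
    induction i, hi using Nat.le_induction with
    | base => norm_num
    | succ i hi ih =>
      have e : 2 ^ (2 * (i + 1) + 2) * 2 ^ (2 * (i + 1) + 2) =
        16 * (2 ^ (2 * i + 2) * 2 ^ (2 * i + 2)) := by ring
      rw [e, pow_succ 32 i]
      omega
  rcases Nat.even_or_odd' q with ⟨i, rfl | rfl⟩
  · obtain ⟨j, rfl⟩ : ∃ j, i = j + 1 := ⟨i - 1, by omega⟩
    have := key j (by omega)
    have e : (2 * (j + 1) - 1) / 2 = j := by omega
    rw [e]; exact this
  · have := key i (by omega)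
    have e : (2 * i + 1 - 1) / 2 = i := by omega
    rw [e]
    refine le_trans ?_ this
    gcongr <;> omega

lemma sum_bound (e : ℕ → ℕ) (C : ℕ) (he : ∀ q, 5 ≤ q → e q * 2 ^ q ≤ 4 * C) (t : ℕ) :
    4 * ∑ q ∈ Finset.Ico 5 (5 + t), e q ≤ C := by
  have h : ∀ t, ((∑ q ∈ Finset.Ico 5 (5 + t), e q : ℕ) : ℚ) ≤ C / 4 * (1 - (1 / 2) ^ t) := by
    intro t
    induction t with
    | zero => simp
    | succ t ih =>
      rw [← add_assoc, Finset.sum_Ico_succ_top (by omega)]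
      push_cast at ih ⊢
      have h1 := he (5 + t) (by omega)
      have h2 : (e (5 + t) : ℚ) * 2 ^ (5 + t) ≤ 4 * C := by exact_mod_cast h1
      have h3 : (e (5 + t) : ℚ) ≤ C / 4 * ((1 / 2) ^ (t + 1)) := by
        have hp : (0 : ℚ) < 2 ^ (5 + t) := by positivity
        rw [← mul_le_mul_iff_left₀ hp]
        refine h2.trans (le_of_eq ?_)
        rw [one_div, inv_pow]
        field_simp
        ring
      have h4 : (1 / 2 : ℚ) ^ (t + 1) = (1 / 2) ^ t * (1 / 2) := pow_succ _ _
      rw [h4] at h3 ⊢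
      linarith
  have h1 := h t
  have h2 : (0 : ℚ) ≤ C / 4 * (1 / 2) ^ t := by positivity
  have h3 : (4 : ℚ) * ((∑ q ∈ Finset.Ico 5 (5 + t), e q : ℕ) : ℚ) ≤ C := by linarith
  exact_mod_cast h3

lemma fat_count (n k l : ℕ) (hl : 4 ≤ l) (hlk : l ≤ k) (hn : 2 * l ^ 2 * k < n)
    (X : Finset ℕ) (hX : X ⊆ Finset.Icc 1 n) (hXc : X.card = l + 1)
    (G : Finset (Finset ℕ)) (hG : G ⊆ Finset.powersetCard k (Finset.Icc 1 n))
    (y : ℕ) (hy : y ∈ X) (H : Finset (Finset ℕ)) (hHG : H ⊆ G)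
    (hH : ∀ A ∈ H, y ∈ A ∧ (3 ≤ (A ∩ X).card ∨ Fat n X A)) :
    2 * H.card < (n - 2).choose (k - 2) := by
  classical
  set C := (n - 2).choose (k - 2) with hC
  have hl2 : 16 ≤ l ^ 2 := by nlinarith
  have h32 : 32 * k ≤ n := by nlinarith
  have hkn : k ≤ n := by omega
  have hCpos : 0 < C := Nat.choose_pos (by omega)
  have hyP : ∀ m, y ∈ P n X m := fun m => by
    have : y ∈ P n X 0 := by rw [P_zero n X hX]; exact hy
    exact P_mono n X (Nat.zero_le m) this
  have hPV : ∀ m, P n X m ⊆ Finset.Icc 1 n := fun m => Finset.filter_subset _ _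
  let H0 := H.filter fun A => 3 ≤ (A ∩ X).card
  let E : ℕ → Finset (Finset ℕ) := fun q => H.filter fun A => ∃ m, (P n X m).card = q + 1 ∧
    q + 2 ≤ 2 * (A ∩ P n X m).card
  have hcov : H ⊆ H0 ∪ (Finset.Ico 5 (5 + n)).biUnion E := by
    intro A hA
    rw [Finset.mem_union]
    by_cases h3 : 3 ≤ (A ∩ X).card
    · left; exact Finset.mem_filter.2 ⟨hA, h3⟩
    · right
      rcases (hH A hA).2 with h | ⟨m, hm⟩
      · exact absurd h h3
      · have h4 : X ⊆ P n X m := by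
          have := P_mono n X (Nat.zero_le m)
          rwa [P_zero n X hX] at this
        have h5 : (P n X m).card ≠ l + 1 := by
          intro he
          have : X = P n X m := Finset.eq_of_subset_of_card_le h4 (by omega)
          rw [← this] at hm
          omega
        have h6 := Finset.card_le_card h4
        have h7 : (P n X m).card ≤ n := by simpa using Finset.card_le_card (hPV m)
        rw [Finset.mem_biUnion]
        refine ⟨(P n X m).card - 1, Finset.mem_Ico.2 ⟨by omega, by omega⟩,
          Finset.mem_filter.2 ⟨hA, m, by omega, by omega⟩⟩
  have hE : ∀ q, 5 ≤ q → (E q).card * 2 ^ q ≤ 4 * C := by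
    intro q hq
    rcases (E q).eq_empty_or_nonempty with he | ⟨A0, hA0⟩
    · simp [he]
    obtain ⟨-, m0, hm0, -⟩ := Finset.mem_filter.1 hA0
    have huni : ∀ m, (P n X m).card = q + 1 → P n X m = P n X m0 := by
      intro m hm
      rcases le_total m m0 with h | h
      · exact Finset.eq_of_subset_of_card_le (P_mono n X h) (by omega)
      · exact (Finset.eq_of_subset_of_card_le (P_mono n X h) (by omega)).symm
    have h1 := card_big_trace n k ((q + 3) / 2) 32 (E q) (P n X m0) y
      (((Finset.filter_subset _ _).trans hHG).trans hG) (hPV m0) (hyP m0) (by omega) h32 (by omega)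
      (by
        intro A hA
        obtain ⟨hA1, m, hm, hm2⟩ := Finset.mem_filter.1 hA
        rw [huni m hm] at hm2
        exact ⟨(hH A hA1).1, by omega⟩)
    rw [hm0] at h1
    have e1 : (q + 3) / 2 - 2 = (q - 1) / 2 := by omega
    rw [e1] at h1
    have h2 : (q + 1 - 1).choose ((q + 3) / 2 - 1) ≤ 2 ^ q := Nat.choose_le_two_pow _ _
    have h3 := pow_bound q hq
    have hp : 0 < 32 ^ ((q - 1) / 2) := by positivity
    apply Nat.le_of_mul_le_mul_right _ hp
    calc (E q).card * 2 ^ q * 32 ^ ((q - 1) / 2) = ((E q).card * 32 ^ ((q - 1) / 2)) * 2 ^ q := by ring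
      _ ≤ (2 ^ q * C) * 2 ^ q := Nat.mul_le_mul_right _ (h1.trans (Nat.mul_le_mul_right _ h2))
      _ = (2 ^ q * 2 ^ q) * C := by ring
      _ ≤ (4 * 32 ^ ((q - 1) / 2)) * C := Nat.mul_le_mul_right _ h3
      _ = _ := by ring
  have hsum := sum_bound (fun q => (E q).card) C hE n
  have h0 := card_big_trace n k 3 (2 * l ^ 2) H0 X y
      (((Finset.filter_subset _ _).trans hHG).trans hG) hX hy (by omega) hn.le (by omega)
      (by
        intro A hA
        obtain ⟨hA1, hm⟩ := Finset.mem_filter.1 hA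
        exact ⟨(hH A hA1).1, hm⟩)
  have h0' : 4 * H0.card < C := by
    have hch : (X.card - 1).choose (3 - 1) * 2 = l * (l - 1) := by
      rw [hXc]
      have := Nat.triangle_succ (l - 1)
      have e : l - 1 + 1 = l := by omega
      rw [Nat.add_sub_cancel, show 3 - 1 = 2 from rfl, Nat.choose_two_right]
      exact Nat.div_mul_cancel (Nat.even_mul_pred_self l).two_dvd
    have e : 3 - 2 = 1 := rfl
    rw [e, pow_one] at h0
    obtain ⟨t, rfl⟩ : ∃ t, l = t + 1 := ⟨l - 1, by omega⟩
    rw [Nat.add_sub_cancel] at hch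
    have h1 : H0.card * (2 * (t + 1) ^ 2) * 2 ≤ ((t + 1) * t) * C := by
      rw [← hch]; nlinarith
    have h2 : (4 * H0.card * (t + 1)) * (t + 1) ≤ (t * C) * (t + 1) := by nlinarith
    have h3 := Nat.le_of_mul_le_mul_right h2 (by omega)
    have h4 : 4 * H0.card * (t + 1) < C * (t + 1) := by nlinarith
    exact Nat.lt_of_mul_lt_mul_right h4
  have hfin : H.card ≤ H0.card + ∑ q ∈ Finset.Ico 5 (5 + n), (E q).card :=
    (Finset.card_le_card hcov).trans ((Finset.card_union_le _ _).trans
      (Nat.add_le_add_left Finset.card_biUnion_le _))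
  omega

lemma star (n k l : ℕ) (hl : 4 ≤ l) 
    (X : Finset ℕ) (hX : X ⊆ Finset.Icc 1 n) (hXc : X.card = l + 1)
    (G : Finset (Finset ℕ)) (hG : G ⊆ Finset.powersetCard k (Finset.Icc 1 n))
    (hI : Inter G) (hS : Shifted n X G)
    (hthin : ∀ y ∈ X, ∃ A ∈ G, y ∈ A ∧ ¬ Fat n X A ∧ (A ∩ X).card < 3) :
    ∃ x ∈ X, ∀ A ∈ G, ¬ Fat n X A → x ∈ A := by
  classical
  have hint := nonfat_inter n k X G hG hI hS
  by_cases h1 : ∃ A ∈ G, ¬ Fat n X A ∧ (A ∩ X).card ≤ 1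
  · obtain ⟨A, hA, fA, hA1⟩ := h1
    obtain ⟨x, hx, hxA, -⟩ := hint A A hA hA fA fA
    refine ⟨x, hx, fun B hB fB => ?_⟩
    obtain ⟨z, hz, hzA, hzB⟩ := hint A B hA hB fA fB
    have : x = z := Finset.card_le_one.1 hA1 x (by simp [hx, hxA]) z (by simp [hz, hzA])
    rwa [this]
  push Not at h1
  have hpair : ∀ y ∈ X, ∃ g ∈ X, g ≠ y ∧ ∃ A ∈ G, ¬ Fat n X A ∧ A ∩ X = {y, g} := by
    intro y hy
    obtain ⟨A, hA, hyA, fA, hc⟩ := hthin y hy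
    have h2 := h1 A hA fA
    have h3 : (A ∩ X).card = 2 := by omega
    obtain ⟨a, b, hab, he⟩ := Finset.card_eq_two.1 h3
    have hyin : y ∈ A ∩ X := Finset.mem_inter.2 ⟨hyA, hy⟩
    have haX : a ∈ X := (Finset.mem_inter.1 (by rw [he]; simp : a ∈ A ∩ X)).2
    have hbX : b ∈ X := (Finset.mem_inter.1 (by rw [he]; simp : b ∈ A ∩ X)).2
    rw [he] at hyin
    simp only [Finset.mem_insert, Finset.mem_singleton] at hyin
    rcases hyin with rfl | rfl
    · exact ⟨b, hbX, hab.symm, A, hA, fA, he⟩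
    · exact ⟨a, haX, hab, A, hA, fA, by rw [he, Finset.pair_comm]⟩
  -- the key facts on pairs
  let Pr : ℕ → ℕ → Prop := fun y g => ∃ A ∈ G, ¬ Fat n X A ∧ A ∩ X = {y, g}
  have hPr : ∀ y g B, Pr y g → B ∈ G → ¬ Fat n X B → y ∈ B ∨ g ∈ B := by
    rintro y g B ⟨A, hA, fA, he⟩ hB fB
    obtain ⟨z, hz, hzA, hzB⟩ := hint A B hA hB fA fB
    have : z ∈ A ∩ X := Finset.mem_inter.2 ⟨hzA, hz⟩
    rw [he] at this
    simp only [Finset.mem_insert, Finset.mem_singleton] at this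
    rcases this with rfl | rfl
    · exact Or.inl hzB
    · exact Or.inr hzB
  have hPP : ∀ y g y' g', y ∈ X → g ∈ X → Pr y g → Pr y' g' → y = y' ∨ y = g' ∨ g = y' ∨ g = g' := by
    rintro y g y' g' hy hg h ⟨A, hA, fA, he⟩
    rcases hPr y g A h hA fA with h2 | h2
    · have : y ∈ A ∩ X := Finset.mem_inter.2 ⟨h2, hy⟩
      rw [he] at this
      simp only [Finset.mem_insert, Finset.mem_singleton] at this
      tauto
    · have : g ∈ A ∩ X := Finset.mem_inter.2 ⟨h2, hg⟩
      rw [he] at this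
      simp only [Finset.mem_insert, Finset.mem_singleton] at this
      tauto
  -- from a centre, conclude
  have hcentre : ∀ a b, a ∈ X → b ∈ X → Pr a b → (∀ y ∈ X, y ≠ a → y ≠ b → Pr y a) →
      ∃ x ∈ X, ∀ A ∈ G, ¬ Fat n X A → x ∈ A := by
    intro a b ha hb hab hall
    refine ⟨a, ha, fun A hA fA => ?_⟩
    by_contra haA
    apply fA
    refine ⟨0, ?_⟩
    rw [P_zero n X hX]
    have hsub : X.erase a ⊆ A ∩ X := by
      intro y hy
      obtain ⟨hya, hyX⟩ := Finset.mem_erase.1 hy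
      refine Finset.mem_inter.2 ⟨?_, hyX⟩
      by_cases hyb : y = b
      · subst hyb
        exact (hPr a y A hab hA fA).resolve_left haA
      · exact (hPr y a A (hall y hyX hya hyb) hA fA).resolve_right haA
    have := Finset.card_le_card hsub
    rw [Finset.card_erase_of_mem ha] at this
    omega
  have hsymm : ∀ a b, Pr a b → Pr b a := by
    rintro a b ⟨A, hA, fA, he⟩
    exact ⟨A, hA, fA, by rw [he, Finset.pair_comm]⟩
  obtain ⟨a, ha⟩ : X.Nonempty := Finset.card_pos.1 (by omega)
  obtain ⟨b, hb, hba, hab⟩ := hpair a ha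
  change Pr a b at hab
  have hex : ∃ y1 ∈ X, y1 ≠ a ∧ y1 ≠ b := by
    have : 0 < ((X.erase a).erase b).card := by
      rw [Finset.card_erase_of_mem (Finset.mem_erase.2 ⟨hba, hb⟩), Finset.card_erase_of_mem ha]
      omega
    obtain ⟨y, hy⟩ := Finset.card_pos.1 this
    simp only [Finset.mem_erase] at hy
    exact ⟨y, hy.2.2, hy.2.1, hy.1⟩
  have hg : ∀ y ∈ X, y ≠ a → y ≠ b → Pr y a ∨ Pr y b := by
    intro y hy hya hyb
    obtain ⟨g, hgX, hgy, hp⟩ := hpair y hy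
    change Pr y g at hp
    rcases hPP y g a b hy hgX hp hab with h | h | h | h
    · exact absurd h hya
    · exact absurd h hyb
    · subst h; exact Or.inl hp
    · subst h; exact Or.inr hp
  obtain ⟨y1, hy1, hy1a, hy1b⟩ := hex
  have hsep : ∀ y ∈ X, ∀ y' ∈ X, y ≠ a → y ≠ b → y' ≠ a → y' ≠ b → y ≠ y' → Pr y a → Pr y' b → False := by
    intro y hy y' hy' h1 h2 h3 h4 h5 p1 p2
    rcases hPP y a y' b hy ha p1 p2 with h | h | h | h
    · exact h5 h
    · exact h2 h
    · exact h3 h.symm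
    · exact hba h.symm
  have hex2 : ∀ y ∈ X, ∃ y' ∈ X, y' ≠ a ∧ y' ≠ b ∧ y' ≠ y := by
    intro y hy
    have : 0 < (X \ {a, b, y}).card := by
      have h1 := Finset.le_card_sdiff {a, b, y} X
      have h2 : ({a, b, y} : Finset ℕ).card ≤ 3 := Finset.card_le_three
      omega
    obtain ⟨y', hy'⟩ := Finset.card_pos.1 this
    simp only [Finset.mem_sdiff, Finset.mem_insert, Finset.mem_singleton, not_or] at hy'
    exact ⟨y', hy'.1, hy'.2.1, hy'.2.2.1, hy'.2.2.2⟩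
  by_cases hA : ∀ y ∈ X, y ≠ a → y ≠ b → Pr y a
  · exact hcentre a b ha hb hab hA
  · by_cases hB : ∀ y ∈ X, y ≠ b → y ≠ a → Pr y b
    · exact hcentre b a hb ha (hsymm _ _ hab) hB
    · exfalso
      push Not at hA hB
      obtain ⟨y, hy, hya, hyb, hyn⟩ := hA
      obtain ⟨z, hz, hzb, hza, hzn⟩ := hB
      have p1 := (hg y hy hya hyb).resolve_left hyn
      have p2 := (hg z hz hza hzb).resolve_right hzn
      by_cases hyz : z = y
      · subst hyz; exact hyn p2
      · exact hsep z hz y hy hza hzb hya hyb hyz p2 p1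

open scoped FinsetFamily in
lemma kk_fin (N a b s : ℕ) (B D : Finset (Finset (Fin N)))
    (hB : ∀ A ∈ B, A.card = b) (hD : ∀ A ∈ D, A.card = a)
    (hcr : ∀ A ∈ B, ∀ A' ∈ D, (A ∩ A').Nonempty) (hab : a + b ≤ N) (hs : s ≤ b)
    (hc : (N - s).choose (b - s) ≤ B.card) :
    D.card + (N - s).choose a ≤ N.choose a := by
  classical
  have h1 : ((Bᶜˢ : Finset (Finset (Fin N))) : Set (Finset (Fin N))).Sized (N - b) := by
    have : (B : Set (Finset (Fin N))).Sized b := fun A hA => hB A hA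
    simpa using this.compls
  have h2 : (N - s).choose (N - b) ≤ (Bᶜˢ).card := by
    rw [Finset.card_compls]
    have : (N - s).choose (N - b) = (N - s).choose (b - s) := by
      rw [← Nat.choose_symm (by omega : b - s ≤ N - s)]
      congr 1; omega
    omega
  have kk := Finset.kruskal_katona_lovasz_form (i := N - b - a) (by omega) (by omega : N - b ≤ N - s)
    (Nat.sub_le _ _) h1 h2
  have e : N - b - (N - b - a) = a := by omega
  rw [e] at kk
  have hdis : Disjoint D (∂^[N - b - a] Bᶜˢ) := by
    rw [Finset.disjoint_left]
    intro A hA hA'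
    rw [Finset.mem_shadow_iterate_iff_exists_sdiff] at hA'
    obtain ⟨S, hS, hAS, -⟩ := hA'
    rw [Finset.mem_compls] at hS
    obtain ⟨z, hz⟩ := hcr _ hS A hA
    simp only [Finset.mem_inter, Finset.mem_compl] at hz
    exact hz.1 (hAS hz.2)
  have hsz : ((D ∪ ∂^[N - b - a] Bᶜˢ : Finset _) : Set (Finset (Fin N))).Sized a := by
    intro A hA
    rcases Finset.mem_union.1 hA with h | h
    · exact hD A h
    · have := h1.shadow_iterate (k := N - b - a) h
      omega
  have h3 := hsz.card_le
  rw [Finset.card_union_of_disjoint hdis, Fintype.card_fin] at h3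
  omega

lemma kk_nat (S : Finset ℕ) (N a b s : ℕ) (hSN : S.card = N) (B D : Finset (Finset ℕ))
    (hB : B ⊆ Finset.powersetCard b S) (hD : D ⊆ Finset.powersetCard a S)
    (hcr : ∀ A ∈ B, ∀ A' ∈ D, (A ∩ A').Nonempty) (hab : a + b ≤ N) (hs : s ≤ b)
    (hc : (N - s).choose (b - s) ≤ B.card) :
    D.card + (N - s).choose a ≤ N.choose a := by
  classical
  let o : Fin N ↪o ℕ := S.orderEmbOfFin hSN
  have hr : ∀ x ∈ S, ∃ i, o i = x := by
    intro x hx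
    have := S.range_orderEmbOfFin hSN
    have hx' : x ∈ Set.range o := by rw [this]; exact hx
    exact hx'
  let f : Finset ℕ → Finset (Fin N) := fun A => Finset.univ.filter fun i => o i ∈ A
  have hf : ∀ A, A ⊆ S → (f A).map o.toEmbedding = A := by
    intro A hA
    ext x
    simp only [f, Finset.mem_map, Finset.mem_filter, Finset.mem_univ, true_and]
    constructor
    · rintro ⟨i, h1, rfl⟩; exact h1
    · intro hx
      obtain ⟨i, rfl⟩ := hr x (hA hx)
      exact ⟨i, hx, rfl⟩
  have hcard : ∀ A, A ⊆ S → (f A).card = A.card := by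
    intro A hA
    rw [← Finset.card_map o.toEmbedding, hf A hA]
  have hinj : ∀ (H : Finset (Finset ℕ)) (c : ℕ), H ⊆ Finset.powersetCard c S → (H.image f).card = H.card := by
    intro H c hH
    apply Finset.card_image_of_injOn
    intro A hA A' hA' h
    have h1 := hf A (Finset.mem_powersetCard.1 (hH hA)).1
    have h2 := hf A' (Finset.mem_powersetCard.1 (hH hA')).1
    rw [← h1, h, h2]
  rw [← hinj D a hD]
  refine kk_fin N a b s (B.image f) (D.image f) ?_ ?_ ?_ hab hs ?_
  · intro A hA
    obtain ⟨A', hA', rfl⟩ := Finset.mem_image.1 hA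
    have := Finset.mem_powersetCard.1 (hB hA')
    rw [hcard _ this.1, this.2]
  · intro A hA
    obtain ⟨A', hA', rfl⟩ := Finset.mem_image.1 hA
    have := Finset.mem_powersetCard.1 (hD hA')
    rw [hcard _ this.1, this.2]
  · intro A hA A' hA'
    obtain ⟨A1, hA1, rfl⟩ := Finset.mem_image.1 hA
    obtain ⟨A2, hA2, rfl⟩ := Finset.mem_image.1 hA'
    obtain ⟨z, hz⟩ := hcr A1 hA1 A2 hA2
    obtain ⟨z1, z2⟩ := Finset.mem_inter.1 hz
    obtain ⟨i, rfl⟩ := hr z ((Finset.mem_powersetCard.1 (hB hA1)).1 z1)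
    exact ⟨i, by simp [f, z1, z2]⟩
  · rw [hinj B b hB]; exact hc

lemma choose_mono_half (M r t : ℕ) (hrt : r ≤ t) (ht : 2 * t ≤ M) : M.choose r ≤ M.choose t := by
  induction t, hrt using Nat.le_induction with
  | base => exact le_rfl
  | succ t h ih =>
    exact (ih (by omega)).trans (Nat.choose_le_succ_of_lt_half_left (by omega))

lemma arith1 (n k : ℕ) (hk : 4 ≤ k) (hn : 32 * k ≤ n) :
    (n - 2).choose (k - 2) ≤ 2 * (n - 5).choose (k - 2) := by
  have h := choose_ratio n k 3 32 (by omega) hn (by omega) (by omega)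
  obtain ⟨k', rfl⟩ : ∃ k', k = k' + 3 := ⟨k - 3, by omega⟩
  obtain ⟨n', rfl⟩ : ∃ n', n = n' + 5 := ⟨n - 5, by omega⟩
  have e1 : n' + 5 - 2 = n' + 2 + 1 := by omega
  have e2 : k' + 3 - 2 = k' + 1 := by omega
  have e3 : n' + 5 - 5 = n' := by omega
  have e4 : n' + 5 - 3 = n' + 2 := by omega
  have e5 : k' + 3 - 3 = k' := by omega
  rw [e1, e2, e4, e5] at h
  rw [e1, e2, e3]
  have h1 := Nat.choose_succ_succ' (n' + 2) k'
  have h2 : (n' + 2).choose (k' + 1) = (n' + 1).choose k' + (n' + 1).choose (k' + 1) :=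
    Nat.choose_succ_succ' (n' + 1) k'
  have h3 := Nat.choose_succ_succ' n' k'
  have h4 : (n' + 1).choose k' ≤ (n' + 2).choose k' := Nat.choose_le_choose _ (by omega)
  have h5 : n'.choose k' ≤ (n' + 2).choose k' := Nat.choose_le_choose _ (by omega)
  rw [show 3 - 2 = 1 from rfl, pow_one] at h
  omega

lemma arith2 (n k l s : ℕ) (hl : 4 ≤ l) (hlk : l ≤ k) (hn : 2 * l ^ 2 * k < n)
    (hs : 3 ≤ s) (hsk : s ≤ k - 1) :
    (l - 1) * (n - 3 - s + 1).choose (k - s) ≤ (n - 3 - s).choose (k - 2) := by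
  obtain ⟨t, rfl⟩ : ∃ t, l = t + 1 := ⟨l - 1, by omega⟩
  have hbig : 2 * t * k + 2 * k + 20 ≤ n := by nlinarith [mul_le_mul hl hlk (by omega) (by omega)]
  obtain ⟨M, hM⟩ : ∃ M, n - 3 - s = M := ⟨_, rfl⟩
  obtain ⟨k', rfl⟩ : ∃ k', k = k' + 3 := ⟨k - 3, by omega⟩
  obtain ⟨r, hr⟩ : ∃ r, k' + 3 - s = r + 1 := ⟨k' + 3 - s - 1, by omega⟩
  have hMk : 2 * t * (k' + 3) + (k' + 3) + 10 ≤ M := by omega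
  have e2 : k' + 3 - 2 = k' + 1 := by omega
  rw [hM, hr, e2, Nat.add_sub_cancel, Nat.choose_succ_succ']
  have hM2 : 2 * k' ≤ M := by nlinarith
  have h1 := choose_mono_half M r k' (by omega) hM2
  have h2 := choose_mono_half M (r + 1) k' (by omega) hM2
  have h3 := Nat.choose_succ_right_eq M k'
  have h4 : 2 * t * (k' + 1) ≤ M - k' := by
    have : 2 * t * (k' + 1) ≤ 2 * t * (k' + 3) := Nat.mul_le_mul_left _ (by omega)
    omega
  have h5 : 2 * t * M.choose k' ≤ M.choose (k' + 1) := by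
    have : (2 * t * M.choose k') * (k' + 1) ≤ M.choose (k' + 1) * (k' + 1) := by
      rw [h3]
      calc _ = M.choose k' * (2 * t * (k' + 1)) := by ring
        _ ≤ _ := Nat.mul_le_mul_left _ h4
    exact Nat.le_of_mul_le_mul_right this (by omega)
  calc t * (M.choose r + M.choose (r + 1)) ≤ t * (M.choose k' + M.choose k') :=
        Nat.mul_le_mul_left _ (by omega)
    _ = 2 * t * M.choose k' := by ring
    _ ≤ _ := h5

/-- Kruskal-Katona consequence -/
lemma kk_use (n k l : ℕ) (hl : 4 ≤ l) (hlk : l ≤ k) (hn : 2 * l ^ 2 * k < n)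
    (G : Finset (Finset ℕ)) (hG : G ⊆ Finset.powersetCard k (Finset.Icc 1 n)) (hI : Inter G)
    (x y z : ℕ) (hx : x ∈ Finset.Icc 1 n) (hy : y ∈ Finset.Icc 1 n) (hz : z ∈ Finset.Icc 1 n)
    (hxy : x ≠ y) (hxz : x ≠ z) (hyz : y ≠ z)
    (hne : (G.filter fun A => y ∈ A ∧ x ∉ A ∧ z ∉ A).Nonempty)
    (hbig : (n - 2).choose (k - 2) < 2 * (G.filter fun A => x ∈ A ∧ z ∈ A).card) :
    (G.filter fun A => x ∈ A ∧ z ∈ A).card +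
      (l - 1) * (G.filter fun A => y ∈ A ∧ x ∉ A ∧ z ∉ A).card ≤ (n - 2).choose (k - 2) := by
  classical
  set B0 := G.filter fun A => y ∈ A ∧ x ∉ A ∧ z ∉ A with hB0
  have hl2 : 16 ≤ l ^ 2 := by nlinarith
  have h32 : 32 * k ≤ n := by nlinarith
  have hsub3 : ({x, y, z} : Finset ℕ) ⊆ Finset.Icc 1 n := by
    intro a ha
    simp only [Finset.mem_insert, Finset.mem_singleton] at ha
    rcases ha with rfl | rfl | rfl <;> assumption
  have hc3 : ({x, y, z} : Finset ℕ).card = 3 := by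
    rw [Finset.card_eq_three]; exact ⟨x, y, z, hxy, hxz, hyz, rfl⟩
  set S := Finset.Icc 1 n \ {x, y, z} with hSdef
  have hS : S.card = n - 3 := by
    rw [hSdef, Finset.card_sdiff_of_subset hsub3, hc3]; simp
  set D0 := G.filter fun A => x ∈ A ∧ z ∈ A ∧ y ∉ A with hD0
  set K0 := G.filter fun A => x ∈ A ∧ z ∈ A ∧ y ∈ A with hK0
  have hsplit : (G.filter fun A => x ∈ A ∧ z ∈ A).card ≤ K0.card + D0.card := by
    refine (Finset.card_le_card ?_).trans (Finset.card_union_le _ _)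
    intro A hA
    simp only [hK0, hD0, Finset.mem_union, Finset.mem_filter] at hA ⊢
    tauto
  have hK0c : K0.card ≤ (n - 3).choose (k - 3) := by
    rw [← hc3]
    apply card_superset n k
    · exact (Finset.filter_subset _ _).trans hG
    · exact hsub3
    · intro A hA
      have := (Finset.mem_filter.1 hA).2
      intro a ha
      simp only [Finset.mem_insert, Finset.mem_singleton] at ha
      rcases ha with rfl | rfl | rfl <;> tauto
  -- reduced families
  have hBi : (B0.image fun A => A.erase y).card = B0.card := by
    apply Finset.card_image_of_injOn
    intro A hA A' hA' h
    have h1 := (Finset.mem_filter.1 hA).2.1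
    have h2 := (Finset.mem_filter.1 hA').2.1
    simp only at h
    rw [← Finset.insert_erase h1, h, Finset.insert_erase h2]
  have hDi : (D0.image fun A => (A.erase x).erase z).card = D0.card := by
    apply Finset.card_image_of_injOn
    intro A hA A' hA' h
    obtain ⟨-, h1, h2, -⟩ := Finset.mem_filter.1 hA
    obtain ⟨-, h3, h4, -⟩ := Finset.mem_filter.1 hA'
    simp only at h
    rw [← Finset.insert_erase h1, ← Finset.insert_erase (Finset.mem_erase.2 ⟨hxz.symm, h2⟩), h,
      Finset.insert_erase (Finset.mem_erase.2 ⟨hxz.symm, h4⟩), Finset.insert_erase h3]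
  have hBsub : (B0.image fun A => A.erase y) ⊆ Finset.powersetCard (k - 1) S := by
    intro A' hA'
    obtain ⟨A, hA, rfl⟩ := Finset.mem_image.1 hA'
    obtain ⟨hAG, h1, h2, h3⟩ := Finset.mem_filter.1 hA
    obtain ⟨h4, h5⟩ := Finset.mem_powersetCard.1 (hG hAG)
    refine Finset.mem_powersetCard.2 ⟨?_, by rw [Finset.card_erase_of_mem h1, h5]⟩
    intro a ha
    obtain ⟨ha1, ha2⟩ := Finset.mem_erase.1 ha
    refine Finset.mem_sdiff.2 ⟨h4 ha2, ?_⟩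
    simp only [Finset.mem_insert, Finset.mem_singleton, not_or]
    exact ⟨fun e => h2 (e ▸ ha2), ha1, fun e => h3 (e ▸ ha2)⟩
  have hDsub : (D0.image fun A => (A.erase x).erase z) ⊆ Finset.powersetCard (k - 2) S := by
    intro A' hA'
    obtain ⟨A, hA, rfl⟩ := Finset.mem_image.1 hA'
    obtain ⟨hAG, h1, h2, h3⟩ := Finset.mem_filter.1 hA
    obtain ⟨h4, h5⟩ := Finset.mem_powersetCard.1 (hG hAG)
    refine Finset.mem_powersetCard.2 ⟨?_, by
      rw [Finset.card_erase_of_mem (Finset.mem_erase.2 ⟨hxz.symm, h2⟩),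
        Finset.card_erase_of_mem h1, h5]; omega⟩
    intro a ha
    obtain ⟨ha1, ha2⟩ := Finset.mem_erase.1 ha
    obtain ⟨ha3, ha4⟩ := Finset.mem_erase.1 ha2
    refine Finset.mem_sdiff.2 ⟨h4 ha4, ?_⟩
    simp only [Finset.mem_insert, Finset.mem_singleton, not_or]
    exact ⟨ha3, fun e => h3 (e ▸ ha4), ha1⟩
  have hcr : ∀ A ∈ (B0.image fun A => A.erase y), ∀ A' ∈ (D0.image fun A => (A.erase x).erase z),
      (A ∩ A').Nonempty := by
    intro A1 hA1 A2 hA2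
    obtain ⟨A, hA, rfl⟩ := Finset.mem_image.1 hA1
    obtain ⟨A', hA', rfl⟩ := Finset.mem_image.1 hA2
    obtain ⟨hAG, h1, h2, h3⟩ := Finset.mem_filter.1 hA
    obtain ⟨hAG', h4, h5, h6⟩ := Finset.mem_filter.1 hA'
    obtain ⟨a, ha⟩ := hI A hAG A' hAG'
    obtain ⟨ha1, ha2⟩ := Finset.mem_inter.1 ha
    refine ⟨a, ?_⟩
    simp only [Finset.mem_inter, Finset.mem_erase]
    exact ⟨⟨fun e => h6 (e ▸ ha2), ha1⟩, fun e => h3 (e ▸ ha1), fun e => h2 (e ▸ ha1), ha2⟩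
  have hkk : ∀ s, s ≤ k - 1 → (n - 3 - s).choose (k - 1 - s) ≤ B0.card →
      (G.filter fun A => x ∈ A ∧ z ∈ A).card + (n - 3 - s).choose (k - 2) ≤ (n - 2).choose (k - 2) := by
    intro s hs hc
    have h1 := kk_nat S (n - 3) (k - 2) (k - 1) s hS _ _ hBsub hDsub hcr (by omega) hs
      (by rw [hBi]; exact hc)
    rw [hDi] at h1
    have h2 : (n - 2).choose (k - 2) = (n - 3).choose (k - 3) + (n - 3).choose (k - 2) := by
      have := Nat.choose_succ_succ' (n - 3) (k - 3)
      have e1 : n - 3 + 1 = n - 2 := by omega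
      have e2 : k - 3 + 1 = k - 2 := by omega
      rwa [e1, e2] at this
    omega
  have hB1 : 1 ≤ B0.card := Finset.card_pos.2 hne
  have hexs : ∃ s, (n - 3 - s).choose (k - 1 - s) ≤ B0.card := ⟨k - 1, by simpa using hB1⟩
  classical
  have hsp := Nat.find_spec hexs
  have hmin : ∀ s' < Nat.find hexs, ¬ (n - 3 - s').choose (k - 1 - s') ≤ B0.card :=
    fun s' h => Nat.find_min hexs h
  have hle : Nat.find hexs ≤ k - 1 := Nat.find_min' hexs (by simpa using hB1)
  generalize Nat.find hexs = s at hsp hmin hle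
  have hk := hkk s hle hsp
  have hs3 : 3 ≤ s := by
    by_contra hcon
    have h1 : (n - 5).choose (k - 2) ≤ (n - 3 - s).choose (k - 2) :=
      Nat.choose_le_choose _ (by omega)
    have := arith1 n k (by omega) h32
    omega
  have h2 := hmin (s - 1) (by omega)
  have e1 : n - 3 - (s - 1) = n - 3 - s + 1 := by omega
  have e2 : k - 1 - (s - 1) = k - s := by omega
  rw [e1, e2] at h2
  have h3 := arith2 n k l s hl hlk hn hs3 hle
  have h4 : (l - 1) * B0.card ≤ (l - 1) * (n - 3 - s + 1).choose (k - s) :=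
    Nat.mul_le_mul_left _ (by omega)
  omega

lemma main_shifted (n k l : ℕ) (hl : 4 ≤ l) (hlk : l ≤ k) (hn : 2 * l ^ 2 * k < n)
    (X : Finset ℕ) (hX : X ⊆ Finset.Icc 1 n) (hXc : X.card = l + 1)
    (G : Finset (Finset ℕ)) (hG : G ⊆ Finset.powersetCard k (Finset.Icc 1 n))
    (hI : Inter G) (hS : Shifted n X G)
    (hdeg : ∀ x ∈ X, (n - 2).choose (k - 2) + (n - l - 1).choose (k - l) < degree G x) : False := by
  classical
  set C := (n - 2).choose (k - 2) with hC
  have hthin : ∀ y ∈ X, ∃ A ∈ G, y ∈ A ∧ ¬ Fat n X A ∧ (A ∩ X).card < 3 := by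
    intro y hy
    by_contra hcon
    push Not at hcon
    have h1 := fat_count n k l hl hlk hn X hX hXc G hG y hy (G.filter fun A => y ∈ A)
      (Finset.filter_subset _ _) (by
        intro A hA
        obtain ⟨hA1, hA2⟩ := Finset.mem_filter.1 hA
        refine ⟨hA2, ?_⟩
        by_cases hf : Fat n X A
        · exact Or.inr hf
        · exact Or.inl (hcon A hA1 hA2 hf))
    have h2 := hdeg y hy
    unfold degree at h2
    omega
  obtain ⟨x, hx, hstar⟩ := star n k l hl X hX hXc G hG hI hS hthin
  let b : ℕ → Finset (Finset ℕ) := fun y =>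
    G.filter fun A => y ∈ A ∧ x ∉ A ∧ ¬ X.erase x ⊆ A
  let d : ℕ → Finset (Finset ℕ) := fun y => G.filter fun A => x ∈ A ∧ y ∈ A
  have hdc : ∀ y ∈ X, y ≠ x → C < 2 * (d y).card := by
    intro y hy hyx
    have h1 := fat_count n k l hl hlk hn X hX hXc G hG y hy (G.filter fun A => y ∈ A ∧ x ∉ A)
      (Finset.filter_subset _ _) (by
        intro A hA
        obtain ⟨hA1, hA2, hA3⟩ := Finset.mem_filter.1 hA
        refine ⟨hA2, Or.inr ?_⟩
        by_contra hf
        exact hA3 (hstar A hA1 hf))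
    have h2 := hdeg y hy
    have h3 : degree G y ≤ (d y).card + (G.filter fun A => y ∈ A ∧ x ∉ A).card := by
      unfold degree
      refine (Finset.card_le_card ?_).trans (Finset.card_union_le _ _)
      intro A hA
      simp only [d, Finset.mem_union, Finset.mem_filter] at hA ⊢
      tauto
    omega
  have hbc : ∀ y ∈ X, y ≠ x → C < (d y).card + (b y).card := by
    intro y hy hyx
    have h2 := hdeg y hy
    have h3 : degree G y ≤ (d y).card + ((b y).card + (G.filter fun A => X.erase x ⊆ A ∧ x ∉ A).card) := by
      unfold degree
      have : (G.filter fun A => y ∈ A) ⊆ d y ∪ (b y ∪ (G.filter fun A => X.erase x ⊆ A ∧ x ∉ A)) := by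
        intro A hA
        simp only [d, b, Finset.mem_union, Finset.mem_filter] at hA ⊢
        tauto
      exact (Finset.card_le_card this).trans ((Finset.card_union_le _ _).trans
        (Nat.add_le_add_left (Finset.card_union_le _ _) _))
    have h4 : (G.filter fun A => X.erase x ⊆ A ∧ x ∉ A).card ≤ (n - l - 1).choose (k - l) := by
      have hXV : X.erase x ⊆ Finset.Icc 1 n := (Finset.erase_subset _ _).trans hX
      have e : (n - l - 1).choose (k - l) =
          (Finset.powersetCard (k - l) (Finset.Icc 1 n \ X)).card := by
        rw [Finset.card_powersetCard, Finset.card_sdiff_of_subset hX, hXc]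
        simp [Nat.sub_sub]
      rw [e]
      apply Finset.card_le_card_of_injOn (fun A => A \ X.erase x)
      · intro A hA
        obtain ⟨hA1, hA2, hA3⟩ := Finset.mem_filter.1 hA
        obtain ⟨h5, h6⟩ := Finset.mem_powersetCard.1 (hG hA1)
        rw [Finset.mem_coe]
        refine Finset.mem_powersetCard.2 ⟨?_, ?_⟩
        · intro a ha
          obtain ⟨ha1, ha2⟩ := Finset.mem_sdiff.1 ha
          refine Finset.mem_sdiff.2 ⟨h5 ha1, fun haX => ha2 (Finset.mem_erase.2 ⟨?_, haX⟩)⟩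
          rintro rfl
          exact hA3 ha1
        · rw [Finset.card_sdiff_of_subset hA2, Finset.card_erase_of_mem hx]
          omega
      · intro A hA A' hA' h
        simp only at h
        rw [← Finset.sdiff_union_of_subset (Finset.mem_filter.1 hA).2.1, h,
          Finset.sdiff_union_of_subset (Finset.mem_filter.1 hA').2.1]
    omega
  have hXe : (X.erase x).Nonempty := Finset.card_pos.1 (by
    rw [Finset.card_erase_of_mem hx]; omega)
  obtain ⟨y, hy, hymax⟩ := Finset.exists_max_image (X.erase x) (fun y => (b y).card) hXe
  obtain ⟨hyx, hyX⟩ := Finset.mem_erase.1 hy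
  let B : ℕ → Finset (Finset ℕ) := fun z => G.filter fun A => y ∈ A ∧ x ∉ A ∧ z ∉ A
  have hXe2c : ((X.erase x).erase y).card = l - 1 := by
    rw [Finset.card_erase_of_mem hy, Finset.card_erase_of_mem hx]; omega
  have hXe2 : ((X.erase x).erase y).Nonempty := Finset.card_pos.1 (by omega)
  obtain ⟨z, hz, hzmax⟩ := Finset.exists_max_image ((X.erase x).erase y) (fun z => (B z).card) hXe2
  obtain ⟨hzy, hz2⟩ := Finset.mem_erase.1 hz
  obtain ⟨hzx, hzX⟩ := Finset.mem_erase.1 hz2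
  have hby : (b y).card ≤ (l - 1) * (B z).card := by
    rw [← hXe2c]
    refine le_trans (Finset.card_le_card ?_)
      (Finset.card_biUnion_le_card_mul ((X.erase x).erase y) B _ hzmax)
    intro A hA
    obtain ⟨hA1, hA2, hA3, hA4⟩ := Finset.mem_filter.1 hA
    obtain ⟨w, hw, hwA⟩ := Finset.not_subset.1 hA4
    refine Finset.mem_biUnion.2 ⟨w, Finset.mem_erase.2 ⟨?_, hw⟩, Finset.mem_filter.2 ⟨hA1, hA2, hA3, hwA⟩⟩
    rintro rfl
    exact hwA hA2
  have hdyC : (d y).card ≤ C := by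
    have hc2 : ({x, y} : Finset ℕ).card = 2 := Finset.card_pair (Ne.symm hyx)
    rw [hC, ← hc2]
    apply card_superset n k
    · exact (Finset.filter_subset _ _).trans hG
    · intro a ha
      simp only [Finset.mem_insert, Finset.mem_singleton] at ha
      rcases ha with rfl | rfl
      · exact hX hx
      · exact hX hyX
    · intro A hA
      have := (Finset.mem_filter.1 hA).2
      intro a ha
      simp only [Finset.mem_insert, Finset.mem_singleton] at ha
      rcases ha with rfl | rfl <;> tauto
  have h1 := hbc y hyX hyx
  have hBne : (B z).Nonempty := by
    rw [← Finset.card_pos]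
    rcases Nat.eq_zero_or_pos (B z).card with h | h
    · rw [h] at hby; omega
    · exact h
  have h2 := kk_use n k l hl hlk hn G hG hI x y z (hX hx) (hX hyX) (hX hzX)
    (Ne.symm hyx) (Ne.symm hzx) (Ne.symm hzy) hBne (hdc z hzX hzx)
  have h3 := hbc z hzX hzx
  have h4 := hymax z hz2
  change (d z).card + (l - 1) * (B z).card ≤ C at h2
  omega

lemma extract (n i T : ℕ) (F : Finset (Finset ℕ)) (h : T < nthDegree n F (i + 1)) :
    ∃ X ⊆ Finset.Icc 1 n, X.card = i + 1 ∧ ∀ x ∈ X, T < degree F x := by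
  classical
  unfold nthDegree at h
  set L := ((Finset.Icc 1 n).val.map (degree F)).sort (· ≥ ·) with hL
  rw [Nat.add_sub_cancel] at h
  have hi : i < L.length := by
    by_contra hc
    rw [List.getD_eq_default _ _ (by omega)] at h
    omega
  rw [List.getD_eq_getElem _ _ hi] at h
  have hsorted : L.Pairwise (· ≥ ·) := Multiset.pairwise_sort _ _
  have hall : ∀ a ∈ L.take (i + 1), T < a := by
    intro a ha
    obtain ⟨j, hj, rfl⟩ := List.mem_iff_getElem.1 ha
    rw [List.getElem_take]
    have hj' : j < i + 1 := by
      rw [List.length_take] at hj; omega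
    rcases Nat.lt_or_ge j i with hji | hji
    · have := List.pairwise_iff_getElem.1 hsorted j i (by omega) hi hji
      omega
    · have : j = i := by omega
      subst this; exact h
  have hcount : i + 1 ≤ (L.filter (fun a => T < a)).length := by
    have h1 : ((L.take (i + 1)).filter (fun a => T < a)) = L.take (i + 1) := by
      rw [List.filter_eq_self]
      intro a ha
      simpa using hall a ha
    have h2 : ((L.take (i + 1)).filter (fun a => T < a)).Sublist (L.filter (fun a => T < a)) :=
      (List.take_sublist _ _).filter _
    have h3 := h2.length_le
    rw [h1, List.length_take] at h3
    omega
  have hmul : ((L.filter (fun a => T < a)).length) =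
      ((Finset.Icc 1 n).filter fun x => T < degree F x).card := by
    have h1 : (L : Multiset ℕ) = (Finset.Icc 1 n).val.map (degree F) := Multiset.sort_eq _ _
    have h2 : (L.filter (fun a => T < a)).length = ((L : Multiset ℕ).filter (fun a => T < a)).card := by
      simp
    rw [h2, h1, Multiset.filter_map, Multiset.card_map]
    rfl
  rw [hmul] at hcount
  obtain ⟨X, hX1, hX2⟩ := Finset.exists_subset_card_eq hcount
  refine ⟨X, hX1.trans (Finset.filter_subset _ _), hX2, fun x hx => ?_⟩
  exact (Finset.mem_filter.1 (hX1 hx)).2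

end S6

theorem stmt_6 (n k l : ℕ) (hl : 4 ≤ l) (hlk : l ≤ k) (hn : 2 * l ^ 2 * k < n)
    (F : Finset (Finset ℕ)) (hF : F ⊆ Finset.powersetCard k (Finset.Icc 1 n))
    (hint : ∀ A ∈ F, ∀ B ∈ F, (A ∩ B).Nonempty) :
    nthDegree n F (l + 1) ≤ (n - 2).choose (k - 2) + (n - l - 1).choose (k - l) := by
  by_contra hcon
  push Not at hcon
  obtain ⟨X, hX, hXc, hdeg⟩ := S6.extract n l _ F hcon
  obtain ⟨G, hG, hI, hd, hS⟩ := S6.exists_shifted n k X _ F rfl hF hint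
  exact S6.main_shifted n k l hl hlk hn X hX hXc G hG hI hS
    (fun x hx => (hdeg x hx).trans_le (hd x hx))
end

section
/- (Daykin) Let n > 2k ≥ 2 and let A, B ⊆ \binom{[n]}{k} be cross-intersecting families. Then min{|A|, |B|} ≤ \binom{n-1}{k-1}. Moreover, if |A| ≥ \binom{n-1}{k-1} and |B| ≥ \binom{n-1}{k-1}, then there exists x ∈ [n] such that A = B = {F ∈ \binom{[n]}{k} : x ∈ F}. -/
open Finset

open scoped FinsetFamily

/-- Shadow ratio bound with its equality case, for families of `(r+1)`-sets. -/
def ShadowRatio (d r : ℕ) : Prop :=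
  ∀ F : Finset (Finset ℕ), (∀ s ∈ F, #s = r + 1) → #F ≤ (r + 1 + d).choose (r + 1) →
    (r + 1) * #F ≤ (d + 1) * #(∂ F) ∧
    (F.Nonempty → (r + 1) * #F = (d + 1) * #(∂ F) →
      ∃ S : Finset ℕ, #S = r + 1 + d ∧ F = powersetCard (r + 1) S)

lemma choose_ratio (d r : ℕ) :
    (r + 1) * (r + 1 + d).choose (r + 1) = (d + 1) * (r + 1 + d).choose r := by
  have h := Nat.choose_succ_right_eq (r + 1 + d) r
  rw [show r + 1 + d - r = d + 1 by omega] at h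
  linarith

lemma member_shadow (v : ℕ) (F : Finset (Finset ℕ)) :
    (∂ F).memberSubfamily v = ∂ (F.memberSubfamily v) := by
  ext s
  simp only [mem_memberSubfamily, mem_shadow_iff_insert_mem, mem_insert, not_or]
  constructor
  · rintro ⟨⟨a, ⟨h1, h2⟩, h3⟩, h4⟩
    exact ⟨a, h2, by rwa [Finset.insert_comm], fun h => h1 h.symm, h4⟩
  · rintro ⟨a, h2, h3, h1, h4⟩
    exact ⟨⟨a, ⟨fun h => h1 h.symm, h2⟩, by rwa [Finset.insert_comm]⟩, h4⟩

lemma member_subset_nonMember_shadow (v : ℕ) (F : Finset (Finset ℕ)) :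
    F.memberSubfamily v ⊆ (∂ F).nonMemberSubfamily v := by
  intro s
  simp only [mem_memberSubfamily, mem_nonMemberSubfamily, mem_shadow_iff_insert_mem]
  rintro ⟨h1, h2⟩
  exact ⟨⟨v, h2, h1⟩, h2⟩

lemma card_member_eq (v : ℕ) (F : Finset (Finset ℕ)) :
    #(F.memberSubfamily v) = #(F.filter (fun s => v ∈ s)) := by
  rw [memberSubfamily, card_image_of_injOn]
  intro s hs t ht h
  simp only [coe_filter, Set.mem_ofPred_eq] at hs ht
  have := congrArg (insert v) h
  simpa [insert_erase, hs.2, ht.2] using this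

lemma sum_member (U : Finset ℕ) (F : Finset (Finset ℕ)) (m : ℕ) (hF : ∀ s ∈ F, #s = m)
    (hU : ∀ s ∈ F, s ⊆ U) : ∑ v ∈ U, #(F.memberSubfamily v) = m * #F := by
  simp_rw [card_member_eq]
  have h := sum_card_bipartiteAbove_eq_sum_card_bipartiteBelow (s := U) (t := F)
    (fun (v : ℕ) (s : Finset ℕ) => v ∈ s)
  simp only [bipartiteAbove, bipartiteBelow] at h
  rw [h]
  have : ∀ s ∈ F, #(U.filter (fun v => v ∈ s)) = m := by
    intro s hs
    rw [filter_mem_eq_inter, inter_eq_right.2 (hU s hs), hF s hs]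
  rw [sum_congr rfl this]
  simp [mul_comm]

lemma kk_of_ratio {d r : ℕ} (h : ShadowRatio d r) (F : Finset (Finset ℕ))
    (hF : ∀ s ∈ F, #s = r + 1) (hc : (r + 1 + d).choose (r + 1) ≤ #F) :
    (r + 1 + d).choose r ≤ #(∂ F) := by
  obtain ⟨G, hGF, hG⟩ := exists_subset_card_eq hc
  have h1 := (h G (fun s hs => hF s (hGF hs)) hG.le).1
  rw [hG, choose_ratio] at h1
  exact (Nat.le_of_mul_le_mul_left h1 (Nat.succ_pos d)).trans (card_le_card (shadow_mono hGF))

/-- A family of sets of size at least two whose shadow lives on `S` lives on `S`. -/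
lemma subset_of_shadow_subset {r : ℕ} {S : Finset ℕ} {F : Finset (Finset ℕ)}
    (hF : ∀ s ∈ F, #s = r + 2) (h : ∂ F ⊆ powersetCard (r + 1) S) :
    F ⊆ powersetCard (r + 2) S := by
  intro s hs
  rw [mem_powersetCard]
  refine ⟨fun x hx => ?_, hF s hs⟩
  obtain ⟨y, hy, hyx⟩ := exists_mem_ne (s := s) (by rw [hF s hs]; omega) x
  have := h (erase_mem_shadow hs hy)
  rw [mem_powersetCard] at this
  exact this.1 (mem_erase.2 ⟨hyx.symm, hx⟩)

lemma ratio_zero (d : ℕ) : ShadowRatio d 0 := by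
  intro F hF hc
  simp only [zero_add, Nat.choose_one_right, one_mul] at *
  rcases F.eq_empty_or_nonempty with rfl | hne
  · simp
  have hsh : ∂ F = {∅} := by
    ext t
    simp only [mem_singleton, mem_shadow_iff]
    constructor
    · rintro ⟨s, hs, a, ha, rfl⟩
      obtain ⟨b, rfl⟩ := card_eq_one.1 (hF s hs)
      simp at ha
      simp [ha]
    · rintro rfl
      obtain ⟨s, hs⟩ := hne
      obtain ⟨b, rfl⟩ := card_eq_one.1 (hF s hs)
      exact ⟨_, hs, b, by simp, by simp⟩
  rw [hsh]
  simp only [card_singleton, mul_one]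
  refine ⟨by omega, fun _ he => ?_⟩
  have hFU : F = powersetCard 1 (F.biUnion id) := by
    ext s
    simp only [mem_powersetCard]
    constructor
    · intro hs
      exact ⟨fun x hx => mem_biUnion.2 ⟨s, hs, hx⟩, hF s hs⟩
    · rintro ⟨h1, h2⟩
      obtain ⟨b, rfl⟩ := card_eq_one.1 h2
      obtain ⟨t, ht, hbt⟩ := mem_biUnion.1 (h1 (mem_singleton_self b))
      obtain ⟨c, rfl⟩ := card_eq_one.1 (hF t ht)
      simp at hbt
      rwa [hbt]
  refine ⟨F.biUnion id, ?_, hFU⟩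
  have := congrArg card hFU
  rw [card_powersetCard, Nat.choose_one_right] at this
  omega

lemma ratio_succ (d r : ℕ) (ih : ShadowRatio d r) : ShadowRatio d (r + 1) := by
  intro F hF hc
  have hF1 : ∀ v, ∀ s ∈ F.memberSubfamily v, #s = r + 1 := by
    intro v s hs
    rw [mem_memberSubfamily] at hs
    have := hF _ hs.1
    rw [card_insert_of_notMem hs.2] at this
    omega
  by_cases hv : ∃ v, (r + 1 + d).choose (r + 1) ≤ #(F.memberSubfamily v)
  · obtain ⟨v, hv⟩ := hv
    have h1 := kk_of_ratio ih _ (hF1 v) hv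
    have h2 := card_memberSubfamily_add_card_nonMemberSubfamily v (∂ F)
    rw [member_shadow] at h2
    have h3 := card_le_card (member_subset_nonMember_shadow v F)
    have h4 := choose_ratio d (r + 1)
    have h5 : (r + 1 + 1 + d).choose (r + 1) =
        (r + 1 + d).choose r + (r + 1 + d).choose (r + 1) := by
      rw [show r + 1 + 1 + d = (r + 1 + d) + 1 by omega, Nat.choose_succ_succ]
    have h6 : (r + 1 + 1 + d).choose (r + 1) ≤ #(∂ F) := by omega
    have h7 := Nat.mul_le_mul_left (r + 1 + 1) hc
    have h8 := Nat.mul_le_mul_left (d + 1) h6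
    refine ⟨by omega, fun _ he => ?_⟩
    have h9 : #(∂ F) = (r + 1 + 1 + d).choose (r + 1) :=
      Nat.eq_of_mul_eq_mul_left (Nat.succ_pos d) (by simp only [Nat.succ_eq_add_one]; omega)
    have h10 : #F = (r + 1 + 1 + d).choose (r + 1 + 1) :=
      Nat.eq_of_mul_eq_mul_left (Nat.succ_pos (r + 1)) (by simp only [Nat.succ_eq_add_one]; omega)
    have h11 : #(F.memberSubfamily v) = (r + 1 + d).choose (r + 1) := by omega
    have h12 : #(∂ (F.memberSubfamily v)) = (r + 1 + d).choose r := by omega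
    have h13 : F.memberSubfamily v = (∂ F).nonMemberSubfamily v :=
      eq_of_subset_of_card_le (member_subset_nonMember_shadow v F) (by omega)
    have hne : (F.memberSubfamily v).Nonempty := by
      rw [← card_pos, h11]; exact Nat.choose_pos (by omega)
    obtain ⟨S, hS, hFS⟩ := (ih _ (hF1 v) h11.le).2 hne (by rw [h11, h12, choose_ratio])
    have hsub : F ⊆ powersetCard (r + 1 + 1) (insert v S) := by
      intro s hs
      rw [mem_powersetCard]
      refine ⟨?_, hF s hs⟩
      by_cases hvs : v ∈ s
      · have : s.erase v ∈ F.memberSubfamily v := by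
          rw [mem_memberSubfamily, insert_erase hvs]
          exact ⟨hs, notMem_erase v s⟩
        rw [hFS, mem_powersetCard] at this
        rw [← insert_erase hvs]
        exact insert_subset_insert _ this.1
      · have : F.nonMemberSubfamily v ⊆ powersetCard (r + 2) S := by
          apply subset_of_shadow_subset
          · intro t ht
            exact hF t (mem_nonMemberSubfamily.1 ht).1
          · rw [← hFS, h13]
            intro t ht
            obtain ⟨u, hu, a, ha, rfl⟩ := mem_shadow_iff.1 ht
            rw [mem_nonMemberSubfamily] at hu ⊢
            exact ⟨erase_mem_shadow hu.1 ha, fun h => hu.2 (mem_of_mem_erase h)⟩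
        have := this (mem_nonMemberSubfamily.2 ⟨hs, hvs⟩)
        rw [mem_powersetCard] at this
        exact this.1.trans (subset_insert _ _)
    have hvS : v ∉ S := by
      intro hvS
      obtain ⟨t, h1t, h2t, h3t⟩ := exists_subsuperset_card_eq (s := {v}) (t := S) (n := r + 1)
        (by simpa using hvS) (by simp) (by omega)
      have : t ∈ F.memberSubfamily v := by rw [hFS, mem_powersetCard]; exact ⟨h2t, h3t⟩
      exact (mem_memberSubfamily.1 this).2 (by simpa using h1t)
    have hcard : #(insert v S) = r + 1 + 1 + d := by
      rw [card_insert_of_notMem hvS]; omega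
    refine ⟨insert v S, hcard, eq_of_subset_of_card_le hsub ?_⟩
    rw [card_powersetCard, hcard, h10]
  · push Not at hv
    set U := F.biUnion id with hU
    have hsU : ∀ s ∈ F, s ⊆ U := fun s hs x hx => mem_biUnion.2 ⟨s, hs, hx⟩
    have e1 := sum_member U F (r + 1 + 1) hF hsU
    have e2 := sum_member U (∂ F) (r + 1)
      (by
        intro s hs
        obtain ⟨t, ht, a, ha, rfl⟩ := mem_shadow_iff.1 hs
        rw [card_erase_of_mem ha, hF t ht]; omega)
      (by
        intro s hs
        obtain ⟨t, ht, a, ha, rfl⟩ := mem_shadow_iff.1 hs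
        exact (erase_subset _ _).trans (hsU t ht))
    simp_rw [member_shadow] at e2
    have hle : ∀ v ∈ U, (r + 1) * #(F.memberSubfamily v) ≤ (d + 1) * #(∂ (F.memberSubfamily v)) :=
      fun v _ => (ih _ (hF1 v) (hv v).le).1
    have hsum := sum_le_sum hle
    rw [← mul_sum, ← mul_sum, e1, e2] at hsum
    have hswap : (d + 1) * ((r + 1) * #(∂ F)) = (r + 1) * ((d + 1) * #(∂ F)) := by ring
    rw [hswap] at hsum
    refine ⟨Nat.le_of_mul_le_mul_left hsum (Nat.succ_pos r), fun hne he => ?_⟩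
    exfalso
    have heq : ∑ v ∈ U, (r + 1) * #(F.memberSubfamily v) =
        ∑ v ∈ U, (d + 1) * #(∂ (F.memberSubfamily v)) := by
      rw [← mul_sum, ← mul_sum, e1, e2, hswap, he]
    have hall := (sum_eq_sum_iff_of_le hle).1 heq
    obtain ⟨s, hs⟩ := hne
    obtain ⟨v, hvs⟩ : s.Nonempty := by rw [← card_pos, hF s hs]; omega
    have hmem : s.erase v ∈ F.memberSubfamily v := by
      rw [mem_memberSubfamily, insert_erase hvs]
      exact ⟨hs, notMem_erase v s⟩
    obtain ⟨S, hS, hFS⟩ := (ih _ (hF1 v) (hv v).le).2 ⟨_, hmem⟩ (hall v (hsU s hs hvs))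
    have := hv v
    rw [hFS, card_powersetCard, hS] at this
    exact lt_irrefl _ this

lemma shadowRatio (d r : ℕ) : ShadowRatio d r := by
  induction r with
  | zero => exact ratio_zero d
  | succ r ih => exact ratio_succ d r ih

/-- Uniqueness for one shadow. -/
lemma shadow_unique_one (d r : ℕ) (F : Finset (Finset ℕ)) (hF : ∀ s ∈ F, #s = r + 2)
    (hc : (r + 2 + d).choose (r + 2) ≤ #F) (hs : #(∂ F) ≤ (r + 2 + d).choose (r + 1)) :
    ∃ S : Finset ℕ, #S = r + 2 + d ∧ F = powersetCard (r + 2) S := by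
  obtain ⟨G, hGF, hG⟩ := exists_subset_card_eq hc
  have hGs : ∀ s ∈ G, #s = r + 1 + 1 := fun s hs => hF s (hGF hs)
  have hk := kk_of_ratio (shadowRatio d (r + 1)) G hGs hG.ge
  have hsub : ∂ G ⊆ ∂ F := shadow_mono hGF
  have hle := card_le_card hsub
  have hGne : G.Nonempty := by
    rw [← card_pos, hG]; exact Nat.choose_pos (by omega)
  have hGc : #(∂ G) = (r + 1 + 1 + d).choose (r + 1) := le_antisymm (hle.trans hs) hk
  obtain ⟨S, hS, hGS⟩ := (shadowRatio d (r + 1) G hGs hG.le).2 hGne (by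
    rw [hGc, ← choose_ratio, hG])
  have heq : ∂ G = ∂ F := eq_of_subset_of_card_le hsub (hs.trans hk)
  refine ⟨S, hS, ?_⟩
  have h1 : F ⊆ powersetCard (r + 2) S := by
    apply subset_of_shadow_subset hF
    rw [← heq, hGS]
    intro t ht
    obtain ⟨u, hu, a, ha, rfl⟩ := mem_shadow_iff.1 ht
    rw [mem_powersetCard] at hu ⊢
    exact ⟨(erase_subset _ _).trans hu.1, by rw [card_erase_of_mem ha, hu.2]; omega⟩
  refine eq_of_subset_of_card_le h1 ?_
  rw [card_powersetCard, hS]; exact hc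

lemma unique_iter (i : ℕ) : ∀ (d r : ℕ) (F : Finset (Finset ℕ)),
    (∀ s ∈ F, #s = r + i + 2) → (r + i + 2 + d).choose (r + i + 2) ≤ #F →
    #(∂^[i + 1] F) ≤ (r + i + 2 + d).choose (r + 1) →
    ∃ S : Finset ℕ, #S = r + i + 2 + d ∧ F = powersetCard (r + i + 2) S := by
  induction i with
  | zero =>
    intro d r F hF hc hs
    exact shadow_unique_one d r F hF hc hs
  | succ i ih =>
    intro d r F hF hc hs
    have hk := kk_of_ratio (shadowRatio d (r + i + 2)) F hF hc
    obtain ⟨S, hS, hFS⟩ := ih (d + 1) r (∂ F)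
      (by
        intro s hs
        obtain ⟨t, ht, a, ha, rfl⟩ := mem_shadow_iff.1 hs
        rw [card_erase_of_mem ha, hF t ht]; omega)
      (by
        rw [show r + i + 2 + (d + 1) = r + i + 2 + 1 + d by omega]; exact hk)
      (by
        rw [show r + i + 2 + (d + 1) = r + (i + 1) + 2 + d by omega]
        rwa [Function.iterate_succ_apply] at hs)
    refine ⟨S, by omega, ?_⟩
    have h1 : F ⊆ powersetCard (r + i + 1 + 2) S :=
      subset_of_shadow_subset hF (by rw [hFS])
    refine eq_of_subset_of_card_le h1 ?_
    rw [card_powersetCard, hS, show r + i + 2 + (d + 1) = r + (i + 1) + 2 + d by omega]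
    exact hc

lemma daykin_eq (n k : ℕ) (hk : 1 ≤ k) (hn : 2 * k < n)
    (A B : Finset (Finset ℕ))
    (hA : A ⊆ Finset.powersetCard k (Finset.Icc 1 n))
    (hB : B ⊆ Finset.powersetCard k (Finset.Icc 1 n))
    (hcross : ∀ s ∈ A, ∀ t ∈ B, (s ∩ t).Nonempty)
    (hAc : (n - 1).choose (k - 1) ≤ A.card) (hBc : (n - 1).choose (k - 1) ≤ B.card) :
      ∃ x ∈ Finset.Icc 1 n,
        A = (Finset.powersetCard k (Finset.Icc 1 n)).filter (fun s => x ∈ s) ∧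
        B = (Finset.powersetCard k (Finset.Icc 1 n)).filter (fun s => x ∈ s) := by
  obtain ⟨r, rfl⟩ : ∃ r, k = r + 1 := ⟨k - 1, by omega⟩
  obtain ⟨i, rfl⟩ : ∃ i, n = 2 * (r + 1) + 1 + i := ⟨n - (2 * (r + 1) + 1), by omega⟩
  set n := 2 * (r + 1) + 1 + i with hndef
  set X := Icc 1 n with hX
  have hXc : #X = n := by simp [hX]
  have hA' : ∀ s ∈ A, s ⊆ X ∧ #s = r + 1 := fun s hs => mem_powersetCard.1 (hA hs)
  have hB' : ∀ s ∈ B, s ⊆ X ∧ #s = r + 1 := fun s hs => mem_powersetCard.1 (hB hs)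
  set G := A.image (fun s => X \ s) with hG
  have hGc : #G = #A := by
    apply card_image_of_injOn
    intro s hs t ht h
    have h' := congrArg (fun u => X \ u) h
    simpa only [Finset.sdiff_sdiff_eq_self (hA' s hs).1, Finset.sdiff_sdiff_eq_self (hA' t ht).1] using h'
  have hGs : ∀ s ∈ G, #s = r + i + 2 := by
    intro s hs
    obtain ⟨t, ht, rfl⟩ := mem_image.1 hs
    rw [card_sdiff_of_subset (hA' t ht).1, (hA' t ht).2, hXc]; omega
  have hGX : ∀ s ∈ G, s ⊆ X := by
    intro s hs
    obtain ⟨t, ht, rfl⟩ := mem_image.1 hs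
    exact sdiff_subset
  have hn1 : n - 1 = r + i + 2 + r := by omega
  have hsym : (r + i + 2 + r).choose (r + i + 2) = (n - 1).choose (r + 1 - 1) := by
    rw [hn1, Nat.add_sub_cancel]
    exact Nat.choose_symm_add
  have hdisj : Disjoint (∂^[i + 1] G) B := by
    rw [disjoint_left]
    intro t ht htB
    obtain ⟨s, hs, hts, _⟩ := mem_shadow_iterate_iff_exists_mem_card_add.1 ht
    obtain ⟨a, ha, rfl⟩ := mem_image.1 hs
    obtain ⟨x, hx⟩ := hcross a ha t htB
    rw [mem_inter] at hx
    exact (mem_sdiff.1 (hts hx.2)).2 hx.1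
  have hsubX : ∂^[i + 1] G ∪ B ⊆ powersetCard (r + 1) X := by
    apply union_subset _ hB
    intro t ht
    obtain ⟨s, hs, hts, hc⟩ := mem_shadow_iterate_iff_exists_mem_card_add.1 ht
    rw [mem_powersetCard]
    refine ⟨hts.trans (hGX s hs), ?_⟩
    have := hGs s hs
    omega
  have hcard := card_le_card hsubX
  rw [card_union_of_disjoint hdisj, card_powersetCard, hXc,
    show n = (r + i + 2 + r) + 1 by omega, Nat.choose_succ_succ] at hcard
  rw [hn1, Nat.add_sub_cancel] at hBc
  obtain ⟨S, hS, hGS⟩ := unique_iter i r r G hGs (by rw [hsym, hGc]; exact hAc)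
    (by simp only [Nat.succ_eq_add_one] at hcard; omega)
  have hSX : S ⊆ X := by
    intro x hx
    obtain ⟨t, h1t, h2t, h3t⟩ := exists_subsuperset_card_eq (s := {x}) (t := S) (n := r + i + 2)
      (by simpa using hx) (by simp) (by omega)
    exact hGX t (by rw [hGS, mem_powersetCard]; exact ⟨h2t, h3t⟩) (by simpa using h1t)
  obtain ⟨x, hx⟩ : ∃ x, X \ S = {x} := by
    apply card_eq_one.1
    rw [card_sdiff_of_subset hSX, hXc, hS]; omega
  have hxm : x ∈ X \ S := by rw [hx]; exact mem_singleton_self x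
  rw [mem_sdiff] at hxm
  have hxu : ∀ y ∈ X, y ≠ x → y ∈ S := by
    intro y hy hyx
    by_contra hyS
    have : y ∈ X \ S := mem_sdiff.2 ⟨hy, hyS⟩
    rw [hx, mem_singleton] at this
    exact hyx this
  have hAeq : A = (powersetCard (r + 1) X).filter (fun s => x ∈ s) := by
    ext s
    rw [mem_filter]
    constructor
    · intro hs
      refine ⟨hA hs, ?_⟩
      by_contra hxs
      have : X \ s ∈ G := mem_image_of_mem _ hs
      rw [hGS, mem_powersetCard] at this
      exact hxm.2 (this.1 (mem_sdiff.2 ⟨hxm.1, hxs⟩))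
    · rintro ⟨hs, hxs⟩
      rw [mem_powersetCard] at hs
      have : X \ s ∈ G := by
        rw [hGS, mem_powersetCard]
        refine ⟨fun y hy => ?_, ?_⟩
        · rw [mem_sdiff] at hy
          exact hxu y hy.1 (fun h => hy.2 (h ▸ hxs))
        · rw [card_sdiff_of_subset hs.1, hs.2, hXc]; omega
      obtain ⟨a, ha, hae⟩ := mem_image.1 this
      have h' := congrArg (fun u => X \ u) hae
      simp only [Finset.sdiff_sdiff_eq_self (hA' a ha).1, Finset.sdiff_sdiff_eq_self hs.1] at h'
      rwa [← h']
  have hBsub : B ⊆ (powersetCard (r + 1) X).filter (fun s => x ∈ s) := by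
    intro b hb
    rw [mem_filter]
    refine ⟨hB hb, ?_⟩
    by_contra hxb
    obtain ⟨a, h1a, h2a, h3a⟩ := exists_subsuperset_card_eq (s := {x}) (t := X \ b) (n := r + 1)
      (by simpa using ⟨hxm.1, hxb⟩) (by simp)
      (by rw [card_sdiff_of_subset (hB' b hb).1, (hB' b hb).2, hXc]; omega)
    have haA : a ∈ A := by
      rw [hAeq, mem_filter, mem_powersetCard]
      exact ⟨⟨h2a.trans sdiff_subset, h3a⟩, by simpa using h1a⟩
    obtain ⟨y, hy⟩ := hcross a haA b hb
    rw [mem_inter] at hy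
    exact (mem_sdiff.1 (h2a hy.1)).2 hy.2
  refine ⟨x, hxm.1, hAeq, eq_of_subset_of_card_le hBsub ?_⟩
  rw [← hAeq, ← hGc, hGS, card_powersetCard, hS, hsym, hn1, Nat.add_sub_cancel]
  exact hBc

lemma card_star (n k x : ℕ) (hk : 1 ≤ k) (hx : x ∈ Finset.Icc 1 n) :
    #((powersetCard k (Icc 1 n)).filter (fun s => x ∈ s)) ≤ (n - 1).choose (k - 1) := by
  rw [← card_member_eq]
  have h : (powersetCard k (Icc 1 n)).memberSubfamily x ⊆
      powersetCard (k - 1) ((Icc 1 n).erase x) := by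
    intro s hs
    rw [mem_memberSubfamily, mem_powersetCard] at hs
    obtain ⟨⟨h1, h2⟩, h3⟩ := hs
    rw [card_insert_of_notMem h3] at h2
    rw [mem_powersetCard]
    refine ⟨fun y hy => mem_erase.2 ⟨fun h => h3 (h ▸ hy), h1 (mem_insert_of_mem hy)⟩, by omega⟩
  refine (card_le_card h).trans ?_
  rw [card_powersetCard, card_erase_of_mem hx]
  simp

theorem stmt_11 (n k : ℕ) (hk : 1 ≤ k) (hn : 2 * k < n)
    (A B : Finset (Finset ℕ))
    (hA : A ⊆ Finset.powersetCard k (Finset.Icc 1 n))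
    (hB : B ⊆ Finset.powersetCard k (Finset.Icc 1 n))
    (hcross : ∀ s ∈ A, ∀ t ∈ B, (s ∩ t).Nonempty) :
    min A.card B.card ≤ (n - 1).choose (k - 1) ∧
    ((n - 1).choose (k - 1) ≤ A.card → (n - 1).choose (k - 1) ≤ B.card →
      ∃ x ∈ Finset.Icc 1 n,
        A = (Finset.powersetCard k (Finset.Icc 1 n)).filter (fun s => x ∈ s) ∧
        B = (Finset.powersetCard k (Finset.Icc 1 n)).filter (fun s => x ∈ s)) := by
  refine ⟨?_, daykin_eq n k hk hn A B hA hB hcross⟩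
  by_contra hlt
  rw [not_le, lt_min_iff] at hlt
  obtain ⟨x, hx, hAx, -⟩ := daykin_eq n k hk hn A B hA hB hcross hlt.1.le hlt.2.le
  have := card_star n k x hk hx
  rw [← hAx] at this
  omega
end

section
/- Let 1 ≤ t ≤ k, n > 2k − t, and n > (t+1)(k−t). If F ⊆ \binom{[n]}{k} is a shifted t-intersecting family, then the (2k−t+1)-th largest degree satisfies d_{2k−t+1}(F) ≤ \binom{n−t−1}{k−t−1}. -/
open Finset

/-- The shifting partial order: for sets `A = {a₁ < … < a_k}` and `B = {b₁ < … < b_k}`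
of the same size, `A ≺ B` iff `aᵢ ≤ bᵢ` for all `i`. -/
def shiftPrec (A B : Finset ℕ) : Prop :=
  A.card = B.card ∧
  ∀ i : ℕ, (A.sort (· ≤ ·)).getD i 0 ≤ (B.sort (· ≤ ·)).getD i 0

/-- the shift replacing `v` by `j` inside the family `G` -/
def shiftMap (G : Finset (Finset ℕ)) (v j : ℕ) (S : Finset ℕ) : Finset ℕ :=
  if v ∈ S ∧ j ∉ S ∧ insert j (S.erase v) ∉ G then insert j (S.erase v) else S

lemma card_swap {S : Finset ℕ} {v j : ℕ} (hv : v ∈ S) (hj : j ∉ S) :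
    (insert j (S.erase v)).card = S.card := by
  rw [card_insert_of_notMem (by simp [hj]), card_erase_add_one hv]

lemma shiftMap_card (G : Finset (Finset ℕ)) (v j : ℕ) (S : Finset ℕ) :
    (shiftMap G v j S).card = S.card := by
  unfold shiftMap
  split_ifs with h
  · exact card_swap h.1 h.2.1
  · rfl

lemma swap_inj {S T : Finset ℕ} {v j : ℕ} (hv : v ∈ S) (hj : j ∉ S) (hv' : v ∈ T) (hj' : j ∉ T)
    (h : insert j (S.erase v) = insert j (T.erase v)) : S = T := by
  ext x
  have := congrArg (x ∈ ·) h
  simp only [mem_insert, mem_erase, eq_iff_iff] at this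
  by_cases h1 : x = v
  · subst h1; tauto
  · by_cases h2 : x = j
    · subst h2; tauto
    · tauto

lemma shiftMap_injOn (G : Finset (Finset ℕ)) (v j : ℕ) :
    Set.InjOn (shiftMap G v j) G := by
  intro S hS T hT h
  unfold shiftMap at h
  split_ifs at h with h1 h2 h2
  · exact swap_inj h1.1 h1.2.1 h2.1 h2.2.1 h
  · exact absurd (h ▸ hT) h1.2.2
  · exact absurd (h ▸ hS) h2.2.2
  · exact h

lemma shift_int_aux {G : Finset (Finset ℕ)} {t v j : ℕ} 
    (hG : ∀ S ∈ G, ∀ T ∈ G, t ≤ (S ∩ T).card) {S T : Finset ℕ} (hS : S ∈ G) (hT : T ∈ G)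
    (h1 : v ∈ S ∧ j ∉ S ∧ insert j (S.erase v) ∉ G)
    (h2 : ¬ (v ∈ T ∧ j ∉ T ∧ insert j (T.erase v) ∉ G)) :
    t ≤ (insert j (S.erase v) ∩ T).card := by
  have hne : j ≠ v := fun h => h1.2.1 (h ▸ h1.1)
  by_cases hvT : v ∈ T
  · by_cases hjT : j ∈ T
    · have e : insert j (S.erase v) ∩ T = insert j ((S ∩ T).erase v) := by
        ext x
        simp only [mem_insert, mem_erase, mem_inter]
        by_cases hx : x = j
        · subst hx; tauto
        · tauto
      rw [e, card_swap (by simp [h1.1, hvT]) (by simp [h1.2.1])]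
      exact hG S hS T hT
    · have h3 : insert j (T.erase v) ∈ G := by tauto
      refine (hG S hS _ h3).trans (card_le_card ?_)
      intro x
      simp only [mem_insert, mem_erase, mem_inter]
      rintro ⟨hx, rfl | hx'⟩
      · exact absurd hx h1.2.1
      · tauto
  · refine (hG S hS T hT).trans (card_le_card ?_)
    intro x
    simp only [mem_insert, mem_erase, mem_inter]
    rintro ⟨hx, hx'⟩
    exact ⟨Or.inr ⟨fun h => hvT (h ▸ hx'), hx⟩, hx'⟩

lemma exists_shifted (V : Finset ℕ) (v t : ℕ) : ∀ (m : ℕ) (G : Finset (Finset ℕ)),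
    (G.filter fun S => v ∈ S).card = m → G ⊆ V.powerset →
    (∀ S ∈ G, ∀ T ∈ G, t ≤ (S ∩ T).card) →
    ∃ G' : Finset (Finset ℕ), G' ⊆ V.powerset ∧ (∀ S ∈ G', ∀ T ∈ G', t ≤ (S ∩ T).card) ∧
      (∀ f : ℕ → ℕ, ∑ S ∈ G', f S.card = ∑ S ∈ G, f S.card) ∧
      (∀ S ∈ G', v ∈ S → ∀ j ∈ V, j ∉ S → insert j (S.erase v) ∈ G') := by
  intro m
  induction m using Nat.strong_induction_on with
  | _ m ih =>
    intro G hm hV hG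
    by_cases hc : ∀ S ∈ G, v ∈ S → ∀ j ∈ V, j ∉ S → insert j (S.erase v) ∈ G
    · exact ⟨G, hV, hG, fun _ => rfl, hc⟩
    push Not at hc
    obtain ⟨S₀, hS₀, hvS₀, j, hjV, hjS₀, hn⟩ := hc
    have hne : j ≠ v := fun h => hjS₀ (h ▸ hvS₀)
    have key := ih _ ?_ (G.image (shiftMap G v j)) rfl ?_ ?_
    · obtain ⟨G', a, b, c, d⟩ := key
      refine ⟨G', a, b, fun f => ?_, d⟩
      rw [c, sum_image (shiftMap_injOn G v j)]
      simp [shiftMap_card]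
    · rw [← hm]
      have : ((G.image (shiftMap G v j)).filter fun S => v ∈ S) ⊂ G.filter fun S => v ∈ S := by
        refine (ssubset_iff_of_subset ?_).2 ⟨S₀, by simp [hS₀, hvS₀], ?_⟩
        · intro S
          simp only [mem_filter, mem_image]
          rintro ⟨⟨T, hT, rfl⟩, hv⟩
          unfold shiftMap at hv ⊢
          split_ifs at hv ⊢ with h
          · simp [hne.symm] at hv
          · exact ⟨hT, hv⟩
        · simp only [mem_filter, mem_image]
          rintro ⟨⟨T, hT, h⟩, hv⟩
          unfold shiftMap at h
          split_ifs at h with h'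
          · rw [← h] at hv
            simp [hne.symm] at hv
          · subst h; exact h' ⟨hvS₀, hjS₀, hn⟩
      exact card_lt_card this
    · intro S
      simp only [mem_image]
      rintro ⟨T, hT, rfl⟩
      have hTV := mem_powerset.1 (hV hT)
      unfold shiftMap
      split_ifs with h
      · exact mem_powerset.2 (insert_subset hjV ((erase_subset _ _).trans hTV))
      · exact hV hT
    · intro S' hS' T' hT'
      obtain ⟨S, hS, rfl⟩ := mem_image.1 hS'
      obtain ⟨T, hT, rfl⟩ := mem_image.1 hT'
      unfold shiftMap
      split_ifs with h1 h2 h2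
      · have e : insert j (S.erase v) ∩ insert j (T.erase v) = insert j ((S ∩ T).erase v) := by
          ext x
          simp only [mem_insert, mem_erase, mem_inter]
          tauto
        rw [e, card_swap (by simp [h1.1, h2.1]) (by simp [h1.2.1])]
        exact hG S hS T hT
      · exact shift_int_aux hG hS hT h1 h2
      · rw [inter_comm]; exact shift_int_aux hG hT hS h2 h1
      · exact hG S hS T hT

/-- number of `K`-sets of the whole ground set with given trace of size `s`, `N` free elements -/
def wt (K N s : ℕ) : ℕ := if s ≤ K then N.choose (K - s) else 0

lemma wt_succ (K N s : ℕ) : wt K (N + 1) s = wt K N s + wt K N (s + 1) := by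
  unfold wt
  by_cases h : s + 1 ≤ K
  · have e : K - s = (K - (s + 1)) + 1 := by omega
    rw [if_pos (by omega), if_pos (by omega), if_pos h, e, Nat.choose_succ_succ, add_comm]
  · by_cases h' : s = K
    · subst h'; simp
    · rw [if_neg (by omega), if_neg (by omega), if_neg h]

lemma wt_pair (K N i i' : ℕ) (hi : 1 ≤ i) (hi' : 1 ≤ i') (h : 2 * K + 1 ≤ N + i + i') :
    wt K N i * wt K N i' ≤ wt K N (i - 1) * wt K N (i' - 1) := by
  unfold wt
  by_cases h1 : i ≤ K
  swap
  · simp [h1]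
  by_cases h2 : i' ≤ K
  swap
  · simp [h2]
  rw [if_pos h1, if_pos h2, if_pos (by omega), if_pos (by omega)]
  obtain ⟨a, rfl⟩ := Nat.exists_eq_add_of_le h1
  obtain ⟨b, hb⟩ := Nat.exists_eq_add_of_le h2
  have e1 : i + a - i = a := by omega
  have e2 : i + a - i' = b := by omega
  have e3 : i + a - (i - 1) = a + 1 := by omega
  have e4 : i + a - (i' - 1) = b + 1 := by omega
  rw [e1, e2, e3, e4]
  have ca := Nat.choose_succ_right_eq N a
  have cb := Nat.choose_succ_right_eq N b
  have hab : a + b + 1 ≤ N := by omega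
  have h3 : b + 1 ≤ N - a := by omega
  have h4 : a + 1 ≤ N - b := by omega
  refine Nat.le_of_mul_le_mul_right (c := (a + 1) * (b + 1)) ?_ (by positivity)
  calc N.choose a * N.choose b * ((a + 1) * (b + 1))
      ≤ N.choose a * N.choose b * ((N - b) * (N - a)) := by gcongr
    _ = (N.choose a * (N - a)) * (N.choose b * (N - b)) := by ring
    _ = (N.choose (a + 1) * (a + 1)) * (N.choose (b + 1) * (b + 1)) := by rw [ca, cb]
    _ = _ := by ring

lemma wt_mid (K N t r : ℕ) (ht : 1 ≤ t) (hr : 1 ≤ r) (hK : t ≤ K)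
    (hn : (t + 1) * (K - t + 1) ≤ N + (t + 2 * r)) :
    (t + r - 1) * wt K N (t + r) ≤ r * wt K N (t + r - 1) := by
  unfold wt
  by_cases h1 : t + r ≤ K
  swap
  · simp [h1]
  rw [if_pos h1, if_pos (by omega)]
  obtain ⟨a, rfl⟩ := Nat.exists_eq_add_of_le h1
  obtain ⟨u, rfl⟩ := Nat.exists_eq_add_of_le ht
  have e1 : 1 + u + r + a - (1 + u + r) = a := by omega
  have e2 : 1 + u + r + a - (1 + u + r - 1) = a + 1 := by omega
  have e3 : 1 + u + r + a - (1 + u) = r + a := by omega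
  have e4 : 1 + u + r - 1 = u + r := by omega
  rw [e3] at hn
  rw [e1, e2, e4]
  have ca := Nat.choose_succ_right_eq N a
  have hN : a ≤ N := by nlinarith
  obtain ⟨M, rfl⟩ := Nat.exists_eq_add_of_le hN
  have e5 : a + M - a = M := by omega
  rw [e5] at ca
  have hh : (u + r) * (a + 1) ≤ r * M := by
    obtain ⟨q, rfl⟩ := Nat.exists_eq_add_of_le hr
    nlinarith [Nat.mul_le_mul_left (1 + q) hn, Nat.zero_le (u * q * a), Nat.zero_le (u * q * q),
      Nat.zero_le (u * q)]
  refine Nat.le_of_mul_le_mul_right (c := a + 1) ?_ (by positivity)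
  calc (u + r) * (a + M).choose a * (a + 1) = (a + M).choose a * ((u + r) * (a + 1)) := by ring
    _ ≤ (a + M).choose a * (r * M) := by gcongr
    _ = r * ((a + M).choose a * M) := by ring
    _ = r * ((a + M).choose (a + 1) * (a + 1)) := by rw [ca]
    _ = _ := by ring

lemma exists_sel (b w : ℕ → ℕ) (m t l : ℕ) (hm : m = l + t) (ht : 1 ≤ t)
    (hw : ∀ i, t ≤ i → i ≤ l → w i * w (m - i) ≤ w (i - 1) * w (m - i - 1)) :
    ∃ sel : ℕ → Prop, (∀ i, t ≤ i → i ≤ l → 2 * i ≠ m → (sel i ↔ ¬ sel (m - i))) ∧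
      (∀ i, 2 * i = m → ¬ sel i) ∧
      (∀ i, t ≤ i → i ≤ l → sel i → b (m - i) * w (m - i) ≤ b i * w (i - 1)) := by
  let P : ℕ → Prop := fun i => b (m - i) * w (m - i) ≤ b i * w (i - 1)
  refine ⟨fun i => (2 * i < m ∧ P i) ∨ (m < 2 * i ∧ ¬ P (m - i)), ?_, ?_, ?_⟩
  · intro i h1 h2 h3
    have e : m - (m - i) = i := by omega
    simp only [e]
    rcases lt_or_gt_of_ne h3 with h | h
    · have a1 : ¬ (2 * (m - i) < m) := by omega
      have a2 : m < 2 * (m - i) := by omega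
      have a3 : ¬ (m < 2 * i) := by omega
      tauto
    · have a1 : (2 * (m - i) < m) := by omega
      have a2 : ¬ m < 2 * (m - i) := by omega
      have a3 : ¬ (2 * i < m) := by omega
      tauto
  · intro i h; omega
  · rintro i h1 h2 (⟨_, h⟩ | ⟨h3, h⟩)
    · exact h
    · have e : m - (m - i) = i := by omega
      simp only [P, e, not_le] at h
      by_contra hc
      push Not at hc
      have h5 := hw i h1 h2
      have h6 := Nat.mul_lt_mul'' h hc
      have hb : 0 < b i * b (m - i) := by
        have : 0 < b i := Nat.pos_of_ne_zero (by rintro h0; simp [h0] at h)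
        have : 0 < b (m - i) := Nat.pos_of_ne_zero (by rintro h0; simp [h0] at hc)
        positivity
      have h7 := Nat.mul_le_mul_left (b i * b (m - i)) h5
      have h8 : b i * b (m - i) * (w (i - 1) * w (m - i - 1)) =
        b (m - i) * w (m - i - 1) * (b i * w (i - 1)) := by ring
      have h9 : b i * b (m - i) * (w i * w (m - i)) = b i * w i * (b (m - i) * w (m - i)) := by ring
      omega

lemma sum_group (B : Finset (Finset ℕ)) (t l : ℕ) (hB : ∀ S ∈ B, t ≤ S.card ∧ S.card ≤ l)
    (p : ℕ → Prop) [DecidablePred p] (f : ℕ → ℕ) :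
    ∑ S ∈ B.filter (fun S => p S.card), f S.card =
      ∑ i ∈ (Finset.Icc t l).filter p, (B.filter fun S => S.card = i).card * f i := by
  rw [← sum_fiberwise_of_maps_to (s := B.filter (fun S => p S.card)) (g := Finset.card)
    (t := (Finset.Icc t l).filter p)]
  · refine sum_congr rfl fun i hi => ?_
    rw [sum_congr (g := fun _ => f i) rfl (by intro S hS; simp at hS; rw [hS.2]), sum_const,
      smul_eq_mul]
    congr 2
    ext S
    simp only [mem_filter]
    constructor
    · rintro ⟨⟨a, b⟩, c⟩; exact ⟨a, c⟩
    · rintro ⟨a, c⟩; exact ⟨⟨a, c ▸ (mem_filter.1 hi).2⟩, c⟩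
  · intro S hS
    have := mem_filter.1 hS
    have := hB S this.1
    simp; tauto

/-- choice of the boundary sets to be kept -/
lemma exists_keep (V : Finset ℕ) (v t K N : ℕ) (hv : v ∈ V) (ht : 1 ≤ t) (hK : t ≤ K)
    (hV : t < V.card) (hn : (t + 1) * (K - t + 1) ≤ N + V.card)
    (B : Finset (Finset ℕ)) (hB : ∀ S ∈ B, t ≤ S.card ∧ S ⊆ V ∧ v ∈ S) :
    ∃ Q ⊆ B, (∀ S ∈ Q, ∀ T ∈ Q, S.card + T.card = V.card + t → S ∪ T ≠ V) ∧
      ∑ S ∈ B \ Q, wt K N S.card ≤ ∑ S ∈ Q, wt K N (S.card - 1) := by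
  classical
  have hB' : ∀ S ∈ B, t ≤ S.card ∧ S.card ≤ V.card := fun S hS =>
    ⟨(hB S hS).1, card_le_card (hB S hS).2.1⟩
  have hn' : 2 * K + 1 ≤ N + V.card + t := by
    obtain ⟨d, rfl⟩ := Nat.exists_eq_add_of_le hK
    have : t + d - t = d := by omega
    rw [this] at hn
    nlinarith
  obtain ⟨sel, s1, s2, s3⟩ := exists_sel (fun i => (B.filter fun S => S.card = i).card) (wt K N)
    (V.card + t) t V.card rfl ht (fun i h1 h2 => wt_pair K N i _ (by omega) (by omega) (by omega))
  -- the middle layer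
  have hmid : ∃ j ∈ V.erase v,
      ∑ S ∈ B.filter (fun S => 2 * S.card = V.card + t ∧ j ∈ S), wt K N S.card ≤
      ∑ S ∈ B.filter (fun S => 2 * S.card = V.card + t ∧ j ∉ S), wt K N (S.card - 1) := by
    have hne : (V.erase v).Nonempty := by
      rw [← card_pos, card_erase_of_mem hv]; omega
    apply exists_le_of_sum_le hne
    have e1 : ∀ (P : ℕ → Finset ℕ → Prop) [∀ j S, Decidable (P j S)] (f : ℕ → ℕ),
        ∑ j ∈ V.erase v, ∑ S ∈ B.filter (fun S => 2 * S.card = V.card + t ∧ P j S), f S.card =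
        ∑ S ∈ B.filter (fun S => 2 * S.card = V.card + t),
          ((V.erase v).filter (fun j => P j S)).card * f S.card := by
      intro P _ f
      simp_rw [← filter_filter, sum_filter (p := P _)]
      rw [sum_comm]
      refine sum_congr rfl fun S hS => ?_
      rw [← sum_filter, sum_const, smul_eq_mul]
    rw [e1 (fun j S => j ∈ S) (fun i => wt K N i), e1 (fun j S => j ∉ S) (fun i => wt K N (i - 1))]
    refine sum_le_sum fun S hS => ?_
    obtain ⟨hSB, hSc⟩ := mem_filter.1 hS
    obtain ⟨h1, h2, h3⟩ := hB S hSB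
    have c1 : ((V.erase v).filter (fun j => j ∈ S)) = S.erase v := by
      ext x; simp only [mem_filter, mem_erase]
      constructor
      · tauto
      · rintro ⟨a, b⟩; exact ⟨⟨a, h2 b⟩, b⟩
    have c2 : ((V.erase v).filter (fun j => j ∉ S)) = V \ S := by
      ext x; simp only [mem_filter, mem_erase, mem_sdiff]
      constructor
      · tauto
      · rintro ⟨a, b⟩; exact ⟨⟨fun h => b (h ▸ h3), a⟩, b⟩
    rw [c1, c2, card_erase_of_mem h3, card_sdiff_of_subset h2]
    obtain ⟨r, hr⟩ := Nat.exists_eq_add_of_le h1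
    have e : V.card - S.card = r := by omega
    rw [e, hr]
    exact wt_mid K N t r ht (by omega) hK (by rw [show t + 2 * r = V.card by omega]; exact hn)
  obtain ⟨j, hj, hjs⟩ := hmid
  refine ⟨B.filter (fun S => sel S.card ∨ (2 * S.card = V.card + t ∧ j ∉ S)), filter_subset _ _,
    ?_, ?_⟩
  · intro S hS T hT hc hu
    obtain ⟨hSB, hS⟩ := mem_filter.1 hS
    obtain ⟨hTB, hT⟩ := mem_filter.1 hT
    have b1 := hB' S hSB
    have b2 := hB' T hTB
    by_cases h2 : 2 * S.card = V.card + t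
    · have h3 : 2 * T.card = V.card + t := by omega
      have a1 := s2 _ h2
      have a2 := s2 _ h3
      have : j ∈ S ∪ T := by rw [hu]; exact mem_of_mem_erase hj
      rw [mem_union] at this
      tauto
    · have h3 : ¬ 2 * T.card = V.card + t := by omega
      have h4 := s1 S.card b1.1 b1.2 h2
      rw [show V.card + t - S.card = T.card by omega] at h4
      tauto
  · have d1 : B \ B.filter (fun S => sel S.card ∨ (2 * S.card = V.card + t ∧ j ∉ S)) =
        B.filter (fun S => ¬ sel S.card ∧ 2 * S.card ≠ V.card + t) ∪
        B.filter (fun S => 2 * S.card = V.card + t ∧ j ∈ S) := by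
      ext S
      have := s2 S.card
      simp only [mem_sdiff, mem_filter, mem_union]
      tauto
    have d2 : B.filter (fun S => sel S.card ∨ (2 * S.card = V.card + t ∧ j ∉ S)) =
        B.filter (fun S => sel S.card) ∪
        B.filter (fun S => 2 * S.card = V.card + t ∧ j ∉ S) := by
      rw [filter_or]
    rw [d1, d2, sum_union, sum_union]
    · refine Nat.add_le_add ?_ hjs
      rw [sum_group B t V.card hB' (fun i => ¬ sel i ∧ 2 * i ≠ V.card + t) (wt K N),
        sum_group B t V.card hB' sel (fun i => wt K N (i - 1))]
      rw [sum_bij' (t := (Finset.Icc t V.card).filter sel)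
        (g := fun i => (B.filter fun S => S.card = V.card + t - i).card * wt K N (V.card + t - i))
        (fun i _ => V.card + t - i) (fun i _ => V.card + t - i)]
      · refine sum_le_sum fun i hi => ?_
        simp only [mem_filter, mem_Icc] at hi
        exact s3 i hi.1.1 hi.1.2 hi.2
      · intro i hi
        simp only [mem_filter, mem_Icc] at hi ⊢
        have := s1 i hi.1.1 hi.1.2 hi.2.2
        refine ⟨by omega, by tauto⟩
      · intro i hi
        simp only [mem_filter, mem_Icc] at hi ⊢
        have h0 : 2 * i ≠ V.card + t := fun h => s2 i h hi.2
        have := s1 i hi.1.1 hi.1.2 h0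
        refine ⟨by omega, by tauto, by omega⟩
      · intro i hi
        simp only [mem_filter, mem_Icc] at hi
        omega
      · intro i hi
        simp only [mem_filter, mem_Icc] at hi
        omega
      · intro i hi
        simp only [mem_filter, mem_Icc] at hi
        rw [show V.card + t - (V.card + t - i) = i by omega]
    · rw [disjoint_filter]
      intro S _ h1 h2
      exact s2 _ h2.1 h1
    · rw [disjoint_filter]
      intro S _ h1 h2
      exact h1.2 h2.1

lemma ekr_step (V : Finset ℕ) (v t K N : ℕ) (hv : v ∈ V) (ht : 1 ≤ t) (hK : t ≤ K)
    (hV : t < V.card) (hn : (t + 1) * (K - t + 1) ≤ N + V.card)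
    (G : Finset (Finset ℕ)) (hGV : G ⊆ V.powerset)
    (hG : ∀ S ∈ G, ∀ T ∈ G, t ≤ (S ∩ T).card) :
    ∃ G' ⊆ (V.erase v).powerset, (∀ S ∈ G', ∀ T ∈ G', t ≤ (S ∩ T).card) ∧
      ∑ S ∈ G, wt K N S.card ≤ ∑ S ∈ G', wt K (N + 1) S.card := by
  classical
  obtain ⟨H, hHV, hH, hw, hsh⟩ := exists_shifted V v t _ G rfl hGV hG
  rw [← hw]
  clear hw hGV hG G
  set B := H.filter (fun S => v ∈ S ∧ S.erase v ∉ H) with hBdef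
  have hBm : ∀ S, S ∈ B ↔ S ∈ H ∧ v ∈ S ∧ S.erase v ∉ H := by simp [hBdef]
  obtain ⟨Q, hQB, hQ, hQs⟩ := exists_keep V v t K N hv ht hK hV hn B (by
    intro S hS
    rw [hBm] at hS
    have := hH S hS.1 S hS.1
    rw [inter_self] at this
    exact ⟨this, mem_powerset.1 (hHV hS.1), hS.2.1⟩)
  set H0 := H.filter (fun S => v ∉ S) with hH0
  have hQm : ∀ S ∈ Q, S ∈ H ∧ v ∈ S ∧ S.erase v ∉ H := fun S hS => (hBm S).1 (hQB hS)
  -- intersections inside the boundary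
  have hB2 : ∀ S ∈ H, v ∈ S → ∀ T ∈ H, v ∈ T →
      (S.card + T.card = V.card + t → S ∪ T ≠ V) → t ≤ (S.erase v ∩ T).card := by
    intro S hS hvS T hT hvT hne
    have hSV := mem_powerset.1 (hHV hS)
    have hTV := mem_powerset.1 (hHV hT)
    have e : S.erase v ∩ T = (S ∩ T).erase v := by
      ext x; simp only [mem_inter, mem_erase]; tauto
    by_cases hu : S ∪ T = V
    · have h1 := card_union_add_card_inter S T
      rw [hu] at h1
      have h2 := hH S hS T hT
      have h3 : S.card + T.card ≠ V.card + t := fun h => hne h hu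
      rw [e, card_erase_of_mem (by simp [hvS, hvT])]
      omega
    · obtain ⟨j, hjV, hj⟩ := exists_of_ssubset (ssubset_of_subset_of_ne (union_subset hSV hTV) hu)
      simp only [mem_union, not_or] at hj
      have h1 := hsh S hS hvS j hjV hj.1
      refine (hH _ h1 T hT).trans (card_le_card ?_)
      intro x
      simp only [mem_inter, mem_insert]
      rintro ⟨rfl | h, h'⟩
      · exact absurd h' hj.2
      · exact ⟨h, h'⟩
  have hQ0 : ∀ S ∈ Q, ∀ T ∈ H0, t ≤ (S.erase v ∩ T).card := by
    intro S hS T hT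
    obtain ⟨hT, hvT⟩ := mem_filter.1 hT
    refine (hH S (hQm S hS).1 T hT).trans (card_le_card ?_)
    intro x
    simp only [mem_inter, mem_erase]
    rintro ⟨h, h'⟩
    exact ⟨⟨fun hx => hvT (hx ▸ h'), h⟩, h'⟩
  have hinj : Set.InjOn (fun S : Finset ℕ => S.erase v) (Q : Set (Finset ℕ)) := by
    intro S hS T hT h
    have := congrArg (insert v) h
    simpa [insert_erase (hQm S hS).2.1, insert_erase (hQm T hT).2.1] using this
  refine ⟨H0 ∪ Q.image (fun S => S.erase v), ?_, ?_, ?_⟩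
  · intro S hS
    rw [mem_union, mem_image] at hS
    rw [mem_powerset]
    rcases hS with hS | ⟨T, hT, rfl⟩
    · obtain ⟨hS, hvS⟩ := mem_filter.1 hS
      exact subset_erase.2 ⟨mem_powerset.1 (hHV hS), hvS⟩
    · exact erase_subset_erase _ (mem_powerset.1 (hHV (hQm T hT).1))
  · intro S hS T hT
    rw [mem_union, mem_image] at hS hT
    rcases hS with hS | ⟨S, hS, rfl⟩ <;> rcases hT with hT | ⟨T, hT, rfl⟩
    · exact hH _ (mem_filter.1 hS).1 _ (mem_filter.1 hT).1
    · rw [inter_comm]; exact hQ0 T hT S hS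
    · exact hQ0 S hS T hT
    · have := hB2 S (hQm S hS).1 (hQm S hS).2.1 T (hQm T hT).1 (hQm T hT).2.1 (hQ S hS T hT)
      have e : S.erase v ∩ T.erase v = S.erase v ∩ T := by
        ext x; simp only [mem_inter, mem_erase]; tauto
      simpa only [e] using this
  · rw [sum_union, sum_image hinj]
    · have a1 : ∑ S ∈ Q, wt K (N + 1) (S.erase v).card =
          ∑ S ∈ Q, wt K N (S.card - 1) + ∑ S ∈ Q, wt K N S.card := by
        rw [← sum_add_distrib]
        refine sum_congr rfl fun S hS => ?_
        have hvS := (hQm S hS).2.1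
        have : 0 < S.card := card_pos.2 ⟨v, hvS⟩
        rw [wt_succ, card_erase_of_mem hvS, Nat.sub_add_cancel this]
      have a2 : ∑ S ∈ H0, wt K (N + 1) S.card =
          ∑ S ∈ H0, wt K N S.card + ∑ S ∈ H0, wt K N (S.card + 1) := by
        rw [← sum_add_distrib]
        exact sum_congr rfl fun S hS => wt_succ _ _ _
      have a3 : ∑ S ∈ H, wt K N S.card = ∑ S ∈ H0, wt K N S.card +
          (∑ S ∈ B, wt K N S.card +
            ∑ S ∈ H.filter (fun S => v ∈ S ∧ S.erase v ∈ H), wt K N S.card) := by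
        rw [← sum_union, ← sum_union]
        · refine sum_congr ?_ fun _ _ => rfl
          ext S
          simp only [mem_union, hBm, hH0, mem_filter]
          tauto
        · rw [disjoint_left]
          intro S h1 h2
          simp only [mem_union, hBm, hH0, mem_filter] at h1 h2
          tauto
        · rw [disjoint_left]
          intro S h1 h2
          simp only [hBm, mem_filter] at h1 h2
          tauto
      have a4 : ∑ S ∈ H.filter (fun S => v ∈ S ∧ S.erase v ∈ H), wt K N S.card ≤
          ∑ S ∈ H0, wt K N (S.card + 1) := by
        have hi : Set.InjOn (fun S : Finset ℕ => S.erase v)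
            (H.filter (fun S => v ∈ S ∧ S.erase v ∈ H) : Set (Finset ℕ)) := by
          intro S hS T hT h
          have hS := (mem_filter.1 hS).2.1
          have hT := (mem_filter.1 hT).2.1
          have := congrArg (insert v) h
          simpa [insert_erase hS, insert_erase hT] using this
        calc _ = ∑ S ∈ (H.filter (fun S => v ∈ S ∧ S.erase v ∈ H)).image (fun S => S.erase v),
              wt K N (S.card + 1) := by
              rw [sum_image hi]
              refine sum_congr rfl fun S hS => ?_
              rw [card_erase_add_one (mem_filter.1 hS).2.1]
          _ ≤ _ := by
              refine sum_le_sum_of_subset ?_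
              intro S hS
              obtain ⟨T, hT, rfl⟩ := mem_image.1 hS
              exact mem_filter.2 ⟨(mem_filter.1 hT).2.2, by simp⟩
      have a5 := sum_sdiff (f := fun S => wt K N S.card) hQB
      omega
    · rw [disjoint_left]
      intro S h1 h2
      obtain ⟨T, hT, rfl⟩ := mem_image.1 h2
      exact (hQm T hT).2.2 (mem_filter.1 h1).1

lemma ekr_aux (t K : ℕ) (ht : 1 ≤ t) (hK : t ≤ K) : ∀ (d N : ℕ) (V : Finset ℕ), V.card = t + d →
    (t + 1) * (K - t + 1) ≤ N + V.card → ∀ G : Finset (Finset ℕ), G ⊆ V.powerset →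
    (∀ S ∈ G, ∀ T ∈ G, t ≤ (S ∩ T).card) →
    ∑ S ∈ G, wt K N S.card ≤ (N + d).choose (K - t) := by
  intro d
  induction d with
  | zero =>
    intro N V hV hn G hGV hG
    have : G ⊆ {V} := by
      intro S hS
      have h1 := hG S hS S hS
      rw [inter_self] at h1
      rw [mem_singleton]
      exact eq_of_subset_of_card_le (mem_powerset.1 (hGV hS)) (by omega)
    refine (sum_le_sum_of_subset this).trans ?_
    simp [wt, hV, hK]
  | succ d ih =>
    intro N V hV hn G hGV hG
    obtain ⟨v, hv⟩ : V.Nonempty := card_pos.1 (by omega)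
    obtain ⟨G', h1, h2, h3⟩ := ekr_step V v t K N hv ht hK (by omega) hn G hGV hG
    have hc := card_erase_add_one hv
    have := ih (N + 1) (V.erase v) (by omega) (by omega) G' h1 h2
    rw [show N + (d + 1) = N + 1 + d by omega]
    exact h3.trans this

/-- the Erdős–Ko–Rado theorem for `t`-intersecting families (Frankl, Wilson) -/
lemma ekr (t K n : ℕ) (ht : 1 ≤ t) (hK : t ≤ K) (hn : (t + 1) * (K - t + 1) ≤ n)
    (V : Finset ℕ) (hV : V.card = n) (G : Finset (Finset ℕ)) (hG : G ⊆ powersetCard K V)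
    (hint : ∀ S ∈ G, ∀ T ∈ G, t ≤ (S ∩ T).card) : G.card ≤ (n - t).choose (K - t) := by
  have htn : t ≤ n := by nlinarith
  have := ekr_aux t K ht hK (n - t) 0 V (by omega) (by omega) G
    (fun S hS => mem_powerset.2 (mem_powersetCard.1 (hG hS)).1) hint
  rw [zero_add] at this
  refine le_trans ?_ this
  rw [card_eq_sum_ones]
  refine sum_le_sum fun S hS => ?_
  rw [(mem_powersetCard.1 (hG hS)).2]
  simp [wt]

lemma sort_getD_le (A : Finset ℕ) (i y : ℕ) (h : i < (A.filter (· ≤ y)).card) :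
    (A.sort (· ≤ ·)).getD i 0 ≤ y := by
  have hi : i < A.card := h.trans_le (card_le_card (filter_subset _ _))
  have hl : i < (A.sort (· ≤ ·)).length := by simpa using hi
  rw [List.getD_eq_getElem _ _ hl]
  by_contra hc
  push Not at hc
  have hsub : A.filter (· ≤ y) ⊆
      (Finset.univ.filter (fun q : Fin A.card => q.val < i)).image (A.orderEmbOfFin rfl) := by
    intro a ha
    obtain ⟨haA, hay⟩ := mem_filter.1 ha
    have : a ∈ Set.range (A.orderEmbOfFin rfl) := by rw [range_orderEmbOfFin]; exact haA
    obtain ⟨q, rfl⟩ := this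
    refine mem_image.2 ⟨q, ?_, rfl⟩
    simp only [mem_filter, mem_univ, true_and]
    by_contra hq
    have h1 : A.orderEmbOfFin rfl ⟨i, hi⟩ ≤ A.orderEmbOfFin rfl q :=
      (A.orderEmbOfFin rfl).monotone (by rw [Fin.le_def]; simpa using hq)
    rw [orderEmbOfFin_apply] at h1
    exact absurd (h1.trans hay) (not_le.2 hc)
  have h2 := (card_le_card hsub).trans card_image_le
  have h3 : (Finset.univ.filter (fun q : Fin A.card => q.val < i)).card ≤ i := by
    have := card_le_card_of_injOn (s := Finset.univ.filter (fun q : Fin A.card => q.val < i))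
      (t := Finset.range i) (fun q => q.val) (by intro q hq; simpa using hq)
      (by intro a _ b _ hab; exact Fin.ext hab)
    simpa using this
  omega

lemma lt_card_filter_sort (A : Finset ℕ) (i : ℕ) (hi : i < A.card) :
    i < (A.filter (· ≤ (A.sort (· ≤ ·)).getD i 0)).card := by
  have hl : i < (A.sort (· ≤ ·)).length := by simpa using hi
  rw [List.getD_eq_getElem _ _ hl]
  have hsub : (Finset.univ.filter (fun q : Fin A.card => q.val ≤ i)).image (A.orderEmbOfFin rfl) ⊆
      A.filter (· ≤ (A.sort (· ≤ ·))[i]) := by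
    intro a ha
    obtain ⟨q, hq, rfl⟩ := mem_image.1 ha
    simp only [mem_filter, mem_univ, true_and] at hq
    refine mem_filter.2 ⟨orderEmbOfFin_mem _ _ _, ?_⟩
    have h1 : A.orderEmbOfFin rfl q ≤ A.orderEmbOfFin rfl ⟨i, hi⟩ :=
      (A.orderEmbOfFin rfl).monotone (by rw [Fin.le_def]; simpa using hq)
    rw [orderEmbOfFin_apply _ _ ⟨i, hi⟩] at h1
    exact h1
  have h2 := card_le_card hsub
  rw [card_image_of_injective _ (A.orderEmbOfFin rfl).injective] at h2
  have h3 : i + 1 ≤ (Finset.univ.filter (fun q : Fin A.card => q.val ≤ i)).card := by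
    have := card_le_card_of_injOn (s := (Finset.univ : Finset (Fin (i + 1))))
      (t := Finset.univ.filter (fun q : Fin A.card => q.val ≤ i))
      (fun q => ⟨q.val, by omega⟩) (by intro q _; simp; omega)
      (by intro a _ b _ hab; simpa [Fin.ext_iff] using hab)
    simpa using this
  omega

/-- replacing an element by a smaller one gives a smaller set in the shifting order -/
lemma shiftPrec_swap {A : Finset ℕ} {x j : ℕ} (hx : x ∈ A) (hj : j ∉ A) (hjx : j < x) :
    shiftPrec (insert j (A.erase x)) A := by
  have hc := card_swap hx hj
  refine ⟨hc, fun i => ?_⟩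
  by_cases hi : i < A.card
  · apply sort_getD_le
    refine (lt_card_filter_sort A i hi).trans_le ?_
    generalize (A.sort (· ≤ ·)).getD i 0 = y
    by_cases hxy : x ≤ y
    · rw [← card_swap (S := A.filter (· ≤ y)) (v := x) (j := j) (by simp [hx, hxy]) (by simp [hj])]
      refine card_le_card ?_
      intro z
      simp only [mem_insert, mem_erase, mem_filter]
      rintro (rfl | ⟨h1, h2, h3⟩)
      · exact ⟨Or.inl rfl, by omega⟩
      · exact ⟨Or.inr ⟨h1, h2⟩, h3⟩
    · refine card_le_card ?_
      intro z
      simp only [mem_insert, mem_erase, mem_filter]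
      rintro ⟨h2, h3⟩
      exact ⟨Or.inr ⟨by rintro rfl; exact hxy h3, h2⟩, h3⟩
  · rw [List.getD_eq_default]
    · exact Nat.zero_le _
    · simp only [length_sort]; omega

lemma nthDegree_le (n m b : ℕ) (F : Finset (Finset ℕ))
    (h : ∀ x, m < x → x ≤ n → degree F x ≤ b) : nthDegree n F (m + 1) ≤ b := by
  unfold nthDegree
  rw [Nat.add_sub_cancel]
  set M := (Finset.Icc 1 n).val.map (degree F) with hM
  by_contra hc
  push Not at hc
  have hl : m < (M.sort (· ≥ ·)).length := by
    by_contra hl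
    rw [List.getD_eq_default _ _ (by omega)] at hc
    omega
  rw [List.getD_eq_getElem _ _ hl] at hc
  have hs : (M.sort (· ≥ ·)).Pairwise (· ≥ ·) := Multiset.pairwise_sort _ _
  have h1 : m + 1 ≤ (M.sort (· ≥ ·)).countP (fun q => decide (b < q)) := by
    have h2 := (List.take_sublist (m + 1) (M.sort (· ≥ ·))).countP_le (p := fun q => decide (b < q))
    have h3 : ((M.sort (· ≥ ·)).take (m + 1)).countP (fun q => decide (b < q)) = m + 1 := by
      rw [List.countP_eq_length.2, List.length_take]
      · omega
      · intro a ha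
        obtain ⟨i, hi, rfl⟩ := List.getElem_of_mem ha
        rw [List.length_take] at hi
        rw [List.getElem_take]
        rw [decide_eq_true_iff]
        refine hc.trans_le ?_
        rcases Nat.lt_or_ge i m with h4 | h4
        · exact List.pairwise_iff_getElem.1 hs i m (by omega) hl h4
        · have : i = m := by omega
          subst this; exact le_rfl
    omega
  have h2 : (M.sort (· ≥ ·)).countP (fun q => decide (b < q)) = M.countP (fun q => b < q) := by
    conv_rhs => rw [← Multiset.sort_eq M (· ≥ ·)]
    rw [Multiset.coe_countP]
  rw [h2, hM, Multiset.countP_map] at h1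
  have h3 : ((Finset.Icc 1 n).filter (fun x => b < degree F x)).card ≤ m := by
    have : (Finset.Icc 1 n).filter (fun x => b < degree F x) ⊆ Finset.Icc 1 m := by
      intro x hx
      simp only [mem_filter, mem_Icc] at hx ⊢
      by_contra h5
      have := h x (by omega) hx.1.2
      omega
    simpa using card_le_card this
  have h4 : (Multiset.filter (fun x => b < degree F x) (Finset.Icc 1 n).val).card ≤ m := h3
  omega

theorem stmt_13 (n k t : ℕ) (ht : 1 ≤ t) (htk : t ≤ k)
    (hn1 : 2 * k - t < n) (hn2 : (t + 1) * (k - t) < n)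
    (F : Finset (Finset ℕ)) (hF : F ⊆ Finset.powersetCard k (Finset.Icc 1 n))
    (hint : ∀ A ∈ F, ∀ C ∈ F, t ≤ (A ∩ C).card)
    (hshift : ∀ C ∈ F, ∀ A : Finset ℕ, A ⊆ Finset.Icc 1 n → shiftPrec A C → A ∈ F) :
    nthDegree n F (2 * k - t + 1) ≤ (n - t - 1).choose (k - t - 1) := by
  apply nthDegree_le
  intro x hx hxn
  unfold degree
  rcases htk.eq_or_lt with rfl | hlt
  · have : (n - t - 1).choose (t - t - 1) = 1 := by simp
    rw [this]
    refine (card_le_card (filter_subset _ _)).trans (card_le_one.2 ?_)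
    intro A hA C hC
    have h1 := (mem_powersetCard.1 (hF hA)).2
    have h2 := (mem_powersetCard.1 (hF hC)).2
    have h3 := hint A hA C hC
    have h4 := eq_of_subset_of_card_le (inter_subset_left (s₁ := A) (s₂ := C)) (by omega)
    have h5 := eq_of_subset_of_card_le (inter_subset_right (s₁ := A) (s₂ := C)) (by omega)
    rw [← h4, h5]
  · have hinj : Set.InjOn (fun S : Finset ℕ => S.erase x)
        (F.filter fun A => x ∈ A : Finset (Finset ℕ)) := by
      intro S hS T hT h
      have hS := (mem_filter.1 hS).2
      have hT := (mem_filter.1 hT).2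
      have := congrArg (insert x) h
      simpa [insert_erase hS, insert_erase hT] using this
    rw [← card_image_of_injOn hinj]
    have hxI : x ∈ Finset.Icc 1 n := by simp; omega
    have key := ekr t (k - 1) (n - 1) ht (by omega)
      (by rw [show k - 1 - t + 1 = k - t by omega]; omega) ((Finset.Icc 1 n).erase x)
      (by rw [card_erase_of_mem hxI]; simp)
      ((F.filter fun A => x ∈ A).image fun S => S.erase x) ?_ ?_
    · rw [show n - t - 1 = n - 1 - t by omega, show k - t - 1 = k - 1 - t by omega]
      exact key
    · intro S hS
      obtain ⟨A, hA, rfl⟩ := mem_image.1 hS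
      obtain ⟨hA, hxA⟩ := mem_filter.1 hA
      obtain ⟨h1, h2⟩ := mem_powersetCard.1 (hF hA)
      exact mem_powersetCard.2 ⟨erase_subset_erase _ h1, by rw [card_erase_of_mem hxA, h2]⟩
    · intro S hS T hT
      obtain ⟨A, hA, rfl⟩ := mem_image.1 hS
      obtain ⟨hA, hxA⟩ := mem_filter.1 hA
      obtain ⟨C, hC, rfl⟩ := mem_image.1 hT
      obtain ⟨hC, hxC⟩ := mem_filter.1 hC
      have e : A.erase x ∩ C.erase x = (A ∩ C).erase x := by
        ext y; simp only [mem_inter, mem_erase]; tauto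
      simp only [e]
      have hxAC : x ∈ A ∩ C := mem_inter.2 ⟨hxA, hxC⟩
      rw [card_erase_of_mem hxAC]
      by_contra hcon
      have h0 := hint A hA C hC
      have hAk := mem_powersetCard.1 (hF hA)
      have hCk := mem_powersetCard.1 (hF hC)
      have h1 := card_union_add_card_inter A C
      have : ¬ (Finset.Icc 1 x ⊆ A ∪ C) := by
        intro h
        have := card_le_card h
        simp at this
        omega
      obtain ⟨j, hj1, hj2⟩ := not_subset.1 this
      rw [mem_Icc] at hj1
      rw [mem_union, not_or] at hj2
      have hjx : j < x := lt_of_le_of_ne hj1.2 (fun h => hj2.1 (h ▸ hxA))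
      have hA' := hshift A hA _ (insert_subset (by simp; omega)
        ((erase_subset _ _).trans hAk.1)) (shiftPrec_swap hxA hj2.1 hjx)
      have h2 := hint _ hA' C hC
      have h3 : insert j (A.erase x) ∩ C = (A ∩ C).erase x := by
        rw [insert_inter_of_notMem hj2.2]
        ext y; simp only [mem_inter, mem_erase]; tauto
      rw [h3, card_erase_of_mem hxAC] at h2
      exact hcon h2
end
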